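/- Let n ∈ {2,3,4}. A glueing datum of dimension n consists of: a finite nonempty index set I (indexing copies Δ_i of the standard n-simplex, realized as {x : {0,…,n} → [0,∞) | Σ_v x_v = 1}, with vertices labeled 0,…,n); a fixed-point-free involution P of the set I × {0,…,n} of codimension-1 faces, where (i,k) denotes the face {x ∈ Δ_i | x_k = 0}; and, for each face (i,k) with P(i,k) = (j,l), a bijection φ_{(i,k)} : {0,…,n}∖{k} → {0,…,n}∖{l}, subject to φ_{(j,l)} = φ_{(i,k)}⁻¹. Let X be the quotient of the disjoint union of the Δ_i by the identifications which, for each (i,k) with P(i,k) = (j,l), identify each point x of the face (i,k) with the point y of the face (j,l) given by y_{φ_{(i,k)}(a)} = x_a for a ≠ k and y_l = 0, with the quotient topology; let X* be X minus the images of the vertices of all the Δ_i; let X^∂ be the quotient of the disjoint union of the truncated simplices Δ_i^∂ = {x ∈ Δ_i : x_v ≤ 3/4 for all v} by the restrictions of the same identifications, and let ∂X^∂ ⊆ X^∂ be the image of the set of points having some barycentric coordinate equal to 3/4. Then: X* is a topological n-manifold (every point has an open neighborhood homeomorphic to ℝⁿ) if and only if X^∂ is a topological n-manifold with boundary (every point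 has an open neighborhood homeomorphic to an open subset of the half-space ℝ^{n−1} × [0,∞)); and in this case X* is homeomorphic to X^∂ ∖ ∂X^∂. -/

import Mathlib

open scoped Classical

noncomputable section

/-- A glueing datum of dimension `n`: a finite nonempty set `I` indexing copies of the
standard `n`-simplex, a fixed-point-free involution `P` of the set `I × Fin (n+1)` of
codimension-1 faces (the face `(i,k)` of the `i`-th simplex being opposite to the vertex
`k`), and for each face `(i,k)` with `P (i,k) = (j,l)` a simplicial identification,
encoded as a permutation `glue (i,k)` of the vertex labels sending `k` to `l` (its
restriction to `{0,…,n} \ {k}` is the bijection `φ_{(i,k)}` onto `{0,…,n} \ {l}`),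
subject to `φ_{P f} = (φ f)⁻¹`. -/
structure GlueingDatum (n : ℕ) where
  I : Type
  fintypeI : Fintype I
  nonemptyI : Nonempty I
  P : I × Fin (n + 1) → I × Fin (n + 1)
  P_involutive : ∀ f, P (P f) = f
  P_fixedPointFree : ∀ f, P f ≠ f
  glue : I × Fin (n + 1) → Equiv.Perm (Fin (n + 1))
  glue_face : ∀ f, glue f f.2 = (P f).2
  glue_symm : ∀ f, glue (P f) = (glue f).symm

/-- The permutation of `Fin n` obtained from a permutation `e` of `Fin (n+1)` by
deleting `k` from the source and `e k` from the target, conjugating by the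
order-preserving bijections `{0,…,n} \ {k} ≃ {1,…,n}` and `{0,…,n} \ {e k} ≃ {1,…,n}`. -/
def restrictPerm {n : ℕ} (e : Equiv.Perm (Fin (n + 1))) (k : Fin (n + 1)) :
    Equiv.Perm (Fin n) :=
  (finSuccAboveEquiv k).trans
    ((e.subtypeEquiv (fun _ => (not_congr e.apply_eq_iff_eq).symm)).trans
      (finSuccAboveEquiv (e k)).symm)

/-- The signature of the face-pairing `e` at the face opposite to `k`. -/
def glueSign {n : ℕ} (e : Equiv.Perm (Fin (n + 1))) (k : Fin (n + 1)) : ℤˣ :=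
  Equiv.Perm.sign (restrictPerm e k)

/-- Condition Ori: the simplices can be given signs so that every face-pairing
reverses the induced orientation. -/
def Ori {n : ℕ} (D : GlueingDatum n) : Prop :=
  ∃ ε : D.I → ℤˣ, ∀ (i : D.I) (k : Fin (n + 1)),
    ε i * (-1) ^ (k : ℕ) * glueSign (D.glue (i, k)) k
      = -(ε (D.P (i, k)).1 * (-1) ^ (((D.P (i, k)).2 : Fin (n + 1)) : ℕ))

/-- Condition Dir: the edges of the simplices can be directed compatibly with all the
face-pairings. -/
def Dir {n : ℕ} (D : GlueingDatum n) : Prop :=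
  ∃ o : D.I → Fin (n + 1) → Fin (n + 1) → Prop,
    (∀ i a b, a ≠ b → Xor' (o i a b) (o i b a)) ∧
    (∀ (i : D.I) (k a b : Fin (n + 1)), a ≠ k → b ≠ k → a ≠ b →
      (o i a b ↔ o (D.P (i, k)).1 (D.glue (i, k) a) (D.glue (i, k) b)))

/-- The standard `n`-simplex, in barycentric coordinates. -/
abbrev Delta (n : ℕ) : Type :=
  {x : Fin (n + 1) → ℝ // (∀ v, 0 ≤ x v) ∧ ∑ v, x v = 1}

/-- The disjoint union of the simplices `Δ_i`, `i ∈ I`. -/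
abbrev GlueTotal {n : ℕ} (D : GlueingDatum n) : Type := Σ _ : D.I, Delta n

/-- The identifications: for each face `(i,k)` with `P (i,k) = (j,l)`, every point `x`
of the face `(i,k)` (i.e. with `x k = 0`) is identified with the point `y = x ∘ φ⁻¹` of
the face `(j,l)`, which satisfies `y (φ a) = x a` for `a ≠ k` and `y l = 0`. -/
def glueRel {n : ℕ} (D : GlueingDatum n) : GlueTotal D → GlueTotal D → Prop :=
  fun p q => ∃ k : Fin (n + 1), p.2.1 k = 0 ∧ (D.P (p.1, k)).1 = q.1 ∧
    (q.2.1 : Fin (n + 1) → ℝ) = p.2.1 ∘ ⇑(D.glue (p.1, k)).symm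

/-- The glued space `X = S/P`, with the quotient topology. -/
abbrev GlueSpace {n : ℕ} (D : GlueingDatum n) : Type := Quot (glueRel D)

/-- The image in `X` of the vertices of the simplices. -/
def vertexImage {n : ℕ} (D : GlueingDatum n) : Set (GlueSpace D) :=
  {z | ∃ p : GlueTotal D, (∃ v, p.2.1 v = 1) ∧ Quot.mk (glueRel D) p = z}

/-- The space `X* = X ∖ {vertices}`, with the subspace topology. -/
abbrev GlueSpaceStar {n : ℕ} (D : GlueingDatum n) : Type := ↥((vertexImage D)ᶜ)

/-- Local euclideanness: every point has an open neighborhood homeomorphic to `ℝⁿ`. -/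
def LocEuclidean (n : ℕ) (Z : Type) [TopologicalSpace Z] : Prop :=
  ∀ z : Z, ∃ U : Set Z, IsOpen U ∧ z ∈ U ∧
    Nonempty (↥U ≃ₜ EuclideanSpace ℝ (Fin n))

/-- The truncated standard `n`-simplex `Δ^∂`: the points of the simplex all of whose
barycentric coordinates are at most `3/4` (the simplex minus the open stars of its
vertices). -/
abbrev DeltaTrunc (n : ℕ) : Type :=
  {x : Fin (n + 1) → ℝ // ((∀ v, 0 ≤ x v) ∧ ∑ v, x v = 1) ∧ ∀ v, x v ≤ 3 / 4}

/-- The disjoint union of the truncated simplices. -/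
abbrev TruncTotal {n : ℕ} (D : GlueingDatum n) : Type := Σ _ : D.I, DeltaTrunc n

/-- The restrictions to the truncated simplices of the identifications defining `X`. -/
def truncRel {n : ℕ} (D : GlueingDatum n) : TruncTotal D → TruncTotal D → Prop :=
  fun p q => ∃ k : Fin (n + 1), p.2.1 k = 0 ∧ (D.P (p.1, k)).1 = q.1 ∧
    (q.2.1 : Fin (n + 1) → ℝ) = p.2.1 ∘ ⇑(D.glue (p.1, k)).symm

/-- The space `X^∂` obtained by glueing the truncated simplices, with the quotient
topology. -/
abbrev TruncSpace {n : ℕ} (D : GlueingDatum n) : Type := Quot (truncRel D)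

/-- The subset `∂X^∂ ⊆ X^∂`: the image of the points having some barycentric
coordinate equal to `3/4`. -/
def truncBoundary {n : ℕ} (D : GlueingDatum n) : Set (TruncSpace D) :=
  {z | ∃ p : TruncTotal D, (∃ v, p.2.1 v = 3 / 4) ∧ Quot.mk (truncRel D) p = z}

/-- Being a topological `n`-manifold with boundary: every point has an open
neighborhood homeomorphic to an open subset of the half-space `ℝ^{n-1} × [0,∞)`. -/
def LocHalfEuclidean (n : ℕ) (Z : Type) [TopologicalSpace Z] : Prop :=
  ∀ z : Z, ∃ U : Set Z, IsOpen U ∧ z ∈ U ∧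
    ∃ V : Set ((Fin (n - 1) → ℝ) × ↥(Set.Ici (0 : ℝ))), IsOpen V ∧
      Nonempty (↥U ≃ₜ ↥V)

namespace GlueAux
open Set Filter Topology MeasureTheory

/-- Euclidean space. -/
abbrev Eu (m : ℕ) : Type := EuclideanSpace ℝ (Fin m)

/-- Lagrange weights expressing `det (1 + A)` through `det (1 + t A)` for small `t`. -/
theorem det_lagrange (m : ℕ) (t0 : ℝ) (ht0 : 0 < t0) :
    ∃ (t L : Fin (m + 1) → ℝ), (∀ j, 0 < t j ∧ t j ≤ t0) ∧ ∑ j, L j = 1 ∧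
      ∀ A : EuclideanSpace ℝ (Fin m) →L[ℝ] EuclideanSpace ℝ (Fin m),
        (1 + A).det = ∑ j, L j * (1 + t j • A).det := by
  let t : Fin (m + 1) → ℝ := fun j => t0 / (j + 1)
  have hinj : Function.Injective t := by
    intro i j hij
    have h1 : (i : ℝ) + 1 = j + 1 := by
      have hi : (0 : ℝ) < (i : ℝ) + 1 := by positivity
      have hj : (0 : ℝ) < (j : ℝ) + 1 := by positivity
      simp only [t] at hij
      field_simp at hij
      linarith
    have h2 : (i : ℝ) = (j : ℝ) := by linarith
    exact Fin.ext (by exact_mod_cast h2)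
  let L : Fin (m + 1) → ℝ := fun j => (Lagrange.basis Finset.univ t j).eval 1
  have key : ∀ p : Polynomial ℝ, p.natDegree ≤ m → p.eval 1 = ∑ j, L j * p.eval (t j) := by
    intro p hp
    have hd : p.degree < ((Finset.univ : Finset (Fin (m + 1))).card : WithBot ℕ) := by
      refine lt_of_le_of_lt Polynomial.degree_le_natDegree ?_
      simp only [Finset.card_univ, Fintype.card_fin]
      exact_mod_cast Nat.lt_succ_of_le hp
    have h := Lagrange.eq_interpolate (s := Finset.univ) (v := t) hinj.injOn hd
    conv_lhs => rw [h]
    rw [Lagrange.interpolate_apply, Polynomial.eval_finsetSum]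
    refine Finset.sum_congr rfl fun j _ => ?_
    simp [L, mul_comm]
  refine ⟨t, L, ?_, ?_, ?_⟩
  · intro j
    refine ⟨by positivity, ?_⟩
    exact div_le_self ht0.le (by linarith [show (0:ℝ) ≤ (j:ℝ) by positivity])
  · have := key 1 (by simp)
    simpa using this.symm
  · intro A
    let b := (EuclideanSpace.basisFun (Fin m) ℝ).toBasis
    let M := LinearMap.toMatrix b b (A : EuclideanSpace ℝ (Fin m) →ₗ[ℝ] _)
    let p : Polynomial ℝ := Matrix.det ((Polynomial.X : Polynomial ℝ) • M.map Polynomial.C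
      + (1 : Matrix (Fin m) (Fin m) ℝ).map Polynomial.C)
    have hp : ∀ s : ℝ, p.eval s = (1 + s • A).det := by
      intro s
      rw [ContinuousLinearMap.det, ← LinearMap.det_toMatrix b]
      simp only [p]
      rw [← Polynomial.coe_evalRingHom, RingHom.map_det]
      congr 1
      have : LinearMap.toMatrix b b ((1 + s • A : EuclideanSpace ℝ (Fin m) →L[ℝ] EuclideanSpace ℝ (Fin m)) : EuclideanSpace ℝ (Fin m) →ₗ[ℝ] _)
          = 1 + s • M := by
        simp only [M, ContinuousLinearMap.toLinearMap_add, ContinuousLinearMap.toLinearMap_smul, map_add, map_smul]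
        congr 1
        exact LinearMap.toMatrix_one b
      rw [this]
      ext i j
      by_cases hij : i = j
      · subst hij; simp; ring
      · simp [hij]; ring
    have hdeg : p.natDegree ≤ m := by
      have := Polynomial.natDegree_det_X_add_C_le M (1 : Matrix (Fin m) (Fin m) ℝ)
      rw [Fintype.card_fin] at this
      exact this
    have := key p hdeg
    rw [hp 1] at this
    simp only [one_smul] at this
    rw [this]
    exact Finset.sum_congr rfl fun j _ => by rw [hp]


/-- A `C¹` map which is the identity on the unit sphere preserves the (signed) volume. -/
theorem det_integral (m : ℕ) (hm : 1 ≤ m) (r : Eu m → Eu m)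
    (hr : ContDiff ℝ 1 r) (h2 : ∀ x, ‖x‖ = 1 → r x = x) :
    ∫ x in Metric.ball (0 : Eu m) 1, (fderiv ℝ r x).det =
      (volume : Measure (Eu m)).real (Metric.ball (0 : Eu m) 1) := by
  obtain ⟨e0, he0⟩ : ∃ e : Eu m, ‖e‖ = 1 :=
    ⟨EuclideanSpace.single (⟨0, hm⟩ : Fin m) (1 : ℝ), by simp⟩
  let B : Set (Eu m) := Metric.ball 0 1
  let W : (Eu m) → (Eu m) := fun x => r x - x
  have hW : ContDiff ℝ 1 W := hr.sub contDiff_id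
  have hWd : Differentiable ℝ W := hW.differentiable (by norm_num)
  have hWc : Continuous (fderiv ℝ W) := hW.continuous_fderiv (by norm_num)
  obtain ⟨K, hK⟩ := (isCompact_closedBall (0 : (Eu m)) 1).exists_bound_of_continuousOn
    (f := fderiv ℝ W) hWc.continuousOn
  have hK0 : 0 ≤ K := (norm_nonneg _).trans (hK 0 (by simp))
  have hlipW : ∀ x ∈ Metric.closedBall (0 : (Eu m)) 1, ∀ y ∈ Metric.closedBall (0 : (Eu m)) 1,
      ‖W x - W y‖ ≤ K * ‖x - y‖ := fun x hx y hy =>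
    (convex_closedBall (0 : (Eu m)) 1).norm_image_sub_le_of_norm_fderiv_le
      (fun z _ => hWd z) (fun z hz => hK z hz) hy hx
  let w : (Eu m) → (Eu m) := fun x => if ‖x‖ ≤ 1 then W x else 0
  have hbd : ∀ x, ‖x‖ = 1 → W x = 0 := fun x hx => by simp [W, h2 x hx]
  have hmix : ∀ x y : (Eu m), ‖x‖ ≤ 1 → 1 ≤ ‖y‖ → ‖W x‖ ≤ K * ‖x - y‖ := by
    intro x y hx hy
    have h3 : ‖y‖ - ‖x‖ ≤ ‖x - y‖ := by
      rw [norm_sub_rev]; exact norm_sub_norm_le y x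
    have h4 : ‖W x‖ ≤ K * (1 - ‖x‖) := by
      by_cases hx0 : x = 0
      · subst hx0
        have := hlipW 0 (by simp) e0 (by simp [he0])
        rw [hbd _ he0] at this
        simpa [he0] using this
      · have hn : 0 < ‖x‖ := norm_pos_iff.2 hx0
        have hz : ‖‖x‖⁻¹ • x‖ = 1 := by
          rw [norm_smul, norm_inv, norm_norm, inv_mul_cancel₀ hn.ne']
        have := hlipW x (by simpa using hx) (‖x‖⁻¹ • x) (by simp [hz])
        rw [hbd _ hz, sub_zero] at this
        refine this.trans (le_of_eq ?_)
        congr 1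
        have : x - ‖x‖⁻¹ • x = (1 - ‖x‖⁻¹) • x := by rw [sub_smul, one_smul]
        rw [this, norm_smul, Real.norm_eq_abs, abs_of_nonpos]
        · field_simp; ring
        · rw [sub_nonpos]; exact (one_le_inv₀ hn).2 hx
    refine h4.trans (mul_le_mul_of_nonneg_left ?_ hK0)
    linarith
  have hlip : ∀ x y, ‖w x - w y‖ ≤ K * ‖x - y‖ := by
    intro x y
    by_cases hx : ‖x‖ ≤ 1 <;> by_cases hy : ‖y‖ ≤ 1
    · simp only [w, hx, hy, if_true]
      exact hlipW x (by simpa using hx) y (by simpa using hy)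
    · simp only [w, hx, hy, if_true, if_false, sub_zero]
      exact hmix x y hx (not_le.1 hy).le
    · simp only [w, hx, hy, if_true, if_false, zero_sub, norm_neg]
      rw [norm_sub_rev x y]
      exact hmix y x hy (not_le.1 hx).le
    · simp only [w, hx, hy, if_false, sub_zero, norm_zero]
      positivity
  -- positivity of the determinant
  have hpos : ∀ᶠ t in 𝓝 (0 : ℝ), ∀ x ∈ Metric.closedBall (0 : (Eu m)) 1,
      0 < (1 + t • fderiv ℝ W x).det := by
    have hcont : Continuous fun q : ℝ × (Eu m) => (1 + q.1 • fderiv ℝ W q.2).det := by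
      refine ContinuousLinearMap.continuous_det.comp ?_
      exact continuous_const.add (continuous_fst.smul (hWc.comp continuous_snd))
    refine (isCompact_closedBall (0 : (Eu m)) 1).eventually_forall_of_forall_eventually ?_
    intro x _
    have h0 : (0 : ℝ) < (1 + (0 : ℝ) • fderiv ℝ W x).det := by
      simp [ContinuousLinearMap.det]
    exact (hcont.tendsto (0, x)).eventually (lt_mem_nhds h0)
  obtain ⟨δ, hδ, hδpos⟩ := Metric.eventually_nhds_iff.1 hpos
  let t0 : ℝ := min (δ / 2) (1 / (2 * (K + 1)))
  have ht0 : 0 < t0 := lt_min (by positivity) (by positivity)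
  have hvol : ∀ t : ℝ, 0 < t → t ≤ t0 →
      ∫ x in B, (1 + t • fderiv ℝ W x).det = (volume : Measure (Eu m)).real B := by
    intro t ht htt
    have htδ : t ≤ δ / 2 := htt.trans (min_le_left _ _)
    have htK : t ≤ 1 / (2 * (K + 1)) := htt.trans (min_le_right _ _)
    have htK2 : t * K ≤ 1 / 2 := by
      rw [le_div_iff₀ (by positivity)] at htK
      nlinarith
    let F : (Eu m) → (Eu m) := fun x => x + t • w x
    have happ : ApproximatesLinearOn F ((ContinuousLinearEquiv.refl ℝ (Eu m) : (Eu m) ≃L[ℝ] (Eu m)) : (Eu m) →L[ℝ] (Eu m))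
        univ (1 / 2) := by
      intro x _ y _
      have : F x - F y - ((ContinuousLinearEquiv.refl ℝ (Eu m) : (Eu m) ≃L[ℝ] (Eu m)) : (Eu m) →L[ℝ] (Eu m)) (x - y)
          = t • (w x - w y) := by
        simp only [F, ContinuousLinearEquiv.coe_refl, ContinuousLinearMap.coe_id', id_eq, smul_sub]
        abel
      rw [this, norm_smul, Real.norm_eq_abs, abs_of_pos ht]
      calc t * ‖w x - w y‖ ≤ t * (K * ‖x - y‖) := mul_le_mul_of_nonneg_left (hlip x y) ht.le
        _ = (t * K) * ‖x - y‖ := by ring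
        _ ≤ (1 / 2) * ‖x - y‖ := mul_le_mul_of_nonneg_right htK2 (norm_nonneg _)
        _ = _ := by norm_num
    have hN : Subsingleton (Eu m) ∨ (1 / 2 : NNReal) <
        ‖((ContinuousLinearEquiv.refl ℝ (Eu m)).symm : (Eu m) →L[ℝ] (Eu m))‖₊⁻¹ := by
      rcases subsingleton_or_nontrivial (Eu m) with h | h
      · exact Or.inl h
      · right
        have : ‖((ContinuousLinearEquiv.refl ℝ (Eu m)).symm : (Eu m) →L[ℝ] (Eu m))‖₊ = 1 := by
          have : ((ContinuousLinearEquiv.refl ℝ (Eu m)).symm : (Eu m) →L[ℝ] (Eu m))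
            = ContinuousLinearMap.id ℝ (Eu m) := rfl
          rw [this]
          exact ContinuousLinearMap.nnnorm_id
        rw [this, inv_one]
        rw [← NNReal.coe_lt_coe]; norm_num
    have hsurj : Function.Surjective F := happ.surjective hN
    have hinj : Function.Injective F := injOn_univ.1 (happ.injOn hN)
    have hout : ∀ x, 1 ≤ ‖x‖ → F x = x := by
      intro x hx
      have : w x = 0 := by
        by_cases h : ‖x‖ ≤ 1
        · simp only [w, h, if_true]; exact hbd x (le_antisymm h hx)
        · simp [w, h]
      simp [F, this]
    have himg : F '' B = B := by
      apply Subset.antisymm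
      · rintro _ ⟨x, hx, rfl⟩
        by_contra hc
        have hc' : 1 ≤ ‖F x‖ := by simpa [B] using hc
        have := hinj (hout _ hc')
        rw [this] at hc'
        have hx' : ‖x‖ < 1 := by simpa [B] using hx
        linarith
      · intro y hy
        obtain ⟨x, rfl⟩ := hsurj y
        refine ⟨x, ?_, rfl⟩
        by_contra hc
        have hc' : 1 ≤ ‖x‖ := by simpa [B] using hc
        rw [hout x hc'] at hy
        exact hc hy
    have hder : ∀ x ∈ B, HasFDerivWithinAt F (1 + t • fderiv ℝ W x) B x := by
      intro x hx
      have h5 : HasFDerivAt (fun x => x + t • W x) (1 + t • fderiv ℝ W x) x :=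
        (hasFDerivAt_id x).add ((hWd x).hasFDerivAt.const_smul t)
      refine h5.hasFDerivWithinAt.congr ?_ ?_
      · intro y hy
        have : ‖y‖ ≤ 1 := by
          have : ‖y‖ < 1 := by simpa [B] using hy
          exact this.le
        simp [F, w, this]
      · have : ‖x‖ ≤ 1 := by
          have : ‖x‖ < 1 := by simpa [B] using hx
          exact this.le
        simp [F, w, this]
    have := integral_image_eq_integral_abs_det_fderiv_smul (volume : Measure (Eu m))
      (measurableSet_ball) hder hinj.injOn (fun _ => (1 : ℝ))
    rw [himg] at this
    simp only [smul_eq_mul, mul_one, integral_const, measureReal_restrict_apply_univ] at this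
    rw [this]
    refine setIntegral_congr_fun measurableSet_ball fun x hx => ?_
    have : 0 < (1 + t • fderiv ℝ W x).det := by
      apply hδpos
      · rw [Real.dist_eq, sub_zero, abs_of_pos ht]; linarith
      · exact Metric.ball_subset_closedBall hx
    exact (abs_of_pos this).symm
  obtain ⟨t, L, ht, hL, hdet⟩ := det_lagrange m t0 ht0
  have hintg : ∀ s : ℝ, IntegrableOn (fun x => (1 + s • fderiv ℝ W x).det) B := by
    intro s
    have hcont : Continuous fun x : (Eu m) => (1 + s • fderiv ℝ W x).det := by
      refine ContinuousLinearMap.continuous_det.comp ?_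
      exact continuous_const.add (hWc.const_smul s)
    exact (hcont.continuousOn.integrableOn_compact (isCompact_closedBall (0 : (Eu m)) 1)).mono_set
      Metric.ball_subset_closedBall
  have hfin : ∫ x in B, (1 + fderiv ℝ W x).det = (volume : Measure (Eu m)).real B := by
    have : ∀ x, (1 + fderiv ℝ W x).det = ∑ j, L j * (1 + t j • fderiv ℝ W x).det :=
      fun x => hdet _
    simp_rw [this]
    rw [integral_finsetSum]
    · simp_rw [integral_const_mul]
      rw [Finset.sum_congr rfl fun j _ => by rw [hvol (t j) (ht j).1 (ht j).2], ← Finset.sum_mul,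
        hL, one_mul]
    · intro j _
      exact (hintg (t j)).const_mul _
  rw [← hfin]
  refine setIntegral_congr_fun measurableSet_ball fun x _ => ?_
  have hd : fderiv ℝ W x = fderiv ℝ r x - 1 := by
    have h6 : HasFDerivAt W (fderiv ℝ r x - ContinuousLinearMap.id ℝ (Eu m)) x :=
      ((hr.differentiable (by norm_num)) x).hasFDerivAt.sub (hasFDerivAt_id x)
    exact h6.fderiv
  simp only [hd, add_sub_cancel]

/-- The derivative of a map into the unit sphere is degenerate. -/
theorem det_zero_of_unit (m : ℕ) (r : Eu m → Eu m) (x : Eu m)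
    (hr : DifferentiableAt ℝ r x) (h1 : ∀ᶠ y in 𝓝 x, ‖r y‖ = 1) : (fderiv ℝ r x).det = 0 := by
  by_contra hne
  have h1x : ‖r x‖ = 1 := h1.self_of_nhds
  have hunit : IsUnit (LinearMap.det ((fderiv ℝ r x : (Eu m) →L[ℝ] (Eu m)) : (Eu m) →ₗ[ℝ] (Eu m))) :=
    isUnit_iff_ne_zero.2 hne
  have hsurj : Function.Surjective (fderiv ℝ r x) := by
    have := (LinearMap.isUnit_iff_isUnit_det _).2 hunit
    exact ((Module.End.isUnit_iff _).1 this).2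
  obtain ⟨v, hv⟩ := hsurj (r x)
  have h7 : HasFDerivAt (fun y => inner ℝ (r y) (r y))
      ((fderivInnerCLM ℝ (r x, r x)).comp ((fderiv ℝ r x).prod (fderiv ℝ r x))) x :=
    hr.hasFDerivAt.inner ℝ hr.hasFDerivAt
  have h8 : (fun y => inner ℝ (r y) (r y)) =ᶠ[𝓝 x] fun _ => (1 : ℝ) := by
    filter_upwards [h1] with y hy
    rw [real_inner_self_eq_norm_sq, hy]; norm_num
  have h9 := (h7.congr_of_eventuallyEq h8.symm).unique (hasFDerivAt_const (1 : ℝ) x)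
  have h10 := congrArg (fun T => T v) h9
  simp only [ContinuousLinearMap.coe_comp, Function.comp_apply, ContinuousLinearMap.prod_apply,
    fderivInnerCLM_apply, hv, real_inner_self_eq_norm_sq, h1x] at h10
  norm_num at h10

theorem volume_unit_ball_pos (m : ℕ) :
    0 < (volume : Measure (Eu m)).real (Metric.ball (0 : Eu m) 1) :=
  ENNReal.toReal_pos (Metric.measure_ball_pos _ _ one_pos).ne' measure_ball_lt_top.ne

/-- There is no `C¹` map into the unit sphere which is the identity on the unit sphere. -/
theorem no_smooth_retraction (m : ℕ) (r : Eu m → Eu m)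
    (hr : ContDiff ℝ 1 r) (h1 : ∀ x, ‖r x‖ = 1) (h2 : ∀ x, ‖x‖ = 1 → r x = x) : False := by
  rcases Nat.eq_zero_or_pos m with rfl | hm
  · have := h1 0
    rw [Subsingleton.elim (r 0) 0, norm_zero] at this
    norm_num at this
  · have h := det_integral m hm r hr h2
    rw [setIntegral_congr_fun measurableSet_ball (fun x _ => det_zero_of_unit m r x
      ((hr.differentiable (by norm_num)) x) (Eventually.of_forall h1))] at h
    simp only [integral_zero] at h
    linarith [volume_unit_ball_pos m]

end GlueAux

namespace GlueAux
open Set Filter Topology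

/-- A continuous self-map of the unit ball fixing the sphere pointwise hits the centre. -/
theorem brouwer_unit (m : ℕ) (f : Eu m → Eu m)
    (hf : ContinuousOn f (Metric.closedBall 0 1)) (h1 : ∀ x, ‖x‖ = 1 → f x = x) :
    ∃ x ∈ Metric.closedBall (0 : Eu m) 1, f x = 0 := by
  by_contra hcon
  push Not at hcon
  let pr : Eu m → Eu m := fun x => (max 1 ‖x‖)⁻¹ • x
  have hmax : ∀ x : Eu m, 0 < max 1 ‖x‖ := fun x => lt_of_lt_of_le one_pos (le_max_left _ _)
  have hprc : Continuous pr :=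
    ((continuous_const.max continuous_norm).inv₀ fun x => (hmax x).ne').smul continuous_id
  have hprn : ∀ x, pr x ∈ Metric.closedBall (0 : Eu m) 1 := by
    intro x
    simp only [pr, mem_closedBall_zero_iff, norm_smul, norm_inv, Real.norm_eq_abs,
      abs_of_pos (hmax x)]
    rw [inv_mul_le_iff₀ (hmax x), mul_one]
    exact le_max_right _ _
  have hpr1 : ∀ x, ‖x‖ ≤ 1 → pr x = x := fun x hx => by simp [pr, max_eq_left hx]
  have hpr2 : ∀ x, 1 ≤ ‖x‖ → ‖pr x‖ = 1 := fun x hx => by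
    have : 0 < ‖x‖ := by linarith
    simp [pr, max_eq_right hx, norm_smul, this.ne']
  let ft : Eu m → Eu m := fun x => f (pr x) + (x - pr x)
  have hftc : Continuous ft := (hf.comp_continuous hprc hprn).add (continuous_id.sub hprc)
  have hft1 : ∀ x, 1 ≤ ‖x‖ → ft x = x := fun x hx => by
    simp only [ft, h1 _ (hpr2 x hx)]; abel
  have hft0 : ∀ x, ft x ≠ 0 := by
    intro x
    rcases le_total ‖x‖ 1 with h | h
    · simp only [ft, hpr1 x h, sub_self, add_zero]
      exact hcon x (by simpa using h)
    · rw [hft1 x h]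
      intro h0
      rw [h0, norm_zero] at h
      linarith
  let f2 : Eu m → Eu m := fun x => (1 / 2 : ℝ) • ft ((2 : ℝ) • x)
  have hf2c : Continuous f2 := (hftc.comp (continuous_const_smul 2)).const_smul (1 / 2 : ℝ)
  have hf21 : ∀ x, 1 / 2 ≤ ‖x‖ → f2 x = x := by
    intro x hx
    simp only [f2]
    rw [hft1, smul_smul]
    · norm_num
    · rw [norm_smul]; norm_num; linarith
  have hf20 : ∀ x, 0 < ‖f2 x‖ := by
    intro x
    rw [norm_pos_iff]
    exact smul_ne_zero (by norm_num) (hft0 _)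
  obtain ⟨g, hg, hgd, hgs, -⟩ := hf2c.exists_contDiff_approx_and_eqOn 1 (ε := fun x => ‖f2 x‖)
    hf2c.norm hf20 (S := Metric.sphere (0 : Eu m) 1) (U := {x | 1 / 2 < ‖x‖})
    Metric.isClosed_sphere
    ((isOpen_lt continuous_const continuous_norm).mem_nhdsSet.2 (by
      intro x hx
      have : ‖x‖ = 1 := by simpa using hx
      simp only [mem_ofPred_eq, this]; norm_num))
    (contDiffOn_id.congr fun x hx => hf21 x (le_of_lt hx))
  have hg0 : ∀ x, g x ≠ 0 := by
    intro x h0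
    have := hgd x
    simp [h0] at this
  refine no_smooth_retraction m (fun x => ‖g x‖⁻¹ • g x) ?_ ?_ ?_
  · have hg' : ContDiff ℝ 1 g := hg
    exact ((hg'.norm ℝ hg0).inv fun x => norm_ne_zero_iff.2 (hg0 x)).smul hg'
  · intro x
    simp [norm_smul, hg0 x]
  · intro x hx
    have : g x = x := by
      rw [hgs (by simpa using hx)]
      exact hf21 x (by rw [hx]; norm_num)
    simp [this, hx]

theorem brouwer_ball (m : ℕ) (x0 : Eu m) (ρ : ℝ) (hρ : 0 < ρ) (f : Eu m → Eu m)
    (hf : ContinuousOn f (Metric.closedBall x0 ρ)) (h1 : ∀ x, ‖x - x0‖ = ρ → f x = x) :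
    ∃ x ∈ Metric.closedBall x0 ρ, f x = x0 := by
  have hmem : ∀ x : Eu m, x ∈ Metric.closedBall (0 : Eu m) 1 →
      x0 + ρ • x ∈ Metric.closedBall x0 ρ := by
    intro x hx
    have hx' : ‖x‖ ≤ 1 := by simpa using hx
    rw [mem_closedBall_iff_norm, add_sub_cancel_left, norm_smul, Real.norm_eq_abs, abs_of_pos hρ]
    nlinarith
  obtain ⟨x, hx, h⟩ := brouwer_unit m (fun x => ρ⁻¹ • (f (x0 + ρ • x) - x0)) (by
    have hc : ContinuousOn (fun x => f (x0 + ρ • x)) (Metric.closedBall (0 : Eu m) 1) :=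
      hf.comp (Continuous.continuousOn (f := fun x : Eu m => x0 + ρ • x) (by fun_prop)) hmem
    exact (hc.sub (continuousOn_const (c := x0))).const_smul ρ⁻¹) (by
    intro x hx
    rw [h1]
    · rw [add_sub_cancel_left, smul_smul, inv_mul_cancel₀ hρ.ne', one_smul]
    · rw [add_sub_cancel_left, norm_smul, hx, Real.norm_eq_abs, abs_of_pos hρ, mul_one])
  refine ⟨_, hmem x hx, ?_⟩
  have := (smul_eq_zero.1 h).resolve_left (inv_ne_zero hρ.ne')
  exact sub_eq_zero.1 this

/-- Perturbing a map into a bigger-dimensional space off the origin. -/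
theorem ext_nonzero (a b : ℕ) (hab : b < a) (g : Eu b → Eu a) (hg : Continuous g) (δ : ℝ)
    (hδ : 0 < δ) : ∃ f : Eu b → Eu a, Continuous f ∧ (∀ x, f x ≠ 0) ∧
      (∀ x, δ ≤ ‖g x‖ → f x = g x) ∧ (∀ x, f x = g x ∨ ‖f x‖ < 2 * δ) := by
  obtain ⟨P, hP, hPd, -⟩ := hg.exists_contDiff_approx 1 (ε := fun _ => δ / 4) continuous_const
    (fun _ => by positivity)
  have hdense := ContDiff.dense_compl_range_of_finrank_lt_finrank (f := P) hP (by simpa using hab)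
  obtain ⟨v, hv, hvd⟩ := hdense.exists_dist_lt (0 : Eu a) (show 0 < δ / 4 by positivity)
  have hv' : ‖v‖ < δ / 4 := by simpa using hvd
  let h : Eu b → Eu a := fun x => P x - v
  have hh0 : ∀ x, h x ≠ 0 := fun x hx => hv ⟨x, sub_eq_zero.1 hx⟩
  have hhc : Continuous h := hP.continuous.sub continuous_const
  have hhg : ∀ x, ‖h x - g x‖ < δ / 2 := by
    intro x
    have h1 : h x - g x = (P x - g x) - v := by simp only [h]; abel
    rw [h1]
    have h2 := hPd x
    rw [dist_eq_norm] at h2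
    calc _ ≤ ‖P x - g x‖ + ‖v‖ := norm_sub_le _ _
      _ < _ := by linarith
  let lam : Eu b → ℝ := fun x => max 0 (min 1 ((‖g x‖ - δ / 2) / (δ / 2)))
  have hlc : Continuous lam := continuous_const.max (continuous_const.min
    ((hg.norm.sub continuous_const).div_const _))
  have hl0 : ∀ x, 0 ≤ lam x := fun x => le_max_left _ _
  have hl1 : ∀ x, lam x ≤ 1 := fun x => max_le (by norm_num) (min_le_left _ _)
  have hfg : ∀ x, ‖h x + lam x • (g x - h x) - g x‖ < δ / 2 := by
    intro x
    have : h x + lam x • (g x - h x) - g x = (1 - lam x) • (h x - g x) := by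
      simp only [smul_sub, sub_smul, one_smul]; abel
    rw [this, norm_smul, Real.norm_eq_abs, abs_of_nonneg (by linarith [hl1 x])]
    have := hhg x
    nlinarith [norm_nonneg (h x - g x), hl0 x]
  have heq : ∀ x, δ ≤ ‖g x‖ → h x + lam x • (g x - h x) = g x := by
    intro x hx
    have : lam x = 1 := by
      have h3 : 1 ≤ (‖g x‖ - δ / 2) / (δ / 2) := by
        rw [le_div_iff₀ (by positivity)]; linarith
      simp [lam, min_eq_left h3]
    rw [this, one_smul]; abel
  refine ⟨fun x => h x + lam x • (g x - h x), hhc.add (hlc.smul (hg.sub hhc)), ?_, heq, ?_⟩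
  · intro x hx
    rcases le_or_gt ‖g x‖ (δ / 2) with h4 | h4
    · have : lam x = 0 := by
        have h3 : (‖g x‖ - δ / 2) / (δ / 2) ≤ 0 :=
          div_nonpos_of_nonpos_of_nonneg (by linarith) (by positivity)
        simp only [lam]
        exact max_eq_left ((min_le_right _ _).trans h3)
      simp only [this, zero_smul, add_zero] at hx
      exact hh0 x hx
    · have := hfg x
      simp only at hx
      rw [hx, zero_sub, norm_neg] at this
      linarith
  · intro x
    rcases le_or_gt δ ‖g x‖ with h4 | h4
    · exact Or.inl (heq x h4)
    · right
      have h5 := hfg x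
      have h6 := norm_sub_norm_le (h x + lam x • (g x - h x)) (g x)
      simp only
      linarith

/-- Invariance of dimension, in a raw form. -/
theorem no_dim_drop (a b : ℕ) (hab : b < a) (f : Eu b → Eu a) (g : Eu a → Eu b) (x0 : Eu b)
    (W : Set (Eu b)) (hW : W ∈ 𝓝 x0) (hf : ContinuousOn f W) (V : Set (Eu a))
    (hV : V ∈ 𝓝 (f x0)) (hg : ContinuousOn g V) (hgf : ∀ x ∈ W, g (f x) = x)
    (hinj : ∀ y ∈ V, g y = x0 → y = f x0) : False := by
  obtain ⟨ε, hε, hεV⟩ := Metric.mem_nhds_iff.1 hV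
  have hfx : ContinuousAt f x0 := hf.continuousAt hW
  have h1 : {x | x ∈ W ∧ f x ∈ Metric.ball (f x0) ε} ∈ 𝓝 x0 :=
    inter_mem hW (hfx (Metric.ball_mem_nhds _ hε))
  obtain ⟨ρ, hρ, hρs⟩ := Metric.nhds_basis_closedBall.mem_iff.1 h1
  let pr : Eu b → Eu b := fun x => x0 + (ρ / max ρ ‖x - x0‖) • (x - x0)
  have hmax : ∀ x : Eu b, 0 < max ρ ‖x - x0‖ := fun x => lt_of_lt_of_le hρ (le_max_left _ _)
  have hprc : Continuous pr := continuous_const.add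
    ((continuous_const.div (continuous_const.max (continuous_id.sub continuous_const).norm)
      fun x => (hmax x).ne').smul (continuous_id.sub continuous_const))
  have hprn : ∀ x, pr x ∈ Metric.closedBall x0 ρ := by
    intro x
    simp only [pr, mem_closedBall_iff_norm, add_sub_cancel_left, norm_smul, norm_div,
      Real.norm_eq_abs, abs_of_pos (hmax x), abs_of_pos hρ]
    rw [div_mul_eq_mul_div, div_le_iff₀ (hmax x)]
    exact mul_le_mul_of_nonneg_left (le_max_right _ _) hρ.le
  have hpr1 : ∀ x, ‖x - x0‖ ≤ ρ → pr x = x := fun x hx => by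
    simp [pr, max_eq_left hx, ne_of_gt hρ]
  -- lower bound on the sphere
  have hsph : ∃ δ > 0, δ ≤ ε / 4 ∧ ∀ x, ‖x - x0‖ = ρ → δ ≤ ‖f x - f x0‖ := by
    rcases (Metric.sphere x0 ρ).eq_empty_or_nonempty with he | hne
    · refine ⟨ε / 4, by positivity, le_rfl, fun x hx => ?_⟩
      have : x ∈ Metric.sphere x0 ρ := by simpa [dist_eq_norm] using hx
      rw [he] at this
      exact this.elim
    · have hc : ContinuousOn (fun x => ‖f x - f x0‖) (Metric.sphere x0 ρ) :=
        ((hf.mono fun x hx => (hρs (Metric.sphere_subset_closedBall hx)).1).sub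
          continuousOn_const).norm
      obtain ⟨z, hz, hmin⟩ := (isCompact_sphere x0 ρ).exists_isMinOn hne hc
      have hzpos : 0 < ‖f z - f x0‖ := by
        rw [norm_pos_iff, sub_ne_zero]
        intro h
        have h2 := hgf z (hρs (Metric.sphere_subset_closedBall hz)).1
        rw [h, hgf x0 (mem_of_mem_nhds hW)] at h2
        have : dist z x0 = ρ := hz
        rw [h2, dist_self] at this
        linarith
      refine ⟨min (ε / 4) ‖f z - f x0‖, lt_min (by positivity) hzpos, min_le_left _ _,
        fun x hx => (min_le_right _ _).trans (hmin ?_)⟩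
      simpa [dist_eq_norm] using hx
  obtain ⟨δ, hδ, hδε, hδs⟩ := hsph
  obtain ⟨F, hFc, hF0, hF1, hF2⟩ := ext_nonzero a b hab (fun x => f (pr x) - f x0)
    ((hf.comp_continuous hprc fun x => (hρs (hprn x)).1).sub continuous_const) δ hδ
  have hFV : ∀ x, f x0 + F x ∈ V := by
    intro x
    apply hεV
    rw [mem_ball_iff_norm, add_sub_cancel_left]
    rcases hF2 x with h | h
    · rw [h]
      have := (hρs (hprn x)).2
      rwa [mem_ball_iff_norm] at this
    · linarith
  obtain ⟨x, _, hx0⟩ := brouwer_ball b x0 ρ hρ (fun x => g (f x0 + F x))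
    ((hg.comp_continuous (continuous_const.add hFc) hFV).continuousOn) (by
      intro x hx
      have h3 : pr x = x := hpr1 x hx.le
      have h4 : F x = f x - f x0 := by
        rw [hF1 x (by rw [h3]; exact hδs x hx), h3]
      rw [h4, add_sub_cancel, hgf]
      exact (hρs (by simp [dist_eq_norm, hx])).1)
  have := hinj _ (hFV x) hx0
  exact hF0 x (by simpa using this)

end GlueAux

namespace GlueAux
open Set Filter Topology

/-- The model half space. -/
abbrev Hs (n : ℕ) : Type := (Fin (n - 1) → ℝ) × ↥(Set.Ici (0 : ℝ))

/-- A point at which the space is locally Euclidean. -/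
def EucAt (n : ℕ) {Z : Type*} [TopologicalSpace Z] (p : Z) : Prop :=
  ∃ ψ : OpenPartialHomeomorph Z (Eu n), p ∈ ψ.source

/-- A point at which the space is locally half-Euclidean. -/
def HalfAt (n : ℕ) {Z : Type*} [TopologicalSpace Z] (p : Z) : Prop :=
  ∃ ψ : OpenPartialHomeomorph Z (Hs n), p ∈ ψ.source

variable {n : ℕ} {Z Z' : Type*} [TopologicalSpace Z] [TopologicalSpace Z']

theorem EucAt.of_oph (e : OpenPartialHomeomorph Z Z') {p : Z} (hp : p ∈ e.source)
    (h : EucAt n (e p)) : EucAt n p := by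
  obtain ⟨ψ, hψ⟩ := h
  exact ⟨e.trans ψ, by simp [hp, hψ]⟩

theorem HalfAt.of_oph (e : OpenPartialHomeomorph Z Z') {p : Z} (hp : p ∈ e.source)
    (h : HalfAt n (e p)) : HalfAt n p := by
  obtain ⟨ψ, hψ⟩ := h
  exact ⟨e.trans ψ, by simp [hp, hψ]⟩

theorem EucAt.of_openEmbedding {f : Z → Z'} (hf : IsOpenEmbedding f) (p : Z) :
    EucAt n (f p) ↔ EucAt n p := by
  have : Nonempty Z := ⟨p⟩
  let e := hf.toOpenPartialHomeomorph f
  constructor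
  · intro h
    exact EucAt.of_oph e (by simp [e]) (by simpa [e] using h)
  · intro h
    refine EucAt.of_oph e.symm (by simp [e]) ?_
    have : e.symm (f p) = p := e.left_inv (x := p) (by simp [e])
    rwa [this]

theorem HalfAt.of_openEmbedding {f : Z → Z'} (hf : IsOpenEmbedding f) (p : Z) :
    HalfAt n (f p) ↔ HalfAt n p := by
  have : Nonempty Z := ⟨p⟩
  let e := hf.toOpenPartialHomeomorph f
  constructor
  · intro h
    exact HalfAt.of_oph e (by simp [e]) (by simpa [e] using h)
  · intro h
    refine HalfAt.of_oph e.symm (by simp [e]) ?_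
    have : e.symm (f p) = p := e.left_inv (x := p) (by simp [e])
    rwa [this]

theorem locEuclidean_iff (n : ℕ) (Z : Type) [TopologicalSpace Z] :
    LocEuclidean n Z ↔ ∀ z : Z, EucAt n z := by
  constructor
  · intro h z
    obtain ⟨U, hU, hz, ⟨e⟩⟩ := h z
    exact (EucAt.of_openEmbedding hU.isOpenEmbedding_subtypeVal ⟨z, hz⟩).2
      ⟨e.toOpenPartialHomeomorph, by simp⟩
  · intro h z
    obtain ⟨ψ, hψ⟩ := h z
    obtain ⟨ε, hε, hball⟩ := Metric.isOpen_iff.1 ψ.open_target _ (ψ.map_source hψ)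
    let χ := ψ.trans (OpenPartialHomeomorph.univBall (ψ z) ε).symm
    have ht : χ.target = univ := by
      simp only [χ, OpenPartialHomeomorph.trans_target, OpenPartialHomeomorph.symm_target,
        OpenPartialHomeomorph.univBall_source, OpenPartialHomeomorph.symm_symm]
      rw [univ_inter, eq_univ_iff_forall]
      intro x
      apply hball
      rw [← OpenPartialHomeomorph.univBall_target (ψ z) hε]
      exact (OpenPartialHomeomorph.univBall (ψ z) ε).map_source (by simp)
    refine ⟨χ.source, χ.open_source, ?_, ⟨?_⟩⟩
    · simp [χ, hψ, OpenPartialHomeomorph.univBall_target (ψ z) hε, hε]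
    · exact χ.toHomeomorphSourceTarget.trans ((Homeomorph.setCongr ht).trans
        (Homeomorph.Set.univ _))

theorem locHalfEuclidean_iff (n : ℕ) (Z : Type) [TopologicalSpace Z] :
    LocHalfEuclidean n Z ↔ ∀ z : Z, HalfAt n z := by
  constructor
  · intro h z
    obtain ⟨U, hU, hz, V, hV, ⟨e⟩⟩ := h z
    refine (HalfAt.of_openEmbedding hU.isOpenEmbedding_subtypeVal ⟨z, hz⟩).2
      ((HalfAt.of_openEmbedding (f := e) e.isOpenEmbedding ⟨z, hz⟩).1 ?_)
    refine (HalfAt.of_openEmbedding hV.isOpenEmbedding_subtypeVal (e ⟨z, hz⟩)).1 ?_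
    exact ⟨OpenPartialHomeomorph.refl _, by simp⟩
  · intro h z
    obtain ⟨ψ, hψ⟩ := h z
    exact ⟨ψ.source, ψ.open_source, hψ, ψ.target, ψ.open_target, ⟨ψ.toHomeomorphSourceTarget⟩⟩

/-- A Euclidean point is not sent to the boundary by a half-space chart. -/
theorem EucAt.half_pos {p : Z} (h : EucAt n p) (ψ : OpenPartialHomeomorph Z (Hs n))
    (hp : p ∈ ψ.source) : 0 < ((ψ p).2 : ℝ) := by
  obtain ⟨φ, hφ⟩ := h
  by_contra hneg
  have hz : ((ψ p).2 : ℝ) = 0 := le_antisymm (not_lt.1 hneg) (ψ p).2.2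
  let κ := φ.symm.trans ψ
  have hx0 : φ p ∈ κ.source := by simp [κ, hφ, hp]
  have hκ : κ (φ p) = ψ p := by simp [κ, hφ]
  have htar : κ.target ∈ 𝓝 (ψ p) := by
    rw [← hκ]; exact κ.open_target.mem_nhds (κ.map_source hx0)
  -- pushing up
  let up : ℝ × Hs n → Hs n := fun q =>
    (q.2.1, ⟨(q.2.2 : ℝ) + max 0 q.1, mem_Ici.2 (add_nonneg (mem_Ici.1 q.2.2.2) (le_max_left _ _))⟩)
  have hup : Continuous up := by
    refine (continuous_fst.comp continuous_snd).prodMk (Continuous.subtype_mk ?_ _)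
    fun_prop
  have hup0 : up (0, ψ p) = ψ p := by simp [up]
  have h1 : ∀ᶠ q in 𝓝 ((0 : ℝ), φ p), up (q.1, κ q.2) ∈ κ.target := by
    have hc : ContinuousAt (fun q : ℝ × Eu n => up (q.1, κ q.2)) (0, φ p) := by
      refine hup.continuousAt.comp (continuousAt_fst.prodMk ?_)
      exact ContinuousAt.comp (x := ((0 : ℝ), φ p)) (f := Prod.snd) (g := κ)
        (κ.continuousAt hx0) continuousAt_snd
    apply hc
    simp only [hκ, hup0]
    exact htar
  rw [nhds_prod_eq, eventually_prod_iff] at h1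
  obtain ⟨pa, hpa, pb, hpb, hab⟩ := h1
  obtain ⟨c, hc, hca⟩ := Metric.nhds_basis_closedBall.mem_iff.1 hpa
  obtain ⟨ρ, hρ, hρs⟩ := Metric.nhds_basis_closedBall.mem_iff.1
    (inter_mem hpb (κ.open_source.mem_nhds hx0))
  let τ : Eu n → ℝ := fun x => max 0 (c * (1 - ‖x - φ p‖ / ρ))
  have hτc : Continuous τ := by fun_prop
  have hτa : ∀ x, pa (τ x) := by
    intro x
    apply hca
    rw [mem_closedBall_iff_norm, sub_zero, Real.norm_eq_abs, abs_of_nonneg (le_max_left _ _)]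
    refine max_le hc.le ?_
    have : 0 ≤ ‖x - φ p‖ / ρ := by positivity
    nlinarith
  have hmem : ∀ x ∈ Metric.closedBall (φ p) ρ, up (τ x, κ x) ∈ κ.target := fun x hx =>
    hab (hτa x) (hρs hx).1
  obtain ⟨x, hx, hxe⟩ := brouwer_ball n (φ p) ρ hρ (fun x => κ.symm (up (τ x, κ x))) (by
      refine κ.continuousOn_symm.comp ?_ hmem
      refine hup.comp_continuousOn (hτc.continuousOn.prodMk ?_)
      exact κ.continuousOn.mono fun x hx => (hρs hx).2) (by
      intro x hx
      have h2 : τ x = 0 := by simp [τ, hx, hρ.ne']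
      have h3 : up (τ x, κ x) = κ x := by simp [up, h2]
      rw [h3]
      exact κ.left_inv (hρs (by simp [dist_eq_norm, hx])).2)
  have h4 : up (τ x, κ x) = ψ p := by
    rw [← κ.right_inv (hmem x hx), hxe, hκ]
  have h5 : ((κ x).2 : ℝ) + max 0 (τ x) = 0 := by
    have := congrArg (fun q : Hs n => (q.2 : ℝ)) h4
    simp only [up, hz] at this
    exact this
  have h6 : 0 ≤ ((κ x).2 : ℝ) := (κ x).2.2
  have h7 : τ x = 0 := by
    have : 0 ≤ τ x := le_max_left _ _
    rw [max_eq_right this] at h5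
    linarith
  have h8 : up (τ x, κ x) = κ x := by simp [up, h7]
  rw [h8, ← hκ] at h4
  have h9 : x = φ p := κ.injOn (hρs hx).2 hx0 h4
  rw [h9] at h7
  simp only [τ, sub_self, norm_zero, zero_div, sub_zero, mul_one] at h7
  rw [max_eq_right hc.le] at h7
  linarith

/-- Splitting off the last coordinate. -/
def euSplit (n : ℕ) (hn : 1 ≤ n) : Eu n ≃ₜ (Fin (n - 1) → ℝ) × ℝ :=
  (EuclideanSpace.equiv (Fin n) ℝ).toHomeomorph.trans
    ((Homeomorph.piCongrLeft (Y := fun _ : Fin n => ℝ)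
      (finCongr (Nat.sub_add_cancel hn))).symm.trans
    ((Fin.appendHomeomorph (n - 1) 1).symm.trans
      ((Homeomorph.refl _).prodCongr (Homeomorph.funUnique (Fin 1) ℝ))))

/-- The open half space inside the product. -/
def hsIncl (n : ℕ) : {q : Hs n // 0 < (q.2 : ℝ)} → (Fin (n - 1) → ℝ) × ℝ :=
  fun q => (q.1.1, (q.1.2 : ℝ))

theorem hsIncl_openEmbedding (n : ℕ) : IsOpenEmbedding (hsIncl n) := by
  have hemb : IsEmbedding (hsIncl n) := by
    have : IsEmbedding (fun q : Hs n => (q.1, (q.2 : ℝ))) :=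
      IsEmbedding.id.prodMap IsEmbedding.subtypeVal
    exact this.comp IsEmbedding.subtypeVal
  refine ⟨hemb, ?_⟩
  have : range (hsIncl n) = {q | 0 < q.2} := by
    ext q
    constructor
    · rintro ⟨x, rfl⟩; exact x.2
    · intro hq; exact ⟨⟨(q.1, ⟨q.2, mem_Ici.2 (le_of_lt hq)⟩), hq⟩, rfl⟩
  rw [this]
  exact isOpen_lt continuous_const continuous_snd

theorem eucAt_prod_real (n : ℕ) (hn : 1 ≤ n) (q : (Fin (n - 1) → ℝ) × ℝ) : EucAt n q :=
  ⟨(euSplit n hn).symm.toOpenPartialHomeomorph, by simp⟩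

theorem eucAt_hs (n : ℕ) (hn : 1 ≤ n) (q : Hs n) (hq : 0 < (q.2 : ℝ)) : EucAt n q := by
  have hop : IsOpen {q : Hs n | 0 < (q.2 : ℝ)} :=
    isOpen_lt continuous_const (continuous_subtype_val.comp continuous_snd)
  have h := (EucAt.of_openEmbedding (n := n) (hsIncl_openEmbedding n) ⟨q, hq⟩).1
    (eucAt_prod_real n hn _)
  exact (EucAt.of_openEmbedding (n := n) hop.isOpenEmbedding_subtypeVal ⟨q, hq⟩).2 h

/-- Euclidean points are half-Euclidean. -/
theorem EucAt.half (hn : 1 ≤ n) {p : Z} (h : EucAt n p) : HalfAt n p := by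
  obtain ⟨φ, hφ⟩ := h
  let e1 := φ.trans (euSplit n hn).toOpenPartialHomeomorph
  refine HalfAt.of_oph e1 (by simp [e1, hφ]) ?_
  -- make the last coordinate positive
  let q := e1 p
  let ex : ((Fin (n - 1) → ℝ) × ℝ) ≃ₜ (Fin (n - 1) → ℝ) × ↥(Ioi (0 : ℝ)) :=
    (Homeomorph.refl _).prodCongr Real.expOrderIso.toHomeomorph
  have hemb : IsOpenEmbedding (fun q : (Fin (n - 1) → ℝ) × ↥(Ioi (0 : ℝ)) =>
      ((q.1, ⟨(q.2 : ℝ), mem_Ici.2 (le_of_lt (mem_Ioi.1 q.2.2))⟩) : Hs n)) := by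
    have h1 : IsOpenEmbedding (fun x : ↥(Ioi (0 : ℝ)) => (⟨(x : ℝ), mem_Ici.2 (le_of_lt (mem_Ioi.1 x.2))⟩ : ↥(Ici (0 : ℝ)))) := by
      refine ⟨?_, ?_⟩
      · exact IsEmbedding.of_comp (by fun_prop) continuous_subtype_val IsEmbedding.subtypeVal
      · have : range (fun x : ↥(Ioi (0 : ℝ)) => (⟨(x : ℝ), mem_Ici.2 (le_of_lt (mem_Ioi.1 x.2))⟩ : ↥(Ici (0 : ℝ)))) =
          {x : ↥(Ici (0 : ℝ)) | 0 < (x : ℝ)} := by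
          ext x
          constructor
          · rintro ⟨y, rfl⟩; exact y.2
          · intro hx; exact ⟨⟨x, hx⟩, rfl⟩
        rw [this]
        exact isOpen_lt continuous_const continuous_subtype_val
    exact IsOpenEmbedding.id.prodMap h1
  have h2 := hemb.comp ex.isOpenEmbedding
  exact (HalfAt.of_openEmbedding h2 (e1 p)).1 ⟨OpenPartialHomeomorph.refl _, by simp⟩

/-- Half-Euclidean points in the interior of a half chart are Euclidean. -/
theorem eucAt_of_half_pos (hn : 1 ≤ n) {p : Z} (ψ : OpenPartialHomeomorph Z (Hs n))
    (hp : p ∈ ψ.source) (h : 0 < ((ψ p).2 : ℝ)) : EucAt n p :=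
  EucAt.of_oph ψ hp (eucAt_hs n hn _ h)

end GlueAux

namespace GlueAux
open Set Filter Topology

section conn
variable {C Φ : Type*}

/-- Connectivity of flags through the colours in `T`. -/
def conn (r : C → Φ → Φ) (T : Set C) : Φ → Φ → Prop :=
  Relation.ReflTransGen (fun f g => ∃ c ∈ T, g = r c f)

variable {r : C → Φ → Φ} {T : Set C}

theorem conn.refl (f : Φ) : conn r T f f := Relation.ReflTransGen.refl

theorem conn.step {c : C} (hc : c ∈ T) (f : Φ) : conn r T f (r c f) :=
  Relation.ReflTransGen.single ⟨c, hc, rfl⟩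

theorem conn.trans {f g h : Φ} (h1 : conn r T f g) (h2 : conn r T g h) : conn r T f h :=
  Relation.ReflTransGen.trans h1 h2

theorem conn.symm (hr : ∀ c f, r c (r c f) = f) {f g : Φ} (h : conn r T f g) : conn r T g f := by
  induction h with
  | refl => exact conn.refl _
  | tail _ hs ih =>
    obtain ⟨c, hc, rfl⟩ := hs
    refine conn.trans ?_ ih
    have := conn.step (r := r) hc (r c ‹_›)
    rwa [hr] at this

theorem conn.mono {T' : Set C} (hT : T ⊆ T') {f g : Φ} (h : conn r T f g) : conn r T' f g :=
  Relation.ReflTransGen.mono (fun _ _ ⟨c, hc, e⟩ => ⟨c, hT hc, e⟩) _ _ h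

/-- A function invariant under the steps is invariant under `conn`. -/
theorem conn.invariant {W : Type*} (h : Φ → W) (hh : ∀ c ∈ T, ∀ f, h (r c f) = h f) {f g : Φ}
    (hc : conn r T f g) : h g = h f := by
  induction hc with
  | refl => rfl
  | tail _ hs ih => obtain ⟨c, hc, rfl⟩ := hs; rw [hh c hc, ih]

theorem conn_empty {f g : Φ} : conn r ∅ f g ↔ f = g := by
  constructor
  · intro h
    exact (conn.invariant (r := r) (T := ∅) id (fun c hc => hc.elim) h).symm
  · rintro rfl; exact conn.refl _

theorem conn_reindex {C' : Type*} (ι : C' → C) (hT : T ⊆ range ι) {f g : Φ} :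
    conn (fun c => r (ι c)) (ι ⁻¹' T) f g ↔ conn r T f g := by
  constructor
  · intro h
    exact Relation.ReflTransGen.mono (fun _ _ ⟨c, hc, e⟩ => ⟨ι c, hc, e⟩) _ _ h
  · intro h
    refine Relation.ReflTransGen.mono ?_ _ _ h
    rintro _ _ ⟨c, hc, e⟩
    obtain ⟨c', rfl⟩ := hT hc
    exact ⟨c', hc, e⟩

end conn

/-- `q` presents `Y` as the quotient of `Φ × A` by the relation generated by the flips `r`. -/
structure Pres {C Φ A Y : Type*} [TopologicalSpace A] [TopologicalSpace Y]
    (r : C → Φ → Φ) (Z : A → Set C) (q : Φ → A → Y) : Prop where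
  cont : ∀ f, Continuous (q f)
  closed : ∀ f, IsClosedMap (q f)
  surj : ∀ y, ∃ f a, q f a = y
  ker : ∀ f a g b, q f a = q g b ↔ a = b ∧ conn r (Z a) f g

namespace Pres
variable {C Φ A Y B Y' : Type*} [TopologicalSpace A] [TopologicalSpace Y] [TopologicalSpace B]
  [TopologicalSpace Y'] {r : C → Φ → Φ} {Z : A → Set C} {q : Φ → A → Y}

theorem inj (h : Pres r Z q) (f : Φ) : Function.Injective (q f) := fun a b hab =>
  ((h.ker f a f b).1 hab).1

theorem closedEmbedding (h : Pres r Z q) (f : Φ) : IsClosedEmbedding (q f) :=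
  .of_continuous_injective_isClosedMap (h.cont f) (h.inj f) (h.closed f)

theorem isClosed_iff [Finite Φ] (h : Pres r Z q) (S : Set Y) :
    IsClosed S ↔ ∀ f, IsClosed (q f ⁻¹' S) := by
  constructor
  · intro hS f; exact hS.preimage (h.cont f)
  · intro hS
    have : S = ⋃ f, q f '' (q f ⁻¹' S) := by
      ext y
      simp only [mem_iUnion, mem_image, mem_preimage]
      constructor
      · intro hy
        obtain ⟨f, a, rfl⟩ := h.surj y
        exact ⟨f, a, hy, rfl⟩
      · rintro ⟨f, a, ha, rfl⟩; exact ha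
    rw [this]
    exact isClosed_iUnion_of_finite fun f => h.closed f _ (hS f)

theorem isOpen_iff [Finite Φ] (h : Pres r Z q) (S : Set Y) :
    IsOpen S ↔ ∀ f, IsOpen (q f ⁻¹' S) := by
  rw [← isClosed_compl_iff, h.isClosed_iff]
  exact forall_congr' fun f => by rw [preimage_compl, isClosed_compl_iff]

theorem continuous_iff [Finite Φ] (h : Pres r Z q) {W : Type*} [TopologicalSpace W] (φ : Y → W) :
    Continuous φ ↔ ∀ f, Continuous (fun a => φ (q f a)) := by
  constructor
  · intro hφ f; exact hφ.comp (h.cont f)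
  · intro hφ
    rw [continuous_def]
    intro s hs
    rw [h.isOpen_iff]
    exact fun f => hs.preimage (hφ f)

/-- Two presentations with the same data give homeomorphic spaces. -/
theorem exists_homeo [Finite Φ] {C' : Type*} {r' : C' → Φ → Φ} {Z' : B → Set C'} {q' : Φ → B → Y'}
    (h : Pres r Z q) (h' : Pres r' Z' q') (σ : A ≃ₜ B)
    (hc : ∀ a f g, conn r (Z a) f g ↔ conn r' (Z' (σ a)) f g) :
    ∃ e : Y ≃ₜ Y', ∀ f a, e (q f a) = q' f (σ a) := by
  have key : ∀ f a g b, q f a = q g b ↔ q' f (σ a) = q' g (σ b) := by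
    intro f a g b
    rw [h.ker, h'.ker, hc, σ.injective.eq_iff]
  choose F P hFP using h.surj
  choose F' P' hFP' using h'.surj
  have h1 : ∀ f a, q' (F (q f a)) (σ (P (q f a))) = q' f (σ a) := fun f a =>
    (key _ _ _ _).1 (hFP _)
  have h2 : ∀ f b, q (F' (q' f b)) (σ.symm (P' (q' f b))) = q f (σ.symm b) := fun f b =>
    (key _ _ _ _).2 (by simpa using hFP' (q' f b))
  refine ⟨⟨⟨fun y => q' (F y) (σ (P y)), fun y => q (F' y) (σ.symm (P' y)), ?_, ?_⟩, ?_, ?_⟩, ?_⟩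
  · intro y
    simp only
    rw [h2]
    simp [hFP]
  · intro y
    simp only
    rw [h1]
    simp [hFP']
  · simp only
    rw [h.continuous_iff]
    intro f
    simp only [h1]
    exact (h'.cont f).comp σ.continuous
  · simp only
    rw [h'.continuous_iff]
    intro f
    simp only [h2]
    exact (h.cont f).comp σ.symm.continuous
  · intro f a
    exact h1 f a

theorem transport (h : Pres r Z q) (σ : B ≃ₜ A) {C' : Type*} {r' : C' → Φ → Φ} {Z' : B → Set C'}
    (hc : ∀ b f g, conn r (Z (σ b)) f g ↔ conn r' (Z' b) f g) :
    Pres r' Z' (fun f b => q f (σ b)) where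
  cont f := (h.cont f).comp σ.continuous
  closed f := (h.closed f).comp σ.isClosedMap
  surj y := by
    obtain ⟨f, a, rfl⟩ := h.surj y
    exact ⟨f, σ.symm a, by simp⟩
  ker f a g b := by rw [h.ker, hc, σ.injective.eq_iff]

theorem restrict (h : Pres r Z q) (S : Set Y) (T : Set A) (hST : ∀ f a, q f a ∈ S ↔ a ∈ T) :
    Pres r (fun a : T => Z a) (fun f (a : T) => (⟨q f a, (hST f a).2 a.2⟩ : S)) where
  cont f := by
    have := h.cont f
    fun_prop
  closed f := by
    intro K hK
    obtain ⟨K', hK', rfl⟩ := isClosed_induced_iff.1 hK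
    refine isClosed_induced_iff.2 ⟨q f '' K', h.closed f _ hK', ?_⟩
    ext ⟨y, hy⟩
    simp only [mem_preimage, mem_image, Subtype.exists, Subtype.mk.injEq]
    constructor
    · rintro ⟨a, ha, rfl⟩
      exact ⟨a, (hST f a).1 hy, ha, rfl⟩
    · rintro ⟨a, _, ha, rfl⟩
      exact ⟨a, ha, rfl⟩
  surj := by
    rintro ⟨y, hy⟩
    obtain ⟨f, a, rfl⟩ := h.surj y
    exact ⟨f, ⟨a, (hST f a).1 hy⟩, rfl⟩
  ker f a g b := by
    rw [Subtype.mk.injEq, h.ker, Subtype.ext_iff]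

theorem prod (h : Pres r Z q) (J : Type*) [TopologicalSpace J] :
    Pres r (fun a : A × J => Z a.1) (fun f (a : A × J) => ((q f a.1, a.2) : Y × J)) where
  cont f := by
    have := h.cont f
    fun_prop
  closed f := ((h.closedEmbedding f).prodMap IsClosedEmbedding.id).isClosedMap
  surj := by
    rintro ⟨y, j⟩
    obtain ⟨f, a, rfl⟩ := h.surj y
    exact ⟨f, ⟨a, j⟩, rfl⟩
  ker f a g b := by
    rw [Prod.mk.injEq, h.ker, Prod.ext_iff]
    tauto

/-- Restriction to a union of orbits of flags. -/
theorem restrictFlags [Finite Φ] (h : Pres r Z q) (O : Set Φ) (hO : ∀ c, ∀ f, f ∈ O ↔ r c f ∈ O) :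
    IsOpen {y : Y | ∃ f ∈ O, ∃ a, q f a = y} ∧
    Pres (Φ := O) (fun c f => (⟨r c f, (hO c f).1 f.2⟩ : O)) Z
      (fun f a => (⟨q f a, ⟨f, f.2, a, rfl⟩⟩ : {y : Y | ∃ f ∈ O, ∃ a, q f a = y})) := by
  have hconn : ∀ T f g, conn r T f g → (f ∈ O ↔ g ∈ O) := by
    intro T f g hfg
    have := conn.invariant (r := r) (T := T) (fun f => f ∈ O)
      (fun c _ f => propext (hO c f).symm) hfg
    exact (Eq.to_iff this).symm
  have hpre : ∀ g a, q g a ∈ {y : Y | ∃ f ∈ O, ∃ a, q f a = y} ↔ g ∈ O := by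
    intro g a
    constructor
    · rintro ⟨f, hf, b, hb⟩
      exact (hconn _ _ _ ((h.ker _ _ _ _).1 hb).2).1 hf
    · intro hg; exact ⟨g, hg, a, rfl⟩
  refine ⟨?_, ?_⟩
  · rw [h.isOpen_iff]
    intro f
    by_cases hf : f ∈ O
    · convert isOpen_univ
      ext a; simp only [mem_preimage, hpre, hf, mem_univ]
    · convert isOpen_empty
      ext a; simp only [mem_preimage, hpre, hf, mem_empty_iff_false]
  · refine ⟨?_, ?_, ?_, ?_⟩
    · intro f
      have := h.cont f
      fun_prop
    · intro f K hK
      refine isClosed_induced_iff.2 ⟨q f '' K, h.closed f _ hK, ?_⟩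
      ext ⟨y, hy⟩
      simp only [mem_preimage, mem_image, Subtype.mk.injEq]
    · rintro ⟨y, f, hf, a, rfl⟩
      exact ⟨⟨f, hf⟩, a, rfl⟩
    · intro f a g b
      rw [Subtype.mk.injEq, h.ker]
      refine and_congr_right fun hab => ?_
      constructor
      · intro hfg
        have key : ∀ g, conn r (Z a) f g → ∀ hg : g ∈ O,
            conn (fun c (f : O) => (⟨r c f, (hO c f).1 f.2⟩ : O)) (Z a) f ⟨g, hg⟩ := by
          intro g hg
          induction hg with
          | refl => intro _; exact conn.refl _
          | @tail x y hx hs ih =>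
            obtain ⟨c, hc, rfl⟩ := hs
            intro hg
            have hxO : x ∈ O := (hO c x).2 hg
            exact (ih hxO).trans (conn.step hc (⟨x, hxO⟩ : O))
        exact key g hfg g.2
      · intro hfg
        clear hab
        induction hfg with
        | refl => exact conn.refl _
        | tail _ hs ih =>
          obtain ⟨c, hc, rfl⟩ := hs
          exact ih.trans (conn.step hc _)

end Pres

section canonical
variable {C Φ A : Type*} [TopologicalSpace A] (r : C → Φ → Φ) (hr : ∀ c f, r c (r c f) = f)
  (Z : A → Set C)

/-- The setoid of the canonical presentation. -/
def presSetoid : Setoid (Σ _ : Φ, A) where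
  r x y := x.2 = y.2 ∧ conn r (Z x.2) x.1 y.1
  iseqv := {
    refl := fun x => ⟨rfl, conn.refl _⟩
    symm := fun {x y} h => ⟨h.1.symm, by rw [← h.1]; exact h.2.symm hr⟩
    trans := fun {x y z} h h' => ⟨h.1.trans h'.1, h.2.trans (by rw [h.1]; exact h'.2)⟩ }

/-- The canonical quotient. -/
def PresQuot : Type _ := Quotient (presSetoid r hr Z)

instance : TopologicalSpace (PresQuot r hr Z) :=
  inferInstanceAs (TopologicalSpace (Quotient (presSetoid r hr Z)))

/-- The canonical map. -/
def presMk (f : Φ) (a : A) : PresQuot r hr Z := Quotient.mk (presSetoid r hr Z) ⟨f, a⟩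

theorem isClosed_conn [Finite C] {r : C → Φ → Φ} {Z : A → Set C}
    (hZ : ∀ c, IsClosed {a | c ∈ Z a}) (f g : Φ) :
    IsClosed {a | conn r (Z a) f g} := by
  have : {a | conn r (Z a) f g} = ⋃ T : {T : Set C // conn r T f g},
      ⋂ c : T.1, {a | (c : C) ∈ Z a} := by
    ext a
    simp only [mem_iUnion, mem_iInter]
    constructor
    · intro h
      exact ⟨⟨Z a, h⟩, fun c => c.2⟩
    · rintro ⟨T, hT⟩
      exact conn.mono (fun c hc => hT ⟨c, hc⟩) T.2
  rw [this]
  exact isClosed_iUnion_of_finite fun T => isClosed_iInter fun c => hZ c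

theorem pres_canonical [Finite C] (hZ : ∀ c, IsClosed {a | c ∈ Z a}) :
    Pres r Z (presMk r hr Z) where
  cont f := continuous_quotient_mk'.comp (continuous_sigmaMk (σ := fun _ : Φ => A))
  closed f := by
    intro K hK
    have : IsClosed (Quotient.mk (presSetoid r hr Z) ⁻¹' (presMk r hr Z f '' K)) := by
      rw [isClosed_sigma_iff]
      intro g
      have : Sigma.mk g ⁻¹' (Quotient.mk (presSetoid r hr Z) ⁻¹' (presMk r hr Z f '' K)) =
          K ∩ {a | conn r (Z a) f g} := by
        ext a
        simp only [mem_preimage, mem_image, mem_inter_iff]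
        constructor
        · rintro ⟨b, hb, hba⟩
          obtain ⟨h1, h2⟩ := Quotient.exact hba
          simp only at h1 h2
          subst h1
          exact ⟨hb, h2⟩
        · rintro ⟨ha, h2⟩
          exact ⟨a, ha, Quotient.sound ⟨rfl, h2⟩⟩
      rw [this]
      exact hK.inter (isClosed_conn hZ f g)
    exact (isQuotientMap_quotient_mk'.isClosed_preimage).1 this
  surj y := by
    obtain ⟨⟨f, a⟩, rfl⟩ := Quotient.exists_rep y
    exact ⟨f, a, rfl⟩
  ker f a g b := Quotient.eq (r := presSetoid r hr Z)

end canonical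

end GlueAux

namespace GlueAux
open Set Filter Topology MeasureTheory

/-- A cut-off normalisation of a map. -/
def cutNorm {m : ℕ} (g : Eu m → Eu m) (x : Eu m) : Eu m :=
  Real.smoothTransition (16 * ‖x‖ ^ 2 - 1) • ‖g x‖⁻¹ • g x

theorem cutNorm_contDiff {m : ℕ} (g : Eu m → Eu m) (hg : ContDiff ℝ 1 g)
    (h0 : ∀ x, x ≠ 0 → g x ≠ 0) : ContDiff ℝ 1 (cutNorm g) := by
  rw [contDiff_iff_contDiffAt]
  intro x
  by_cases hx : x = 0
  · subst hx
    have : cutNorm g =ᶠ[𝓝 0] fun _ => 0 := by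
      have : ∀ᶠ y : Eu m in 𝓝 0, 16 * ‖y‖ ^ 2 - 1 < 0 := by
        have hc : Continuous fun y : Eu m => 16 * ‖y‖ ^ 2 - 1 := by fun_prop
        exact hc.continuousAt.eventually_lt continuousAt_const (by simp)
      filter_upwards [this] with y hy
      simp [cutNorm, Real.smoothTransition.zero_of_nonpos hy.le]
    exact contDiffAt_const.congr_of_eventuallyEq this
  · have h1 : ContDiffAt ℝ 1 (fun x : Eu m => Real.smoothTransition (16 * ‖x‖ ^ 2 - 1)) x := by
      have : ContDiff ℝ 1 (fun x : Eu m => 16 * ‖x‖ ^ 2 - 1) :=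
        (contDiff_const.mul (contDiff_norm_sq ℝ)).sub contDiff_const
      exact (Real.smoothTransition.contDiff.comp this).contDiffAt
    have h2 : ContDiffAt ℝ 1 (fun x : Eu m => ‖g x‖⁻¹) x :=
      (hg.contDiffAt.norm ℝ (h0 x hx)).inv (norm_ne_zero_iff.2 (h0 x hx))
    exact h1.smul (h2.smul hg.contDiffAt)

theorem cutNorm_unit {m : ℕ} (g : Eu m → Eu m) 
    (h0 : ∀ x, x ≠ 0 → g x ≠ 0) (x : Eu m) (hx : 1 / 8 ≤ ‖x‖ ^ 2) : ‖cutNorm g x‖ = 1 := by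
  have hx0 : x ≠ 0 := by rintro rfl; norm_num at hx
  have := norm_ne_zero_iff.2 (h0 x hx0)
  rw [cutNorm, Real.smoothTransition.one_of_one_le (by linarith), one_smul, norm_smul, norm_inv,
    norm_norm, inv_mul_cancel₀ this]

theorem cutNorm_sphere {m : ℕ} (g : Eu m → Eu m) (x : Eu m) (hx : ‖x‖ = 1) (hg : g x = x) :
    cutNorm g x = x := by
  rw [cutNorm, Real.smoothTransition.one_of_one_le (by rw [hx]; norm_num), one_smul, hg, hx]
  simp

/-- A reflection is not homotopic to the identity. -/
theorem no_reflect_homotopy (m : ℕ) (hm : 1 ≤ m) (R : Eu m →L[ℝ] Eu m) (hRn : ∀ x, ‖R x‖ = ‖x‖)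
    (hdet : R.det = -1) (K : ℝ × Eu m → Eu m)
    (hK : ContinuousOn K (Icc 0 1 ×ˢ Metric.sphere 0 1))
    (hK0 : ∀ p ∈ Icc (0:ℝ) 1 ×ˢ Metric.sphere (0 : Eu m) 1, K p ≠ 0)
    (h0 : ∀ x : Eu m, ‖x‖ = 1 → K (0, x) = x) (h1 : ∀ x : Eu m, ‖x‖ = 1 → K (1, x) = R x) : False := by
  let τ : ℝ → ℝ := fun ρ => max 0 (min 1 ((7 / 8 - ρ) * 4))
  have hτc : Continuous τ := by fun_prop
  have hτm : ∀ ρ, τ ρ ∈ Icc (0:ℝ) 1 := fun ρ => ⟨le_max_left _ _, max_le (by norm_num) (min_le_left _ _)⟩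
  have hτ1 : ∀ ρ, ρ ≤ 5 / 8 → τ ρ = 1 := by
    intro ρ h
    simp only [τ]
    rw [min_eq_left (by linarith), max_eq_right (by norm_num)]
  have hτ0 : ∀ ρ, 7 / 8 ≤ ρ → τ ρ = 0 := by
    intro ρ h
    simp only [τ]
    rw [min_eq_right (by linarith), max_eq_left (by linarith)]
  let F : Eu m → Eu m := fun x => ‖x‖ • K (τ ‖x‖, ‖x‖⁻¹ • x)
  have hu : ∀ x : Eu m, x ≠ 0 → ‖‖x‖⁻¹ • x‖ = 1 := by
    intro x hx
    rw [norm_smul, norm_inv, norm_norm, inv_mul_cancel₀ (norm_ne_zero_iff.2 hx)]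
  have hmem : ∀ x : Eu m, x ≠ 0 → (τ ‖x‖, ‖x‖⁻¹ • x) ∈ Icc (0:ℝ) 1 ×ˢ Metric.sphere (0 : Eu m) 1 :=
    fun x hx => ⟨hτm _, by simpa using hu x hx⟩
  have hF0 : ∀ x, x ≠ 0 → F x ≠ 0 := fun x hx =>
    smul_ne_zero (norm_ne_zero_iff.2 hx) (hK0 _ (hmem x hx))
  have hFR : ∀ x, ‖x‖ ≤ 5 / 8 → F x = R x := by
    intro x hx
    by_cases hx0 : x = 0
    · simp [F, hx0]
    · simp only [F]
      rw [hτ1 _ hx, h1 _ (hu x hx0), map_smul, smul_smul, mul_inv_cancel₀ (norm_ne_zero_iff.2 hx0),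
        one_smul]
  have hFI : ∀ x, 7 / 8 ≤ ‖x‖ → F x = x := by
    intro x hx
    have hx0 : x ≠ 0 := by rintro rfl; norm_num at hx
    simp only [F]
    rw [hτ0 _ hx, h0 _ (hu x hx0), smul_smul, mul_inv_cancel₀ (norm_ne_zero_iff.2 hx0),
        one_smul]
  have hFc : Continuous F := by
    rw [continuous_iff_continuousAt]
    intro x
    by_cases hx : x = 0
    · have : F =ᶠ[𝓝 x] R := by
        have : ∀ᶠ y in 𝓝 x, ‖y‖ < 5 / 8 :=
          continuous_norm.continuousAt.eventually_lt continuousAt_const (by rw [hx]; norm_num)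
        filter_upwards [this] with y hy using hFR y hy.le
      exact (R.continuous.continuousAt).congr this.symm
    · have hc : ContinuousOn F {0}ᶜ := by
        refine continuous_norm.continuousOn.smul (hK.comp ?_ fun x hx => hmem x hx)
        refine (hτc.comp continuous_norm).continuousOn.prodMk ?_
        exact (continuous_norm.continuousOn.inv₀ fun x hx => norm_ne_zero_iff.2 hx).smul continuousOn_id
      exact hc.continuousAt (isOpen_compl_singleton.mem_nhds hx)
  let U : Set (Eu m) := {x | ‖x‖ < 5 / 8} ∪ {x | 7 / 8 < ‖x‖}
  have hU1 : IsOpen {x : Eu m | ‖x‖ < 5 / 8} := isOpen_lt continuous_norm continuous_const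
  have hU2 : IsOpen {x : Eu m | 7 / 8 < ‖x‖} := isOpen_lt continuous_const continuous_norm
  obtain ⟨g, hg, hgd, hgs, -⟩ := hFc.exists_contDiff_approx_and_eqOn 1
    (ε := fun x => ‖F x‖ + max 0 (1 / 2 - ‖x‖)) (by fun_prop)
    (by
      intro x
      by_cases hx : x = 0
      · have : (0:ℝ) < max 0 (1 / 2 - ‖x‖) := by rw [hx]; norm_num
        positivity
      · have := norm_pos_iff.2 (hF0 x hx)
        positivity)
    (S := {x | ‖x‖ ≤ 1 / 2} ∪ {x | 1 ≤ ‖x‖}) (U := U)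
    ((isClosed_le continuous_norm continuous_const).union (isClosed_le continuous_const continuous_norm))
    ((hU1.union hU2).mem_nhdsSet.2 (by
      rintro x (hx | hx)
      · left; simp only [mem_ofPred_eq] at hx ⊢; linarith
      · right; simp only [mem_ofPred_eq] at hx ⊢; linarith))
    (by
      rintro x (hx | hx)
      · refine ContDiffAt.contDiffWithinAt ?_
        refine R.contDiff.contDiffAt.congr_of_eventuallyEq ?_
        filter_upwards [hU1.mem_nhds hx] with y hy using hFR y (le_of_lt hy)
      · refine ContDiffAt.contDiffWithinAt ?_
        refine contDiffAt_id.congr_of_eventuallyEq ?_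
        filter_upwards [hU2.mem_nhds hx] with y hy using hFI y (le_of_lt hy))
  have hgR : ∀ x, ‖x‖ ≤ 1 / 2 → g x = R x := fun x hx => by
    rw [hgs (Or.inl hx)]; exact hFR x (by linarith)
  have hg0 : ∀ x, x ≠ 0 → g x ≠ 0 := by
    intro x hx
    by_cases h : ‖x‖ ≤ 1 / 2
    · rw [hgR x h, ← norm_ne_zero_iff, hRn]; exact norm_ne_zero_iff.2 hx
    · intro hz
      have := hgd x
      rw [hz, max_eq_left (by linarith), dist_zero_left] at this
      linarith
  have hg' : ContDiff ℝ 1 g := hg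
  have hG := cutNorm_contDiff g hg' hg0
  have hE := cutNorm_contDiff (m := m) (fun x => x) contDiff_id (fun x hx => hx)
  have i1 := det_integral m hm _ hG (fun x hx => cutNorm_sphere g x hx (by
    rw [hgs (Or.inr (by simp only [mem_ofPred_eq]; linarith))]; exact hFI x (by linarith)))
  have i2 := det_integral m hm _ hE (fun x hx => cutNorm_sphere _ x hx rfl)
  have hkey : ∀ x, (fderiv ℝ (cutNorm g) x).det = - (fderiv ℝ (cutNorm fun x : Eu m => x) x).det := by
    intro x
    by_cases hx : ‖x‖ < 1 / 2
    · have : cutNorm g =ᶠ[𝓝 x] fun y => R (cutNorm (fun x : Eu m => x) y) := by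
        have : ∀ᶠ y in 𝓝 x, ‖y‖ < 1 / 2 :=
          continuous_norm.continuousAt.eventually_lt continuousAt_const hx
        filter_upwards [this] with y hy
        simp only [cutNorm]
        rw [hgR y hy.le, hRn, map_smul, map_smul]
      rw [this.fderiv_eq]
      have : fderiv ℝ (fun y => R (cutNorm (fun x : Eu m => x) y)) x =
          R.comp (fderiv ℝ (cutNorm (fun x : Eu m => x)) x) :=
        (R.hasFDerivAt.comp x ((hE.differentiable (by norm_num)) x).hasFDerivAt).fderiv
      rw [this]
      have : (R.comp (fderiv ℝ (cutNorm (fun x : Eu m => x)) x)).det =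
          R.det * (fderiv ℝ (cutNorm (fun x : Eu m => x)) x).det := by
        simp only [ContinuousLinearMap.det, ContinuousLinearMap.toLinearMap_comp, LinearMap.det_comp]
      rw [this, hdet]; ring
    · have hev : ∀ᶠ y in 𝓝 x, 1 / 8 ≤ ‖y‖ ^ 2 := by
        have hc : Continuous fun y : Eu m => ‖y‖ ^ 2 := by fun_prop
        have : ∀ᶠ y in 𝓝 x, 1 / 8 < ‖y‖ ^ 2 :=
          continuousAt_const.eventually_lt hc.continuousAt (by nlinarith)
        filter_upwards [this] with y hy using hy.le
      rw [det_zero_of_unit m _ x ((hG.differentiable (by norm_num)) x)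
        (hev.mono fun y hy => cutNorm_unit g hg0 y hy),
        det_zero_of_unit m _ x ((hE.differentiable (by norm_num)) x)
        (hev.mono fun y hy => cutNorm_unit _ (fun x hx => hx) y hy), neg_zero]
  simp only [hkey, integral_neg] at i1
  have := volume_unit_ball_pos m
  linarith

end GlueAux

namespace GlueAux
open Set Filter Topology

/-- The unit sphere. -/
abbrev Sph (m : ℕ) : Type := Metric.sphere (0 : Eu m) 1
/-- The punctured space. -/
abbrev Pun (m : ℕ) : Type := {z : Eu m // z ≠ 0}

theorem no_local_reflect (m : ℕ) (hm : 1 ≤ m) (h : OpenPartialHomeomorph (Eu m) (Eu m))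
    (h0 : (0 : Eu m) ∈ h.source) :
    ∃ δ0 : ℝ, 0 < δ0 ∧ ∀ δ : ℝ, 0 < δ → δ ≤ δ0 →
      ∀ (R : Eu m →L[ℝ] Eu m), (∀ x, ‖R x‖ = ‖x‖) → R.det = -1 → ∀ u v : C(Sph m, Pun m),
      (∀ x, (u x : Eu m) = h (δ • (x : Eu m)) - h 0) → (∀ x, (v x : Eu m) = h (δ • R x) - h 0) →
      ¬ u.Homotopic v := by
  obtain ⟨s, hs, hst⟩ := Metric.isOpen_iff.1 h.open_target (h 0) (h.map_source h0)
  have hn : h.source ∩ h ⁻¹' Metric.ball (h 0) s ∈ 𝓝 (0 : Eu m) :=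
    Filter.inter_mem (h.open_source.mem_nhds h0)
      ((h.continuousAt h0).preimage_mem_nhds (Metric.ball_mem_nhds _ hs))
  obtain ⟨ε, hε, hεs⟩ := Metric.mem_nhds_iff.1 hn
  refine ⟨ε / 2, by positivity, ?_⟩
  intro δ hδ hδε R hRn hdet u v hu hv ⟨F⟩
  have hball : ∀ x : Eu m, ‖x‖ = 1 → δ • x ∈ h.source ∧ ‖h (δ • x) - h 0‖ < s := by
    intro x hx
    have : δ • x ∈ Metric.ball (0 : Eu m) ε := by
      rw [mem_ball_zero_iff, norm_smul, hx, Real.norm_eq_abs, abs_of_pos hδ]; linarith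
    obtain ⟨h1, h2⟩ := hεs this
    exact ⟨h1, by simpa [dist_eq_norm] using h2⟩
  have hcomp : IsCompact (range fun p => (F p : Eu m)) :=
    isCompact_range (continuous_subtype_val.comp F.continuous)
  obtain ⟨M, hM⟩ := hcomp.isBounded.exists_norm_le
  have hM' : ∀ p, ‖(F p : Eu m)‖ ≤ |M| + 1 := fun p =>
    (hM _ ⟨p, rfl⟩).trans ((le_abs_self M).trans (by linarith))
  let lam : ℝ := min 1 (s / (2 * (|M| + 1)))
  have hlam : 0 < lam := lt_min one_pos (by positivity)
  have hlam1 : lam ≤ 1 := min_le_left _ _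
  let sc : ℝ → ℝ := fun t => max lam (max (1 - 3 * t) (3 * t - 2))
  have hsc : Continuous sc := by fun_prop
  have hscpos : ∀ t, 0 < sc t := fun t => lt_of_lt_of_le hlam (le_max_left _ _)
  let cl : ℝ → unitInterval := fun t => projIcc (0:ℝ) 1 zero_le_one (3 * t - 1)
  have hcl : Continuous cl := continuous_projIcc.comp (by fun_prop)
  let σ : Eu m → Sph m := fun x => if hx : ‖x‖ = 1 then ⟨x, by simpa using hx⟩ else
    ⟨EuclideanSpace.single (⟨0, hm⟩ : Fin m) (1 : ℝ), by simp⟩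
  have hσ : ∀ x : Eu m, ‖x‖ = 1 → (σ x : Eu m) = x := fun x hx => by simp [σ, hx]
  have hσc : ContinuousOn σ (Metric.sphere 0 1) := by
    rw [continuousOn_iff_continuous_domRestrict]
    have : (Metric.sphere (0 : Eu m) 1).domRestrict σ = id := by
      funext x
      have hx : ‖(x : Eu m)‖ = 1 := by simpa using x.2
      apply Subtype.ext
      simp [hσ _ hx]
    rw [this]; exact continuous_id
  let V : ℝ × Eu m → Eu m := fun p => sc p.1 • (F (cl p.1, σ p.2) : Eu m)
  have hVc : ContinuousOn V (Icc 0 1 ×ˢ Metric.sphere 0 1) := by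
    refine (hsc.comp continuous_fst).continuousOn.smul ?_
    refine continuous_subtype_val.comp_continuousOn (F.continuous.comp_continuousOn ?_)
    refine (hcl.comp continuous_fst).continuousOn.prodMk ?_
    exact hσc.comp continuous_snd.continuousOn fun p hp => hp.2
  have hV0 : ∀ p, V p ≠ 0 := fun p => smul_ne_zero (hscpos _).ne' (F _).2
  have hF0 : ∀ x : Eu m, ‖x‖ = 1 → (F (0, σ x) : Eu m) = h (δ • x) - h 0 := by
    intro x hx
    rw [F.apply_zero, hu, hσ x hx]
  have hF1 : ∀ x : Eu m, ‖x‖ = 1 → (F (1, σ x) : Eu m) = h (δ • R x) - h 0 := by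
    intro x hx
    rw [F.apply_one, hv, hσ x hx]
  have hcl0 : ∀ t : ℝ, t ≤ 1 / 3 → cl t = 0 := fun t ht =>
    projIcc_of_le_left _ (by linarith)
  have hcl1 : ∀ t : ℝ, 2 / 3 ≤ t → cl t = 1 := fun t ht =>
    projIcc_of_right_le _ (by linarith)
  have hVs : ∀ p ∈ Icc (0:ℝ) 1 ×ˢ Metric.sphere (0 : Eu m) 1, ‖V p‖ < s := by
    rintro ⟨t, x⟩ ⟨⟨ht0, ht1⟩, hx⟩
    simp only at ht0 ht1 hx
    have hx : ‖x‖ = 1 := by simpa using hx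
    simp only [V]
    rw [norm_smul, Real.norm_eq_abs, abs_of_pos (hscpos _)]
    have hsc1 : sc t ≤ 1 := max_le hlam1 (max_le (by linarith) (by linarith))
    by_cases h1 : t ≤ 1 / 3
    · rw [hcl0 t h1, hF0 x hx]
      have := (hball x hx).2
      nlinarith [norm_nonneg (h (δ • x) - h 0)]
    by_cases h2 : 2 / 3 ≤ t
    · rw [hcl1 t h2, hF1 x hx]
      have := (hball (R x) (by rw [hRn, hx])).2
      nlinarith [norm_nonneg (h (δ • R x) - h 0)]
    · have : sc t = lam := max_eq_left (max_le (by linarith) (by linarith))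
      rw [this]
      have hl : lam * (2 * (|M| + 1)) ≤ s := by
        have : lam ≤ s / (2 * (|M| + 1)) := min_le_right _ _
        rwa [le_div_iff₀ (by positivity)] at this
      have := hM' (cl t, σ x)
      have h3 : 0 ≤ |M| := abs_nonneg M
      have : lam * ‖(F (cl t, σ x) : Eu m)‖ ≤ lam * (|M| + 1) := mul_le_mul_of_nonneg_left this hlam.le
      nlinarith
  have hVt : ∀ p ∈ Icc (0:ℝ) 1 ×ˢ Metric.sphere (0 : Eu m) 1, h 0 + V p ∈ h.target := by
    intro p hp
    exact hst (by simpa using hVs p hp)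
  refine no_reflect_homotopy m hm R hRn hdet (fun p => δ⁻¹ • h.symm (h 0 + V p)) ?_ ?_ ?_ ?_
  · exact (h.continuousOn_symm.comp (continuousOn_const.add hVc) hVt).const_smul δ⁻¹
  · intro p hp
    refine smul_ne_zero (by positivity) ?_
    intro hz
    have h1 := h.right_inv (hVt p hp)
    rw [hz] at h1
    exact hV0 p (by simpa using h1)
  · intro x hx
    have : V (0, x) = h (δ • x) - h 0 := by
      simp only [V]
      rw [hcl0 0 (by norm_num), hF0 x hx]
      have : sc 0 = 1 := by simp only [sc]; norm_num [hlam1]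
      rw [this, one_smul]
    simp only [this, add_sub_cancel]
    rw [h.left_inv (hball x hx).1, smul_smul, inv_mul_cancel₀ hδ.ne', one_smul]
  · intro x hx
    have : V (1, x) = h (δ • R x) - h 0 := by
      simp only [V]
      rw [hcl1 1 (by norm_num), hF1 x hx]
      have : sc 1 = 1 := by simp only [sc]; norm_num [hlam1]
      rw [this, one_smul]
    simp only [this, add_sub_cancel]
    rw [h.left_inv (hball (R x) (by rw [hRn, hx])).1, smul_smul, inv_mul_cancel₀ hδ.ne', one_smul]

end GlueAux

namespace GlueAux
open Set Filter Topology

/-- Coordinates: a Euclidean space is a power of the reals. -/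
def euPi {n : ℕ} {ι : Type*} [Fintype ι] (h : Fintype.card ι = n) : Eu n ≃ₜ (ι → ℝ) :=
  (EuclideanSpace.equiv (Fin n) ℝ).toHomeomorph.trans
    (Homeomorph.piCongrLeft (Y := fun _ : ι => ℝ) (Fintype.equivFinOfCardEq h).symm)

theorem no_dim_drop_pi {ι κ : Type*} [Fintype ι] [Fintype κ]
    (hab : Fintype.card κ < Fintype.card ι) (f : (κ → ℝ) → (ι → ℝ)) (g : (ι → ℝ) → (κ → ℝ))
    (x0 : κ → ℝ) (W : Set (κ → ℝ)) (hW : W ∈ 𝓝 x0) (hf : ContinuousOn f W) (V : Set (ι → ℝ))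
    (hV : V ∈ 𝓝 (f x0)) (hg : ContinuousOn g V) (hgf : ∀ x ∈ W, g (f x) = x)
    (hinj : ∀ y ∈ V, g y = x0 → y = f x0) : False := by
  let A := euPi (ι := ι) rfl
  let B := euPi (ι := κ) rfl
  refine no_dim_drop _ _ hab (A.symm ∘ f ∘ B) (B.symm ∘ g ∘ A) (B.symm x0) (B ⁻¹' W) ?_ ?_
    (A ⁻¹' V) ?_ ?_ ?_ ?_
  · exact B.continuous.continuousAt.preimage_mem_nhds (by simpa using hW)
  · exact A.symm.continuous.comp_continuousOn
      (hf.comp B.continuous.continuousOn (fun x hx => hx))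
  · exact A.continuous.continuousAt.preimage_mem_nhds (by simpa using hV)
  · exact B.symm.continuous.comp_continuousOn
      (hg.comp A.continuous.continuousOn (fun x hx => hx))
  · intro x hx
    simp [hgf _ hx]
  · intro y hy h
    have h1 : g (A y) = x0 := by simpa using congrArg B h
    have := hinj _ hy h1
    simp [← this]

theorem eucAt_pi {n : ℕ} {ι : Type*} [Fintype ι] (h : Fintype.card ι = n) (x : ι → ℝ) :
    EucAt n x := ⟨(euPi h).symm.toOpenPartialHomeomorph, by simp⟩

/-- The closed orthant. -/
abbrev Orth (C : Type*) : Type _ := {y : C → ℝ // ∀ c, 0 ≤ y c}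

/-- The zero set. -/
def zset {C : Type*} (y : Orth C) : Set C := {c | y.1 c = 0}

theorem mem_zset {C : Type*} {y : Orth C} {c : C} : c ∈ zset y ↔ y.1 c = 0 := Iff.rfl

theorem isClosed_zset {C : Type*} (c : C) : IsClosed {y : Orth C | c ∈ zset y} :=
  isClosed_eq ((continuous_apply c).comp continuous_subtype_val) continuous_const

/-- Componentwise absolute value. -/
def absO {C : Type*} (y : C → ℝ) : Orth C := ⟨fun c => |y c|, fun _ => abs_nonneg _⟩

theorem absO_val {C : Type*} (y : C → ℝ) (c : C) : (absO y).1 c = |y c| := rfl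

theorem continuous_absO {C : Type*} : Continuous (absO (C := C)) := by
  unfold absO; fun_prop

theorem absO_of_nonneg {C : Type*} (y : Orth C) : absO y.1 = y :=
  Subtype.ext (funext fun c => abs_of_nonneg (y.2 c))

theorem conn_singleton {C Φ : Type*} {r : C → Φ → Φ} (hr : ∀ c f, r c (r c f) = f) {T : Set C}
    {c : C} (hT : T ⊆ {c}) {f g : Φ} (h : conn r T f g) : g = f ∨ (c ∈ T ∧ g = r c f) := by
  induction h with
  | refl => exact Or.inl rfl
  | tail _ hs ih =>
    obtain ⟨d, hd, rfl⟩ := hs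
    have : d = c := hT hd
    subst this
    rcases ih with rfl | ⟨_, rfl⟩
    · exact Or.inr ⟨hd, rfl⟩
    · exact Or.inl (hr _ _)

/-- Flipping a coordinate. -/
def flipC {C : Type*} (c : C) (y : C → ℝ) : C → ℝ := fun d => if d = c then - y d else y d

theorem continuous_flipC {C : Type*} (c : C) : Continuous (flipC c) := by
  refine continuous_pi fun d => ?_
  unfold flipC
  split_ifs <;> fun_prop

section orth
variable {C Φ Y : Type*} [TopologicalSpace Y] {r : C → Φ → Φ} {q : Φ → Orth C → Y}

/-- The double chart across a wall. -/
def dbl (r : C → Φ → Φ) (q : Φ → Orth C → Y) (f : Φ) (c : C) (y : C → ℝ) : Y :=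
  if 0 ≤ y c then q f (absO y) else q (r c f) (absO y)

theorem wall (h : Pres r zset q) (f : Φ) (c : C) (y : Orth C) (hy : y.1 c = 0) :
    q f y = q (r c f) y := (h.ker _ _ _ _).2 ⟨rfl, conn.step (mem_zset.2 hy) f⟩

theorem continuous_dbl (h : Pres r zset q) (f : Φ) (c : C) : Continuous (dbl r q f c) := by
  unfold dbl
  refine Continuous.if_le ?_ ?_ continuous_const (continuous_apply c) ?_
  · exact (h.cont f).comp continuous_absO
  · exact (h.cont _).comp continuous_absO
  · intro y hy
    exact wall h f c _ (by rw [absO_val, ← hy, abs_zero])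

theorem dbl_orth (f : Φ) (c : C) (y : Orth C) : dbl r q f c y.1 = q f y := by
  unfold dbl
  rw [if_pos (y.2 c), absO_of_nonneg]

theorem dbl_flip (h : Pres r zset q) (f : Φ) (c : C) (y : Orth C) :
    dbl r q f c (flipC c y.1) = q (r c f) y := by
  have ha : absO (flipC c y.1) = y := by
    apply Subtype.ext; funext d
    rw [absO_val]; unfold flipC
    have := y.2 d
    split_ifs
    · rw [abs_neg, abs_of_nonneg this]
    · rw [abs_of_nonneg this]
  unfold dbl
  rw [ha]
  split_ifs with h1
  · have h2 : y.1 c = 0 := by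
      have := y.2 c
      simp only [flipC, if_true] at h1
      linarith
    exact wall h f c y h2
  · rfl

/-- The double chart is an open embedding where the other coordinates are positive. -/
theorem dbl_openEmbedding [Finite Φ] [Finite C] (hr : ∀ c f, r c (r c f) = f)
    (hfree : ∀ c f, r c f ≠ f) (h : Pres r zset q) (f : Φ) (c : C) :
    IsOpenEmbedding (fun y : {y : C → ℝ | ∀ d, d ≠ c → 0 < y d} => dbl r q f c y.1) := by
  have hU : IsOpen {y : C → ℝ | ∀ d, d ≠ c → 0 < y d} := by
    have : {y : C → ℝ | ∀ d, d ≠ c → 0 < y d} = ⋂ d : {d // d ≠ c}, {y | 0 < y d.1} := by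
      ext y; simp
    rw [this]
    exact isOpen_iInter_of_finite fun d => isOpen_lt continuous_const (continuous_apply _)
  have hz : ∀ y : C → ℝ, (∀ d, d ≠ c → 0 < y d) → zset (absO y) ⊆ {c} := by
    intro y hy d hd
    by_contra hne
    have := hy d hne
    rw [mem_zset, absO_val, abs_eq_zero] at hd
    linarith
  have habs : ∀ y : C → ℝ, (∀ d, d ≠ c → 0 < y d) → ∀ b : Orth C, absO y = b →
      (0 ≤ y c → y = b.1) ∧ (y c ≤ 0 → y = flipC c b.1) := by
    rintro y hy _ rfl
    constructor
    · intro h0; funext d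
      rw [absO_val]
      by_cases hd : d = c
      · subst hd; rw [abs_of_nonneg h0]
      · rw [abs_of_pos (hy d hd)]
    · intro h0; funext d
      unfold flipC
      rw [absO_val]
      by_cases hd : d = c
      · subst hd; rw [if_pos rfl, abs_of_nonpos h0, neg_neg]
      · rw [if_neg hd, abs_of_pos (hy d hd)]
  refine IsOpenEmbedding.of_continuous_injective_isOpenMap
    ((continuous_dbl h f c).comp continuous_subtype_val) ?_ ?_
  · rintro ⟨y, hy⟩ ⟨y', hy'⟩ he
    apply Subtype.ext
    simp only at he ⊢
    have ha := habs y hy _ rfl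
    have key : ∀ g g', q g (absO y) = q g' (absO y') → absO y' = absO y := fun g g' hg =>
      ((h.ker _ _ _ _).1 hg).1.symm
    unfold dbl at he
    split_ifs at he with h1 h2 h2
    · rw [ha.1 h1, (habs y' hy' _ (key _ _ he)).1 h2]
    · exfalso
      have h3 := (h.ker _ _ _ _).1 he
      rw [h3.1] at h3
      rcases conn_singleton hr (hz y' hy') h3.2 with h4 | ⟨h4, _⟩
      · exact hfree _ _ h4
      · rw [mem_zset, absO_val, abs_eq_zero] at h4
        linarith
    · exfalso
      have h3 := (h.ker _ _ _ _).1 he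
      rcases conn_singleton hr (hz y hy) h3.2 with h4 | ⟨h4, _⟩
      · exact hfree _ _ h4.symm
      · rw [mem_zset, absO_val, abs_eq_zero] at h4
        linarith
    · rw [ha.2 (by linarith), (habs y' hy' _ (key _ _ he)).2 (by linarith)]
  · intro V hV
    obtain ⟨V', hV', rfl⟩ := isOpen_induced_iff.1 hV
    rw [h.isOpen_iff]
    intro g
    have : q g ⁻¹' ((fun y : {y : C → ℝ | ∀ d, d ≠ c → 0 < y d} => dbl r q f c y.1) ''
        (Subtype.val ⁻¹' V')) =
        {b : Orth C | g = f} ∩ Subtype.val ⁻¹' (V' ∩ {y : C → ℝ | ∀ d, d ≠ c → 0 < y d}) ∪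
        {b : Orth C | g = r c f} ∩
        (fun b : Orth C => flipC c b.1) ⁻¹' (V' ∩ {y : C → ℝ | ∀ d, d ≠ c → 0 < y d}) := by
      ext b
      constructor
      · rintro ⟨⟨y, hy⟩, hyV, he⟩
        have hyV : y ∈ V' := hyV
        simp only at he
        unfold dbl at he
        split_ifs at he with h1
        · have h3 := (h.ker _ _ _ _).1 he
          have h5 := (habs y hy _ h3.1).1 h1
          rcases conn_singleton hr (hz y hy) h3.2 with h4 | ⟨h4, h4'⟩
          · left; exact ⟨h4, by rw [mem_preimage, ← h5]; exact ⟨hyV, hy⟩⟩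
          · right
            have h0 : y c = 0 := by rwa [mem_zset, absO_val, abs_eq_zero] at h4
            have h5 := (habs y hy _ h3.1).2 h0.le
            exact ⟨h4', by rw [mem_preimage, ← h5]; exact ⟨hyV, hy⟩⟩
        · have h3 := (h.ker _ _ _ _).1 he
          have h5 := (habs y hy _ h3.1).2 (by linarith)
          rcases conn_singleton hr (hz y hy) h3.2 with h4 | ⟨h4, h4'⟩
          · right; exact ⟨h4, by rw [mem_preimage, ← h5]; exact ⟨hyV, hy⟩⟩
          · exfalso
            rw [mem_zset, absO_val, abs_eq_zero] at h4
            linarith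
      · rintro (⟨rfl, hb1, hb2⟩ | ⟨rfl, hb1, hb2⟩)
        · exact ⟨⟨b.1, hb2⟩, hb1, dbl_orth _ _ _⟩
        · exact ⟨⟨_, hb2⟩, hb1, dbl_flip h _ _ _⟩
    rw [this]
    refine IsOpen.union ?_ ?_
    · exact IsOpen.inter isOpen_const ((hV'.inter hU).preimage continuous_subtype_val)
    · exact IsOpen.inter isOpen_const ((hV'.inter hU).preimage
        ((continuous_flipC c).comp continuous_subtype_val))

theorem isOpen_posset [Finite C] (T : Set C) : IsOpen {y : C → ℝ | ∀ d, d ∈ T → 0 < y d} := by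
  have : {y : C → ℝ | ∀ d, d ∈ T → 0 < y d} = ⋂ d : T, {y | 0 < y d.1} := by
    ext y; simp
  rw [this]
  exact isOpen_iInter_of_finite fun d => isOpen_lt continuous_const (continuous_apply _)

theorem eucAt_wall [Finite Φ] [Fintype C] (hr : ∀ c f, r c (r c f) = f)
    (hfree : ∀ c f, r c f ≠ f) (h : Pres r zset q) {n : ℕ} (hn : Fintype.card C = n)
    (f : Φ) (y : Orth C) (c : C) (hy : zset y ⊆ {c}) : EucAt n (q f y) := by
  have hpos : ∀ d, d ≠ c → 0 < y.1 d := by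
    intro d hd
    refine lt_of_le_of_ne (y.2 d) fun h0 => hd (hy h0.symm)
  have h1 := (EucAt.of_openEmbedding (n := n) (dbl_openEmbedding hr hfree h f c) ⟨y.1, hpos⟩).2
    ((EucAt.of_openEmbedding (n := n)
      (isOpen_posset {d | d ≠ c}).isOpenEmbedding_subtypeVal ⟨y.1, hpos⟩).1 (eucAt_pi hn _))
  simpa [dbl_orth] using h1

theorem exists_coord [Finite Φ] {A : Type*} [TopologicalSpace A] {Z : A → Set C} {q : Φ → A → Y}
    (h : Pres r Z q) :
    ∃ co : Y → A, Continuous co ∧ ∀ f a, co (q f a) = a := by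
  choose F P hFP using h.surj
  have h1 : ∀ f a, P (q f a) = a := fun f a => ((h.ker _ _ _ _).1 (hFP (q f a))).1
  refine ⟨P, ?_, h1⟩
  rw [h.continuous_iff]
  intro f
  simp only [h1]
  exact continuous_id

/-- Positive diagonal scaling. -/
def scaleO {C : Type*} (s : C → ℝ) (hs : ∀ c, 0 < s c) : Orth C ≃ₜ Orth C where
  toFun y := ⟨fun c => s c * y.1 c, fun c => mul_nonneg (hs c).le (y.2 c)⟩
  invFun y := ⟨fun c => (s c)⁻¹ * y.1 c, fun c => mul_nonneg (inv_nonneg.2 (hs c).le) (y.2 c)⟩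
  left_inv y := Subtype.ext (funext fun c => by simp [(hs c).ne'])
  right_inv y := Subtype.ext (funext fun c => by simp [(hs c).ne'])
  continuous_toFun := by
    refine Continuous.subtype_mk (continuous_pi fun c => ?_) _
    have : Continuous fun y : Orth C => y.1 c := (continuous_apply c).comp continuous_subtype_val
    exact this.const_mul (s c)
  continuous_invFun := by
    refine Continuous.subtype_mk (continuous_pi fun c => ?_) _
    have : Continuous fun y : Orth C => y.1 c := (continuous_apply c).comp continuous_subtype_val
    exact this.const_mul (s c)⁻¹

theorem exists_scaling [Finite Φ] (h : Pres r zset q) (s : C → ℝ) (hs : ∀ c, 0 < s c) :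
    ∃ e : Y ≃ₜ Y, ∀ f a, e (q f a) = q f (scaleO s hs a) := by
  refine h.exists_homeo h (scaleO s hs) fun a f g => ?_
  have : zset (scaleO s hs a) = zset a := by
    ext c
    have := (hs c).ne'
    simp only [mem_zset]
    change s c * a.1 c = 0 ↔ _
    simp [this]
  rw [this]

end orth

end GlueAux

namespace GlueAux
open Set Filter Topology

section
variable {C Φ Y : Type*} [TopologicalSpace Y] {r : C → Φ → Φ} {q : Φ → Orth C → Y}

theorem isOpen_star [Finite Φ] [Finite C] (hr : ∀ c f, r c (r c f) = f)
    (h : Pres r zset q) (f : Φ) (T : Set C) :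
    IsOpen {z | ∃ g y, conn r T f g ∧ (∀ c ∉ T, 0 < (y : Orth C).1 c) ∧ q g y = z} := by
  rw [h.isOpen_iff]
  intro g
  have hz : ∀ y : Orth C, (∀ c ∉ T, 0 < y.1 c) → zset y ⊆ T := by
    intro y hy c hc
    by_contra hcT
    have := hy c hcT
    rw [mem_zset] at hc
    linarith
  have : q g ⁻¹' {z | ∃ g y, conn r T f g ∧ (∀ c ∉ T, 0 < (y : Orth C).1 c) ∧ q g y = z} =
      {y | conn r T f g} ∩ Subtype.val ⁻¹' {y : C → ℝ | ∀ d, d ∈ Tᶜ → 0 < y d} := by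
    ext y
    constructor
    · rintro ⟨g', y', h1, h2, h3⟩
      obtain ⟨rfl, h4⟩ := (h.ker _ _ _ _).1 h3
      exact ⟨h1.trans (h4.mono (hz _ h2)), h2⟩
    · rintro ⟨h1, h2⟩
      exact ⟨g, y, h1, h2, rfl⟩
  rw [this]
  exact isOpen_const.inter ((isOpen_posset _).preimage continuous_subtype_val)

theorem eucAt_of_half [Finite Φ] [Fintype C] (hr : ∀ c f, r c (r c f) = f)
    (hfree : ∀ c f, r c f ≠ f) (h : Pres r zset q) {n : ℕ} (hn : Fintype.card C = n)
    (hn1 : 1 ≤ n) (hH : ∀ z : Y, HalfAt n z) (z : Y) : EucAt n z := by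
  obtain ⟨f, y0, rfl⟩ := h.surj z
  obtain ⟨k, hk⟩ : ∃ k, (zset y0).ncard = k := ⟨_, rfl⟩
  induction k using Nat.strong_induction_on generalizing f y0 with
  | _ k ih =>
  by_contra hne
  let T := zset y0
  -- at least two zero coordinates
  have hT2 : 2 ≤ T.ncard := by
    by_contra hlt
    have h1 : T.ncard ≤ 1 := by omega
    rw [Set.ncard_le_one (toFinite _)] at h1
    have : Nonempty C := Fintype.card_pos_iff.1 (by omega)
    rcases T.eq_empty_or_nonempty with h0 | ⟨c, hc⟩
    · exact hne (eucAt_wall hr hfree h hn f y0 (Classical.arbitrary C)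
        (by rw [show zset y0 = ∅ from h0]; exact empty_subset _))
    · exact hne (eucAt_wall hr hfree h hn f y0 c (fun d hd => h1 d hd c hc))
  obtain ⟨ψ, hψ⟩ := hH (q f y0)
  have hzero : ∀ z ∈ ψ.source, ¬ EucAt n z → ((ψ z).2 : ℝ) = 0 := by
    intro z hz hnz
    by_contra h0
    exact hnz (eucAt_of_half_pos hn1 ψ hz (lt_of_le_of_ne (ψ z).2.2 (Ne.symm h0)))
  have hcell : ∀ y : Orth C, zset y = T → ¬ EucAt n (q f y) := by
    intro y hy hE
    have hs : ∀ c, 0 < (if c ∈ T then 1 else y.1 c / y0.1 c : ℝ) := by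
      intro c
      split_ifs with hc
      · exact one_pos
      · have h1 : y.1 c ≠ 0 := fun h0 => hc (hy ▸ (mem_zset.2 h0))
        have h2 : y0.1 c ≠ 0 := fun h0 => hc (mem_zset.2 h0)
        exact div_pos (lt_of_le_of_ne (y.2 c) h1.symm) (lt_of_le_of_ne (y0.2 c) h2.symm)
    obtain ⟨e, he⟩ := exists_scaling h _ hs
    have h1 : e (q f y0) = q f y := by
      rw [he]
      congr 1
      apply Subtype.ext; funext c
      simp only [scaleO, Homeomorph.homeomorph_mk_coe, Equiv.coe_fn_mk]
      split_ifs with hc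
      · have h1 : y.1 c = 0 := by rw [← hy] at hc; exact hc
        have h2 : y0.1 c = 0 := hc
        rw [h1, h2, mul_zero]
      · have h2 : y0.1 c ≠ 0 := fun h0 => hc (mem_zset.2 h0)
        field_simp
    rw [← h1] at hE
    exact hne ((EucAt.of_openEmbedding e.isOpenEmbedding _).1 hE)
  obtain ⟨co, hco, hcoq⟩ := exists_coord h
  let κ := {c // c ∉ T}
  -- extension by zero
  let ex : (κ → ℝ) → Orth C := fun x =>
    ⟨fun c => if hc : c ∈ T then 0 else |x ⟨c, hc⟩|, fun c => by dsimp only; split_ifs <;> simp⟩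
  have hex : Continuous ex := by
    refine Continuous.subtype_mk (continuous_pi fun c => ?_) _
    by_cases hc : c ∈ T
    · simp only [hc, dite_true]; exact continuous_const
    · simp only [hc, dite_false]; fun_prop
  let x0 : κ → ℝ := fun c => y0.1 c.1
  have hex0 : ex x0 = y0 := by
    apply Subtype.ext; funext c
    simp only [ex, x0]
    split_ifs with hc
    · exact (mem_zset.1 hc).symm
    · exact abs_of_nonneg (y0.2 c)
  have hx0pos : ∀ c, 0 < x0 c := fun c =>
    lt_of_le_of_ne (y0.2 c) fun h0 => c.2 (mem_zset.2 h0.symm)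
  have hexz : ∀ x : κ → ℝ, (∀ c, 0 < x c) → zset (ex x) = T := by
    intro x hx
    ext c
    rw [mem_zset]
    simp only [ex]
    split_ifs with hc
    · simp [hc]
    · simp [hc, (hx ⟨c, hc⟩).ne']
  let z0 : ↥(Ici (0:ℝ)) := ⟨0, mem_Ici.2 le_rfl⟩
  let fF : (κ → ℝ) → (Fin (n - 1) → ℝ) := fun x => (ψ (q f (ex x))).1
  let gF : (Fin (n - 1) → ℝ) → (κ → ℝ) := fun v c => (co (ψ.symm (v, z0))).1 c.1
  let N : Set Y := {z | ∃ g y, conn r T f g ∧ (∀ c ∉ T, 0 < (y : Orth C).1 c) ∧ q g y = z}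
  have hN : IsOpen N := isOpen_star hr h f T
  have hpN : q f y0 ∈ N := ⟨f, y0, conn.refl _, fun c hc => hx0pos ⟨c, hc⟩, rfl⟩
  have hψ0 : ψ (q f y0) = (fF x0, z0) := by
    refine Prod.ext ?_ ?_
    · simp only [fF, hex0]
    · apply Subtype.ext; exact hzero _ hψ hne
  have hsymm0 : ψ.symm (fF x0, z0) = q f y0 := by rw [← hψ0]; exact ψ.left_inv hψ
  have hmem0 : (fF x0, z0) ∈ ψ.target := by rw [← hψ0]; exact ψ.map_source hψ
  have hι : Continuous fun v : Fin (n - 1) → ℝ => (v, z0) := by fun_prop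
  refine no_dim_drop_pi (ι := Fin (n - 1)) (κ := κ) ?_ fF gF x0
    ({x | q f (ex x) ∈ ψ.source} ∩ {x | ∀ c, c ∈ (univ : Set κ) → 0 < x c}) ?_ ?_
    ({v | (v, z0) ∈ ψ.target} ∩ {v | ψ.symm (v, z0) ∈ N}) ?_ ?_ ?_ ?_
  · have h1 : Fintype.card κ + T.ncard = n := by
      have := Set.ncard_add_ncard_compl T
      rw [Nat.card_eq_fintype_card, hn] at this
      rw [← this, add_comm]
      congr 1
      rw [← Nat.card_eq_fintype_card]
      rfl
    rw [Fintype.card_fin]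
    omega
  · refine inter_mem ?_ ((isOpen_posset _).mem_nhds (fun c _ => hx0pos c))
    exact ((ψ.open_source.preimage ((h.cont f).comp hex))).mem_nhds (by
      simp only [mem_preimage, Function.comp, hex0]; exact hψ)
  · refine continuous_fst.comp_continuousOn (ψ.continuousOn.comp
      ((h.cont f).comp hex).continuousOn ?_)
    intro x hx; exact hx.1
  · refine inter_mem ((ψ.open_target.preimage hι).mem_nhds hmem0) ?_
    have hc : ContinuousAt (fun v => ψ.symm (v, z0)) (fF x0) :=
      ContinuousAt.comp (f := fun v : Fin (n - 1) → ℝ => (v, z0))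
        (ψ.symm.continuousAt hmem0) hι.continuousAt
    exact hc.preimage_mem_nhds (by rw [hsymm0]; exact hN.mem_nhds hpN)
  · have h1 : ContinuousOn (fun v => co (ψ.symm (v, z0)))
        ({v | (v, z0) ∈ ψ.target} ∩ {v | ψ.symm (v, z0) ∈ N}) :=
      hco.comp_continuousOn (ψ.continuousOn_symm.comp hι.continuousOn fun v hv => hv.1)
    exact continuousOn_pi.2 fun c =>
      ((continuous_apply c.1).comp continuous_subtype_val).comp_continuousOn h1
  · rintro x ⟨hx1, hx2⟩
    have hpos : ∀ c, 0 < x c := fun c => hx2 c (mem_univ c)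
    have h1 : ψ (q f (ex x)) = (fF x, z0) := by
      refine Prod.ext rfl (Subtype.ext ?_)
      exact hzero _ hx1 (hcell _ (hexz x hpos))
    have h2 : ψ.symm (fF x, z0) = q f (ex x) := by rw [← h1]; exact ψ.left_inv hx1
    funext c
    simp only [gF, h2, hcoq, ex]
    rw [dif_neg c.2]
    exact abs_of_pos (hpos c)
  · rintro v ⟨hv1, hv2⟩ hgv
    obtain ⟨g, y, hg1, hg2, hg3⟩ := hv2
    have hv1' : ψ.symm (v, z0) ∈ ψ.source := ψ.map_target hv1
    have hright : ψ (ψ.symm (v, z0)) = (v, z0) := ψ.right_inv hv1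
    have hnE : ¬ EucAt n (ψ.symm (v, z0)) := by
      intro hE
      have := hE.half_pos ψ hv1'
      rw [hright] at this
      exact lt_irrefl _ this
    have hzy : zset y ⊆ T := by
      intro c hc
      by_contra hcT
      have := hg2 c hcT
      rw [mem_zset] at hc
      linarith
    have hzT : zset y = T := by
      by_contra hneT
      have hlt : (zset y).ncard < k := hk ▸ Set.ncard_lt_ncard (hzy.ssubset_of_ne hneT) (toFinite _)
      refine hnE ?_
      rw [← hg3]
      exact ih _ hlt g y rfl
    have hyy0 : y = y0 := by
      apply Subtype.ext; funext c
      by_cases hc : c ∈ T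
      · have h1 : y.1 c = 0 := by rw [← hzT] at hc; exact hc
        have h2 : y0.1 c = 0 := hc
        rw [h1, h2]
      · have := congrFun hgv ⟨c, hc⟩
        simp only [gF, ← hg3, hcoq, x0] at this
        exact this
    subst hyy0
    have h5 : q g y = q f y := ((h.ker _ _ _ _).2 ⟨rfl, hg1⟩).symm
    have : ψ (q f y) = (v, z0) := by rw [← h5, hg3, hright]
    rw [hψ0] at this
    exact (congrArg Prod.fst this).symm

end

end GlueAux

namespace GlueAux
open Set Filter Topology

section chain
variable {Φ : Type*}

/-- The orbit of a flag under two involutions. -/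
def orb (A B : Φ → Φ) (f : Φ) : Set Φ :=
  {x | Relation.ReflTransGen (fun u v => v = A u ∨ v = B u) f x}

/-- The alternating sequence. -/
def useq (A B : Φ → Φ) (f : Φ) : ℕ → Φ
  | 0 => f
  | j + 1 => if j % 2 = 0 then A (useq A B f j) else B (useq A B f j)

theorem orb_self (A B : Φ → Φ) (f : Φ) : f ∈ orb A B f := Relation.ReflTransGen.refl

theorem orb_A {A B : Φ → Φ} {f x : Φ} (h : x ∈ orb A B f) : A x ∈ orb A B f :=
  Relation.ReflTransGen.tail h (Or.inl rfl)

theorem orb_B {A B : Φ → Φ} {f x : Φ} (h : x ∈ orb A B f) : B x ∈ orb A B f :=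
  Relation.ReflTransGen.tail h (Or.inr rfl)

theorem useq_orb (A B : Φ → Φ) (f : Φ) (j : ℕ) : useq A B f j ∈ orb A B f := by
  induction j with
  | zero => exact orb_self A B f
  | succ j ih =>
    simp only [useq]
    split_ifs
    · exact orb_A ih
    · exact orb_B ih

theorem useq_period [Finite Φ] {A B : Φ → Φ} (hA : ∀ x, A (A x) = x) (hB : ∀ x, B (B x) = x)
    (hAf : ∀ x, A x ≠ x) (hBf : ∀ x, B x ≠ x) (f : Φ) :
    ∃ N, 2 ≤ N ∧ N % 2 = 0 ∧ useq A B f N = f ∧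
      (∀ i < N, ∀ j < N, useq A B f i = useq A B f j → i = j) := by
  have hex : ∃ j, ∃ i < j, useq A B f i = useq A B f j := by
    obtain ⟨i, j, hne, h⟩ := Finite.exists_ne_map_eq_of_infinite (useq A B f)
    rcases lt_or_gt_of_ne hne with h1 | h1
    · exact ⟨j, i, h1, h⟩
    · exact ⟨i, j, h1, h.symm⟩
  let N := Nat.find hex
  obtain ⟨i, hiN, hi⟩ : ∃ i < N, useq A B f i = useq A B f N := Nat.find_spec hex
  have hmin : ∀ i < N, ∀ j < N, useq A B f i = useq A B f j → i = j := by
    intro i hi j hj h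
    by_contra hne
    rcases lt_or_gt_of_ne hne with h1 | h1
    · exact Nat.find_min hex hj ⟨i, h1, h⟩
    · exact Nat.find_min hex hi ⟨j, h1, h.symm⟩
  have hs0 : ∀ j, j % 2 = 0 → useq A B f (j + 1) = A (useq A B f j) := fun j hj => by
    simp [useq, hj]
  have hs1 : ∀ j, j % 2 = 1 → useq A B f (j + 1) = B (useq A B f j) := fun j hj => by
    simp [useq, hj]
  have hb0 : ∀ j, j % 2 = 0 → useq A B f j = A (useq A B f (j + 1)) := fun j hj => by
    rw [hs0 j hj, hA]
  have hb1 : ∀ j, j % 2 = 1 → useq A B f j = B (useq A B f (j + 1)) := fun j hj => by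
    rw [hs1 j hj, hB]
  obtain ⟨M, hM⟩ : ∃ M, N = M + 1 := ⟨N - 1, by omega⟩
  -- forward collision is impossible
  have hfor : M % 2 = i % 2 → False := by
    intro hp
    have h1 : useq A B f M = useq A B f (i + 1) := by
      rcases Nat.mod_two_eq_zero_or_one i with h | h
      · rw [hs0 i h, hi, hM, ← hb0 M (by omega)]
      · rw [hs1 i h, hi, hM, ← hb1 M (by omega)]
    by_cases h2 : i + 1 < N
    · have := hmin M (by omega) (i + 1) h2 h1
      omega
    · have h3 : i = M := by omega
      subst h3
      rcases Nat.mod_two_eq_zero_or_one i with h | h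
      · have := hs0 i h
        rw [← h1] at this; exact hAf _ this.symm
      · have := hs1 i h
        rw [← h1] at this; exact hBf _ this.symm
  have hi0 : i = 0 := by
    by_contra hne
    obtain ⟨i', rfl⟩ : ∃ i', i = i' + 1 := ⟨i - 1, by omega⟩
    have hp : M % 2 = i' % 2 := by
      by_contra hp; exact hfor (by omega)
    have h1 : useq A B f M = useq A B f i' := by
      rcases Nat.mod_two_eq_zero_or_one i' with h | h
      · rw [hb0 i' h, hi, hM, ← hb0 M (by omega)]
      · rw [hb1 i' h, hi, hM, ← hb1 M (by omega)]
    have := hmin M (by omega) i' (by omega) h1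
    omega
  subst hi0
  refine ⟨N, ?_, ?_, ?_, hmin⟩
  · by_contra h
    exact hfor (by omega)
  · by_contra h
    exact hfor (by omega)
  · rw [← hi]; rfl

/-- The chain coordinate at position `j`. -/
def muj (k : ℕ) (j : ℕ) (s t : ℝ) : ℝ :=
  (s + t) - 2 * (j * (s + t) + if j % 2 = 0 then s else t) / k

theorem exists_chain [Finite Φ] {A B : Φ → Φ} (hA : ∀ x, A (A x) = x) (hB : ∀ x, B (B x) = x)
    (hAf : ∀ x, A x ≠ x) (hBf : ∀ x, B x ≠ x) (f : Φ) :
    ∃ μ : Φ → ℝ → ℝ → ℝ,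
      (∀ x, Continuous fun p : ℝ × ℝ => μ x p.1 p.2) ∧
      (∀ s t, μ f s t = t - s) ∧
      (∀ x ∈ orb A B f, ∀ s t, 0 ≤ s → 0 ≤ t → |μ x s t| ≤ s + t) ∧
      (∀ x ∈ orb A B f, ∀ t, μ (A x) 0 t = μ x 0 t) ∧
      (∀ x ∈ orb A B f, ∀ s, μ (B x) s 0 = μ x s 0) ∧
      (∀ x ∈ orb A B f, x ≠ f → ∀ x' ∈ orb A B f, x' ≠ f → ∀ s t s' t', 0 ≤ s → 0 ≤ t → 0 ≤ s' →
        0 ≤ t' → s + t = s' + t' → μ x s t = μ x' s' t' → s = s' ∧ t = t' ∧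
        Relation.ReflTransGen (fun u v => v ≠ f ∧ ((s = 0 ∧ v = A u) ∨ (t = 0 ∧ v = B u))) x x') ∧
      (∀ τ u, |u| ≤ τ → ∃ x ∈ orb A B f, x ≠ f ∧ ∃ s t, 0 ≤ s ∧ 0 ≤ t ∧ s + t = τ ∧ μ x s t = u) := by
  obtain ⟨N, hN2, hNe, hNf, hmin⟩ := useq_period hA hB hAf hBf f
  obtain ⟨k, rfl⟩ : ∃ k, N = k + 1 := ⟨N - 1, by omega⟩
  have hk1 : 1 ≤ k := by omega
  have hkodd : k % 2 = 1 := by omega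
  have hkR : (0 : ℝ) < k := by exact_mod_cast hk1
  have hs0 : ∀ j, j % 2 = 0 → useq A B f (j + 1) = A (useq A B f j) := fun j hj => by
    simp [useq, hj]
  have hs1 : ∀ j, j % 2 = 1 → useq A B f (j + 1) = B (useq A B f j) := fun j hj => by
    simp [useq, hj]
  have hb0 : ∀ j, j % 2 = 0 → A (useq A B f (j + 1)) = useq A B f j := fun j hj => by
    rw [hs0 j hj, hA]
  have hb1 : ∀ j, j % 2 = 1 → B (useq A B f (j + 1)) = useq A B f j := fun j hj => by
    rw [hs1 j hj, hB]
  have hu0 : useq A B f 0 = f := rfl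
  have hBk : B (useq A B f k) = f := by rw [← hs1 k hkodd, hNf]
  have hBf0 : B f = useq A B f k := by
    have := congrArg B hBk
    rw [hB] at this
    exact this.symm
  -- every element of the orbit is in the list
  have hcov : ∀ x ∈ orb A B f, ∃ i ≤ k, x = useq A B f i := by
    intro x hx
    induction hx with
    | refl => exact ⟨0, by omega, rfl⟩
    | tail _ hs ih =>
      obtain ⟨i, hi, rfl⟩ := ih
      rcases hs with rfl | rfl
      · rcases Nat.mod_two_eq_zero_or_one i with h | h
        · exact ⟨i + 1, by omega, (hs0 i h).symm⟩
        · obtain ⟨i', rfl⟩ : ∃ i', i = i' + 1 := ⟨i - 1, by omega⟩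
          exact ⟨i', by omega, hb0 i' (by omega)⟩
      · rcases Nat.mod_two_eq_zero_or_one i with h | h
        · rcases Nat.eq_zero_or_pos i with rfl | h0
          · exact ⟨k, le_rfl, hBf0⟩
          · obtain ⟨i', rfl⟩ : ∃ i', i = i' + 1 := ⟨i - 1, by omega⟩
            exact ⟨i', by omega, hb1 i' (by omega)⟩
        · by_cases hik : i = k
          · subst hik; exact ⟨0, by omega, hBk⟩
          · exact ⟨i + 1, by omega, (hs1 i h).symm⟩
  have hcov' : ∀ x ∈ orb A B f, x ≠ f → ∃ j < k, x = useq A B f (j + 1) := by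
    intro x hx hne
    obtain ⟨i, hi, rfl⟩ := hcov x hx
    rcases Nat.eq_zero_or_pos i with rfl | h0
    · exact absurd rfl hne
    · exact ⟨i - 1, by omega, by congr 1; omega⟩
  have hnef : ∀ j < k, useq A B f (j + 1) ≠ f := by
    intro j hj h
    have := hmin (j + 1) (by omega) 0 (by omega) (h.trans hu0.symm)
    omega
  let pos : Φ → ℕ := fun x => if h : ∃ j < k, x = useq A B f (j + 1) then h.choose else 0
  have hpos : ∀ j < k, pos (useq A B f (j + 1)) = j := by
    intro j hj
    have hex : ∃ j' < k, useq A B f (j + 1) = useq A B f (j' + 1) := ⟨j, hj, rfl⟩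
    simp only [pos, dif_pos hex]
    have h1 := hex.choose_spec
    have := hmin (j + 1) (by omega) _ (by omega) h1.2
    omega
  let μ : Φ → ℝ → ℝ → ℝ := fun x s t => if x = f then t - s else muj k (pos x) s t
  have hμf : ∀ s t, μ f s t = t - s := fun s t => by simp [μ]
  have hμj : ∀ j < k, ∀ s t, μ (useq A B f (j + 1)) s t = muj k j s t := by
    intro j hj s t
    simp only [μ, if_neg (hnef j hj), hpos j hj]
  have hm1 : ∀ j, j % 2 = 0 → ∀ s, muj k (j + 1) s 0 = muj k j s 0 := by
    intro j hj s
    have : (j + 1) % 2 = 1 := by omega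
    simp only [muj, hj, this]; push_cast; simp; ring
  have hm2 : ∀ j, j % 2 = 1 → ∀ t, muj k (j + 1) 0 t = muj k j 0 t := by
    intro j hj s
    have : (j + 1) % 2 = 0 := by omega
    simp only [muj, hj, this]; push_cast; simp; ring
  have hm0 : ∀ t, muj k 0 0 t = t := fun t => by simp [muj]
  have hmk : ∀ s, muj k (k - 1) s 0 = - s := fun s => by
    have : (k - 1) % 2 = 0 := by omega
    simp only [muj, this, if_true]
    rw [Nat.cast_sub hk1]; field_simp; push_cast; ring
  have hA1 : μ (A f) = μ (useq A B f (0 + 1)) := by rw [hs0 0 rfl, hu0]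
  have hB1 : μ (B f) = μ (useq A B f (k - 1 + 1)) := by rw [hBf0]; congr 2; omega
  -- the range of chain positions
  have hrange : ∀ j < k, ∀ s t : ℝ, 0 ≤ s → 0 ≤ t → |muj k j s t| ≤ s + t := by
    intro j hj s t hs ht
    have hjk : (j : ℝ) + 1 ≤ k := by exact_mod_cast hj
    have hj0 : (0 : ℝ) ≤ j := Nat.cast_nonneg j
    have h1 : 0 ≤ j * (s + t) + (if j % 2 = 0 then s else t) := by
      split_ifs <;> positivity
    have h2 : j * (s + t) + (if j % 2 = 0 then s else t) ≤ k * (s + t) := by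
      split_ifs <;> nlinarith
    have h3 : 2 * (j * (s + t) + (if j % 2 = 0 then s else t)) / k ≤ 2 * (s + t) := by
      rw [div_le_iff₀ hkR]; nlinarith
    have h4 : 0 ≤ 2 * (j * (s + t) + (if j % 2 = 0 then s else t)) / k := by positivity
    rw [abs_le]; unfold muj
    constructor <;> linarith
  refine ⟨μ, ?_, hμf, ?_, ?_, ?_, ?_, ?_⟩
  · intro x
    by_cases hx : x = f
    · simp only [μ, if_pos hx]; fun_prop
    · simp only [μ, if_neg hx, muj]
      split_ifs <;> fun_prop
  · intro x hx s t hs ht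
    by_cases hxf : x = f
    · subst hxf; rw [hμf, abs_le]; constructor <;> linarith
    · obtain ⟨j, hj, rfl⟩ := hcov' x hx hxf
      rw [hμj j hj]
      exact hrange j hj s t hs ht
  · intro x hx t
    by_cases hxf : x = f
    · subst hxf; rw [hA1, hμj 0 (by omega), hm0, hμf, sub_zero]
    · obtain ⟨j, hj, rfl⟩ := hcov' x hx hxf
      rcases Nat.mod_two_eq_zero_or_one j with h | h
      · rw [hb0 j h]
        rcases Nat.eq_zero_or_pos j with rfl | h0
        · rw [hu0, hμj 0 hj, hm0, hμf, sub_zero]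
        · obtain ⟨i, rfl⟩ : ∃ i, j = i + 1 := ⟨j - 1, by omega⟩
          rw [hμj _ hj, hμj i (by omega), hm2 i (by omega)]
      · rw [← hs0 (j + 1) (by omega), hμj (j + 1) (by omega), hμj j hj, hm2 j h]
  · intro x hx s
    by_cases hxf : x = f
    · subst hxf; rw [hB1, hμj _ (by omega), hmk, hμf, zero_sub]
    · obtain ⟨j, hj, rfl⟩ := hcov' x hx hxf
      rcases Nat.mod_two_eq_zero_or_one j with h | h
      · by_cases hjk : j + 1 = k
        · rw [hμj j hj, hjk, hBk, hμf, zero_sub, show j = k - 1 by omega, hmk]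
        · rw [← hs1 (j + 1) (by omega), hμj (j + 1) (by omega), hμj j hj, hm1 j h]
      · rw [hb1 j h]
        obtain ⟨i, rfl⟩ : ∃ i, j = i + 1 := ⟨j - 1, by omega⟩
        rw [hμj _ hj, hμj i (by omega), hm1 i (by omega)]
  · -- kernel
    have hpath : ∀ d j, j + d < k → Relation.ReflTransGen (fun u v => v ≠ f ∧
        (((0:ℝ) = 0 ∧ v = A u) ∨ ((0:ℝ) = 0 ∧ v = B u))) (useq A B f (j + 1))
          (useq A B f (j + d + 1)) := by
      intro d j hjd
      induction d with
      | zero => exact Relation.ReflTransGen.refl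
      | succ d ih =>
        refine (ih (by omega)).tail ⟨hnef _ (by omega), ?_⟩
        rcases Nat.mod_two_eq_zero_or_one (j + d + 1) with h | h
        · exact Or.inl ⟨rfl, hs0 _ h⟩
        · exact Or.inr ⟨rfl, hs1 _ h⟩
    have hpath' : ∀ d j, j + d < k → Relation.ReflTransGen (fun u v => v ≠ f ∧
        (((0:ℝ) = 0 ∧ v = A u) ∨ ((0:ℝ) = 0 ∧ v = B u))) (useq A B f (j + d + 1))
          (useq A B f (j + 1)) := by
      intro d j hjd
      induction d with
      | zero => exact Relation.ReflTransGen.refl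
      | succ d ih =>
        refine Relation.ReflTransGen.head ⟨hnef _ (by omega), ?_⟩ (ih (by omega))
        rcases Nat.mod_two_eq_zero_or_one (j + d + 1) with h | h
        · exact Or.inl ⟨rfl, (hb0 _ h).symm⟩
        · exact Or.inr ⟨rfl, (hb1 _ h).symm⟩
    -- positions differ by at most one
    have key : ∀ j j', j < j' → j' < k → ∀ s t s' t' : ℝ, 0 ≤ s → 0 ≤ t → 0 ≤ s' → 0 ≤ t' →
        s + t = s' + t' → muj k j s t = muj k j' s' t' → 0 < s + t → s = s' ∧ t = t' ∧ j' = j + 1 ∧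
        (j % 2 = 0 → t = 0) ∧ (j % 2 = 1 → s = 0) := by
      intro j j' hjj hj' s t s' t' hs ht hs' ht' hst he hpos
      unfold muj at he
      rw [← hst] at he
      have he2 : j * (s + t) + (if j % 2 = 0 then s else t) =
          j' * (s + t) + (if j' % 2 = 0 then s' else t') := by
        have h1 : 2 * (j * (s + t) + (if j % 2 = 0 then s else t)) / k =
          2 * (j' * (s + t) + (if j' % 2 = 0 then s' else t')) / k := by linarith
        rw [div_left_inj' hkR.ne'] at h1
        linarith
      have h3 : j' = j + 1 := by
        by_contra hne
        have h4 : j + 2 ≤ j' := by omega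
        have h5 : (j : ℝ) + 2 ≤ j' := by exact_mod_cast h4
        have h6 : (if j % 2 = 0 then s else t) ≤ s + t := by split_ifs <;> linarith
        have h7 : 0 ≤ (if j' % 2 = 0 then s' else t') := by split_ifs <;> assumption
        nlinarith
      subst h3
      rcases Nat.mod_two_eq_zero_or_one j with h | h
      · have h' : (j + 1) % 2 = 1 := by omega
        simp only [h, h', if_true] at he2
        push_cast at he2
        norm_num at he2
        refine ⟨?_, ?_, rfl, fun _ => ?_, fun h'' => by omega⟩ <;> linarith
      · have h' : (j + 1) % 2 = 0 := by omega
        simp only [h, h', if_true] at he2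
        push_cast at he2
        norm_num at he2
        refine ⟨?_, ?_, rfl, fun h'' => by omega, fun _ => ?_⟩ <;> linarith
    intro x hx hxf x' hx' hxf' s t s' t' hs ht hs' ht' hst he
    obtain ⟨j, hj, rfl⟩ := hcov' x hx hxf
    obtain ⟨j', hj', rfl⟩ := hcov' x' hx' hxf'
    rw [hμj j hj, hμj j' hj'] at he
    rcases (add_nonneg hs ht).eq_or_lt with h0 | h0
    · have e1 : s = 0 := by linarith
      have e2 : t = 0 := by linarith
      have e3 : s' = 0 := by linarith
      have e4 : t' = 0 := by linarith
      subst e1 e2 e3 e4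
      refine ⟨rfl, rfl, ?_⟩
      rcases le_total j j' with h | h
      · have := hpath (j' - j) j (by omega)
        rwa [show j + (j' - j) = j' by omega] at this
      · have := hpath' (j - j') j' (by omega)
        rwa [show j' + (j - j') = j by omega] at this
    · rcases lt_trichotomy j j' with h | h | h
      · obtain ⟨e1, e2, rfl, e3, e4⟩ := key j j' h hj' s t s' t' hs ht hs' ht' hst he h0
        refine ⟨e1, e2, Relation.ReflTransGen.single ⟨hnef _ hj', ?_⟩⟩
        rcases Nat.mod_two_eq_zero_or_one j with h | h
        · exact Or.inr ⟨e3 h, hs1 _ (by omega)⟩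
        · exact Or.inl ⟨e4 h, hs0 _ (by omega)⟩
      · subst h
        unfold muj at he
        rw [← hst] at he
        have he2 : (if j % 2 = 0 then s else t) = (if j % 2 = 0 then s' else t') := by
          have h1 : 2 * (j * (s + t) + (if j % 2 = 0 then s else t)) / k =
            2 * (j * (s + t) + (if j % 2 = 0 then s' else t')) / k := by linarith
          rw [div_left_inj' hkR.ne'] at h1
          linarith
        have : s = s' := by
          split_ifs at he2 <;> linarith
        exact ⟨this, by linarith, Relation.ReflTransGen.refl⟩
      · obtain ⟨e1, e2, rfl, e3, e4⟩ := key j' j h hj s' t' s t hs' ht' hs ht hst.symm he.symm (hst ▸ h0)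
        refine ⟨e1.symm, e2.symm, Relation.ReflTransGen.single ⟨hnef _ hj', ?_⟩⟩
        rcases Nat.mod_two_eq_zero_or_one j' with h | h
        · exact Or.inr ⟨e2 ▸ e3 h, (hb1 _ (by omega)).symm⟩
        · exact Or.inl ⟨e1 ▸ e4 h, (hb0 _ (by omega)).symm⟩
  · intro τ u hu
    have hτ : 0 ≤ τ := (abs_nonneg u).trans hu
    rw [abs_le] at hu
    -- find the position
    let w := (τ - u) * k / 2
    have hw0 : 0 ≤ w := by have : 0 ≤ τ - u := by linarith
                           positivity
    have hwk : w ≤ k * τ := by simp only [w]; nlinarith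
    obtain ⟨j, hj, hj1, hj2⟩ : ∃ j : ℕ, j < k ∧ j * τ ≤ w ∧ w ≤ (j + 1) * τ := by
      have : ∀ m : ℕ, 1 ≤ m → ∀ w, 0 ≤ w → w ≤ m * τ → ∃ j : ℕ, j < m ∧ j * τ ≤ w ∧ w ≤ (j + 1) * τ := by
        intro m hm
        induction m, hm using Nat.le_induction with
        | base => intro w h1 h2; exact ⟨0, by omega, by simpa using h1, by simpa using h2⟩
        | succ m hm ih =>
          intro w h1 h2
          by_cases h3 : w ≤ m * τ
          · obtain ⟨j, hj, h⟩ := ih w h1 h3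
            exact ⟨j, by omega, h⟩
          · exact ⟨m, by omega, by linarith, by exact_mod_cast h2⟩
      exact this k hk1 w hw0 hwk
    refine ⟨useq A B f (j + 1), useq_orb _ _ _ _, hnef j hj, ?_⟩
    have hfin : τ - 2 * w / k = u := by simp only [w]; field_simp; ring
    rcases Nat.mod_two_eq_zero_or_one j with h | h
    · refine ⟨w - j * τ, τ - (w - j * τ), by linarith, by linarith, by ring, ?_⟩
      rw [hμj j hj, muj, if_pos h]
      rw [← hfin]; ring
    · refine ⟨τ - (w - j * τ), w - j * τ, by linarith, by linarith, by ring, ?_⟩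
      rw [hμj j hj, muj, if_neg (by omega)]
      rw [← hfin]; ring

end chain

end GlueAux

namespace GlueAux
open Set Filter Topology

theorem descend {Ψ A W Y : Type*} [TopologicalSpace A] [TopologicalSpace W] [TopologicalSpace Y]
    [Finite Ψ] (L : Ψ → A → W) (hcl : ∀ x, IsClosedMap (L x))
    (hs : ∀ w, ∃ x a, L x a = w) (q : Ψ → A → Y) (hq : ∀ x, Continuous (q x))
    (hk : ∀ x a x' a', L x a = L x' a' → q x a = q x' a') :
    ∃ D : W → Y, Continuous D ∧ ∀ x a, D (L x a) = q x a := by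
  choose F P hFP using hs
  have h1 : ∀ x a, q (F (L x a)) (P (L x a)) = q x a := fun x a => hk _ _ _ _ (hFP _)
  refine ⟨fun w => q (F w) (P w), ?_, h1⟩
  rw [continuous_iff_isClosed]
  intro K hK
  have : (fun w => q (F w) (P w)) ⁻¹' K = ⋃ x, L x '' (q x ⁻¹' K) := by
    ext w
    simp only [mem_preimage, mem_iUnion, mem_image]
    constructor
    · intro hw; exact ⟨F w, P w, hw, hFP w⟩
    · rintro ⟨x, a, ha, rfl⟩; rwa [h1]
  rw [this]
  exact isClosed_iUnion_of_finite fun x => hcl x _ (hK.preimage (hq x))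

theorem isClosedMap_orth {C W : Type*} [Finite C] [TopologicalSpace W] [T2Space W]
    [WeaklyLocallyCompactSpace W] (h : Orth C → W) (hc : Continuous h) (N : W → ℝ)
    (hN : Continuous N) (hb : ∀ y c, y.1 c ≤ N (h y)) : IsClosedMap h := by
  refine IsProperMap.isClosedMap (isProperMap_iff_isCompact_preimage.2 ⟨hc, ?_⟩)
  intro K hK
  obtain ⟨M, hM⟩ := (hK.image hN).bddAbove
  have hcomp : IsCompact {y : Orth C | ∀ c, y.1 c ≤ M} := by
    have : IsClosedEmbedding (Subtype.val : Orth C → C → ℝ) := by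
      refine IsClosed.isClosedEmbedding_subtypeVal (s := {y : C → ℝ | ∀ c, 0 ≤ y c}) ?_
      have : {y : C → ℝ | ∀ c, 0 ≤ y c} = ⋂ c, {y | 0 ≤ y c} := by ext; simp
      rw [this]
      exact isClosed_iInter fun c => isClosed_le continuous_const (continuous_apply c)
    have h2 := this.isCompact_preimage (isCompact_univ_pi fun _ : C => isCompact_Icc (a := (0:ℝ)) (b := M))
    convert h2 using 1
    ext y
    simp only [mem_preimage, mem_univ_pi, mem_Icc]
    exact ⟨fun hy c => ⟨y.2 c, hy c⟩, fun hy c => (hy c).2⟩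
  refine hcomp.of_isClosed_subset (hK.isClosed.preimage hc) ?_
  intro y hy c
  exact (hb y c).trans (hM ⟨_, hy, rfl⟩)

theorem continuous_coordO {C : Type*} (c : C) : Continuous fun y : Orth C => y.1 c :=
  (continuous_apply c).comp continuous_subtype_val

theorem two_homeo {C Φ Y : Type*} [TopologicalSpace Y] {r : C → Φ → Φ} {q : Φ → Orth C → Y}
    [Finite Φ] [Finite C] (hr : ∀ c f, r c (r c f) = f)
    (hfree : ∀ c f, r c f ≠ f) (h : Pres r zset q) (a b : C) (hab : a ≠ b)
    (hC : ∀ d, d = a ∨ d = b) (f : Φ) (hf : ∀ x, x ∈ orb (r a) (r b) f) :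
    Nonempty (Y ≃ₜ ℝ × ℝ) := by
  obtain ⟨μ, hμc, hμf, hμb, hμA, hμB, hμk, hμs⟩ :=
    exists_chain (hr a) (hr b) (hfree a) (hfree b) f
  let s : Φ → ℝ := fun x => if x = f then -1 else 1
  let L : Φ → Orth C → ℝ × ℝ := fun x y =>
    (μ x (y.1 a) (y.1 b), s x * (y.1 a + y.1 b - |μ x (y.1 a) (y.1 b)|))
  have hs1 : ∀ x, |s x| = 1 := fun x => by simp only [s]; split_ifs <;> simp
  have hsf : s f = -1 := by simp [s]
  have hsn : ∀ x, x ≠ f → s x = 1 := fun x hx => by simp [s, hx]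
  have hnn : ∀ x (y : Orth C), 0 ≤ y.1 a + y.1 b - |μ x (y.1 a) (y.1 b)| := fun x y => by
    have := hμb x (hf x) _ _ (y.2 a) (y.2 b); linarith
  have hLn : ∀ x y, |(L x y).1| + |(L x y).2| = y.1 a + y.1 b := by
    intro x y
    simp only [L, abs_mul, hs1, abs_of_nonneg (hnn x y)]
    ring
  have hLc : ∀ x, Continuous (L x) := by
    intro x
    have h1 : Continuous fun y : Orth C => μ x (y.1 a) (y.1 b) :=
      (hμc x).comp ((continuous_coordO a).prodMk (continuous_coordO b))
    exact h1.prodMk (continuous_const.mul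
      (((continuous_coordO a).add (continuous_coordO b)).sub h1.abs))
  have hmk : ∀ s t : ℝ, 0 ≤ s → 0 ≤ t → ∃ y : Orth C, y.1 a = s ∧ y.1 b = t := by
    intro s t hs ht
    refine ⟨⟨fun d => if d = a then s else t, fun d => by dsimp only; split_ifs <;> assumption⟩, ?_, ?_⟩
    · simp
    · simp [hab.symm]
  have hext : ∀ y y' : Orth C, y.1 a = y'.1 a → y.1 b = y'.1 b → y = y' := by
    intro y y' h1 h2
    apply Subtype.ext; funext d
    rcases hC d with rfl | rfl <;> assumption
  -- invariance under one step
  have hstep : ∀ x y d, d ∈ zset y → L (r d x) y = L x y := by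
    intro x y d hd
    have hd : y.1 d = 0 := hd
    have hμ : μ (r d x) (y.1 a) (y.1 b) = μ x (y.1 a) (y.1 b) := by
      rcases hC d with rfl | rfl
      · rw [hd]; exact hμA x (hf x) _
      · rw [hd]; exact hμB x (hf x) _
    simp only [L, hμ]
    by_cases hx : x = f ∨ r d x = f
    · have : y.1 a + y.1 b - |μ x (y.1 a) (y.1 b)| = 0 := by
        have h1 : μ x (y.1 a) (y.1 b) = y.1 b - y.1 a := by
          rcases hx with hx | hx
          · rw [hx, hμf]
          · rw [← hμ, hx, hμf]
        rw [h1]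
        rcases hC d with rfl | rfl
        · rw [hd, sub_zero, abs_of_nonneg (y.2 b)]; ring
        · rw [hd, zero_sub, abs_neg, abs_of_nonneg (y.2 a)]; ring
      rw [this, mul_zero, mul_zero]
    · push Not at hx
      rw [hsn _ hx.1, hsn _ hx.2]
  have hsound : ∀ x x' y, conn r (zset y) x x' → L x y = L x' y := fun x x' y hc =>
    (conn.invariant (fun x => L x y) (fun d hd x => hstep x y d hd) hc).symm
  -- a non-core flag on the boundary line
  have hend : ∀ x y, y.1 a + y.1 b - |μ x (y.1 a) (y.1 b)| = 0 → conn r (zset y) x f := by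
    intro x y h0
    by_cases hx : x = f
    · subst hx; exact conn.refl _
    have hto : ∀ x', x' ≠ f → ∀ s t, s = y.1 a → t = y.1 b → Relation.ReflTransGen (fun u v => v ≠ f ∧ ((s = 0 ∧ v = r a u) ∨ (t = 0 ∧ v = r b u))) x x' → conn r (zset y) x x' := by
      rintro x' _ _ _ rfl rfl hR
      refine Relation.ReflTransGen.mono ?_ _ _ hR
      rintro u v ⟨_, ⟨h1, rfl⟩ | ⟨h1, rfl⟩⟩
      · exact ⟨a, h1, rfl⟩
      · exact ⟨b, h1, rfl⟩
    rcases le_total 0 (μ x (y.1 a) (y.1 b)) with hm | hm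
    · rw [abs_of_nonneg hm] at h0
      have h2 : μ (r a f) 0 (y.1 a + y.1 b) = y.1 a + y.1 b := by
        rw [hμA f (hf f), hμf, sub_zero]
      obtain ⟨e1, e2, e3⟩ := hμk x (hf x) hx (r a f) (hf _) (hfree a f) (y.1 a) (y.1 b) 0
        (y.1 a + y.1 b) (y.2 a) (y.2 b) le_rfl (add_nonneg (y.2 a) (y.2 b)) (by ring)
        (by rw [h2]; linarith)
      have := (hto _ (hfree a f) _ _ rfl rfl e3).trans (conn.step (mem_zset.2 e1) _)
      rwa [hr] at this
    · rw [abs_of_nonpos hm] at h0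
      have h2 : μ (r b f) (y.1 a + y.1 b) 0 = -(y.1 a + y.1 b) := by
        rw [hμB f (hf f), hμf, zero_sub]
      obtain ⟨e1, e2, e3⟩ := hμk x (hf x) hx (r b f) (hf _) (hfree b f) (y.1 a) (y.1 b)
        (y.1 a + y.1 b) 0 (y.2 a) (y.2 b) (add_nonneg (y.2 a) (y.2 b)) le_rfl (by ring)
        (by rw [h2]; linarith)
      have := (hto _ (hfree b f) _ _ rfl rfl e3).trans (conn.step (mem_zset.2 e2) _)
      rwa [hr] at this
  have hker : ∀ x y x' y', L x y = L x' y' → y = y' ∧ conn r (zset y) x x' := by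
    intro x y x' y' he
    have hτ : y.1 a + y.1 b = y'.1 a + y'.1 b := by rw [← hLn x y, he, hLn]
    have hμ : μ x (y.1 a) (y.1 b) = μ x' (y'.1 a) (y'.1 b) := congrArg Prod.fst he
    have hff : ∀ y y' : Orth C, y.1 a + y.1 b = y'.1 a + y'.1 b → L f y = L f y' → y = y' := by
      intro y y' hτ he
      have : μ f (y.1 a) (y.1 b) = μ f (y'.1 a) (y'.1 b) := congrArg Prod.fst he
      rw [hμf, hμf] at this
      exact hext y y' (by linarith) (by linarith)
    by_cases hx : x ≠ f ∧ x' ≠ f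
    · obtain ⟨e1, e2, e3⟩ := hμk x (hf x) hx.1 x' (hf x') hx.2 _ _ _ _ (y.2 a) (y.2 b) (y'.2 a)
        (y'.2 b) hτ hμ
      refine ⟨hext _ _ e1 e2, ?_⟩
      refine Relation.ReflTransGen.mono ?_ _ _ e3
      rintro u v ⟨_, ⟨h1, rfl⟩ | ⟨h1, rfl⟩⟩
      · exact ⟨a, h1, rfl⟩
      · exact ⟨b, h1, rfl⟩
    · have hcon : conn r (zset y) x f ∧ conn r (zset y') x' f := by
        by_cases hxf : x = f
        · by_cases hxf' : x' = f
          · subst hxf; subst hxf'; exact ⟨conn.refl _, conn.refl _⟩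
          · have h2 : (L x y).2 = (L x' y').2 := congrArg Prod.snd he
            have h3 := hnn x y
            have h4 := hnn x' y'
            simp only [L, hxf, hsf, hsn x' hxf'] at h2
            rw [hxf] at h3 ⊢
            exact ⟨conn.refl _, hend _ _ (by linarith)⟩
        · have hxf' : x' = f := by
            by_contra hne; exact hx ⟨hxf, hne⟩
          have h2 : (L x y).2 = (L x' y').2 := congrArg Prod.snd he
          have h3 := hnn x y
          have h4 := hnn x' y'
          simp only [L, hxf', hsf, hsn x hxf] at h2
          rw [hxf'] at h4 ⊢
          exact ⟨hend _ _ (by linarith), conn.refl _⟩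
      have h5 : y = y' := by
        refine hff y y' hτ ?_
        rw [← hsound x f y hcon.1, ← hsound x' f y' hcon.2, he]
      subst h5
      exact ⟨rfl, hcon.1.trans (hcon.2.symm hr)⟩
  have hP : Pres r zset L := by
    refine ⟨hLc, ?_, ?_, ?_⟩
    · intro x
      refine isClosedMap_orth (L x) (hLc x) (fun p => |p.1| + |p.2|) (by fun_prop) ?_
      intro y c
      rw [hLn x y]
      have h1 := y.2 a
      have h2 := y.2 b
      rcases hC c with rfl | rfl <;> linarith
    · rintro ⟨u, v⟩
      rcases le_total 0 v with hv | hv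
      · obtain ⟨x, hx, hxf, s, t, hs, ht, hst, hu⟩ := hμs (|u| + v) u (by linarith)
        obtain ⟨y, rfl, rfl⟩ := hmk s t hs ht
        refine ⟨x, y, ?_⟩
        simp only [L, hu, hsn x hxf, hst]
        rw [Prod.mk.injEq]; exact ⟨rfl, by ring⟩
      · have h1 := abs_le.1 (le_refl |u|)
        obtain ⟨y, hy1, hy2⟩ := hmk ((|u| - v - u) / 2) ((|u| - v + u) / 2) (by linarith) (by linarith)
        refine ⟨f, y, ?_⟩
        simp only [L, hμf, hsf, hy1, hy2]
        have : (|u| - v + u) / 2 - (|u| - v - u) / 2 = u := by ring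
        rw [this, Prod.mk.injEq]; exact ⟨rfl, by ring⟩
    · intro x y x' y'
      refine ⟨hker x y x' y', ?_⟩
      rintro ⟨rfl, hc⟩
      exact hsound x x' y hc
  obtain ⟨e, _⟩ := h.exists_homeo hP (Homeomorph.refl _) (fun _ _ _ => Iff.rfl)
  exact ⟨e⟩

/-- Full orbits of flags. -/
def fullOrb {C Φ : Type*} (r : C → Φ → Φ) (f : Φ) : Set Φ := {x | conn r univ f x}

theorem fullOrb_iff {C Φ : Type*} {r : C → Φ → Φ} (hr : ∀ c f, r c (r c f) = f) (f : Φ) (c : C)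
    (x : Φ) : x ∈ fullOrb r f ↔ r c x ∈ fullOrb r f := by
  constructor
  · intro hx; exact conn.trans hx (conn.step (mem_univ c) x)
  · intro hx
    have := conn.trans hx (conn.step (mem_univ c) (r c x))
    rwa [hr] at this

theorem eucAt_two {C Φ Y : Type*} [TopologicalSpace Y] {r : C → Φ → Φ} {q : Φ → Orth C → Y}
    [Finite Φ] [Fintype C] (hcard : Fintype.card C = 2) (hr : ∀ c f, r c (r c f) = f)
    (hfree : ∀ c f, r c f ≠ f) (h : Pres r zset q) (z : Y) : EucAt 2 z := by
  obtain ⟨a, b, hab, hC⟩ : ∃ a b : C, a ≠ b ∧ ∀ d, d = a ∨ d = b := by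
    obtain ⟨a, b, hab, h2⟩ := Finset.card_eq_two.1 (Finset.card_univ.trans hcard)
    refine ⟨a, b, hab, fun d => ?_⟩
    have := Finset.mem_univ d
    rw [h2] at this
    simpa using this
  obtain ⟨f, y, rfl⟩ := h.surj z
  obtain ⟨hop, hP⟩ := h.restrictFlags (fullOrb r f) (fullOrb_iff hr f)
  have ht : ∀ x, ∀ hx : x ∈ fullOrb r f, (⟨x, hx⟩ : fullOrb r f) ∈
      orb (fun x : fullOrb r f => (⟨r a x, (fullOrb_iff hr f a x).1 x.2⟩ : fullOrb r f))
      (fun x => (⟨r b x, (fullOrb_iff hr f b x).1 x.2⟩ : fullOrb r f)) ⟨f, conn.refl f⟩ := by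
    intro x hx
    have hx' := hx
    induction hx' with
    | refl => exact orb_self _ _ _
    | tail h1 hs ih =>
      obtain ⟨d, _, rfl⟩ := hs
      rcases hC d with rfl | rfl
      · exact orb_A (ih h1)
      · exact orb_B (ih h1)
  obtain ⟨e⟩ := two_homeo (fun c x => Subtype.ext (hr c x))
    (fun c x hx => hfree c x (congrArg Subtype.val hx)) hP a b hab hC ⟨f, conn.refl f⟩
    (fun x => ht x.1 x.2)
  refine (EucAt.of_openEmbedding hop.isOpenEmbedding_subtypeVal ⟨q f y, f, conn.refl f, y, rfl⟩).2 ?_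
  refine EucAt.of_oph (e.trans (Homeomorph.finTwoArrow (X := ℝ)).symm).toOpenPartialHomeomorph
    (by simp) (eucAt_pi (by simp) _)

end GlueAux

namespace GlueAux
open Set Filter Topology

/-- Paths of flags avoiding the two core flags. -/
def APath {Φ : Type*} (A B : Φ → Φ) (f g : Φ) (s t : ℝ) : Φ → Φ → Prop :=
  Relation.ReflTransGen (fun u v => (v ≠ f ∧ v ≠ g) ∧ ((s = 0 ∧ v = A u) ∨ (t = 0 ∧ v = B u)))

/-- Combined chain data of two orbits. -/
structure DipData {Φ : Type*} (A B : Φ → Φ) (f g : Φ) (S : Set Φ) (s : Φ → ℝ)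
    (μ : Φ → ℝ → ℝ → ℝ) : Prop where
  fS : f ∈ S
  gS : g ∈ S
  AS : ∀ x, x ∈ S ↔ A x ∈ S
  BS : ∀ x, x ∈ S ↔ B x ∈ S
  sf : s f = 1
  sg : s g = -1
  s1 : ∀ x, s x = 1 ∨ s x = -1
  sA : ∀ x ∈ S, s (A x) = s x
  sB : ∀ x ∈ S, s (B x) = s x
  cont : ∀ x, Continuous fun p : ℝ × ℝ => μ x p.1 p.2
  μf : ∀ s t, μ f s t = t - s
  μg : ∀ s t, μ g s t = t - s
  le : ∀ x ∈ S, ∀ s t, 0 ≤ s → 0 ≤ t → |μ x s t| ≤ s + t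
  μA : ∀ x ∈ S, ∀ t, μ (A x) 0 t = μ x 0 t
  μB : ∀ x ∈ S, ∀ t, μ (B x) t 0 = μ x t 0
  ker : ∀ x ∈ S, x ≠ f → x ≠ g → ∀ x' ∈ S, x' ≠ f → x' ≠ g → s x = s x' →
    ∀ t u t' u', 0 ≤ t → 0 ≤ u → 0 ≤ t' → 0 ≤ u' → t + u = t' + u' → μ x t u = μ x' t' u' →
    t = t' ∧ u = u' ∧ APath A B f g t u x x'
  surj : ∀ σ : ℝ, σ = 1 ∨ σ = -1 → ∀ τ w, |w| ≤ τ → ∃ x ∈ S, x ≠ f ∧ x ≠ g ∧ s x = σ ∧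
    ∃ t u, 0 ≤ t ∧ 0 ≤ u ∧ t + u = τ ∧ μ x t u = w

theorem orb_symm {Φ : Type*} {A B : Φ → Φ} (hA : ∀ x, A (A x) = x) (hB : ∀ x, B (B x) = x)
    {f g : Φ} (h : g ∈ orb A B f) : f ∈ orb A B g := by
  unfold orb at *
  induction h with
  | refl => exact Relation.ReflTransGen.refl
  | tail _ hs ih =>
    refine Relation.ReflTransGen.head ?_ ih
    rcases hs with rfl | rfl
    · exact Or.inl (hA _).symm
    · exact Or.inr (hB _).symm

theorem orb_trans {Φ : Type*} {A B : Φ → Φ} {f g h : Φ} (h1 : g ∈ orb A B f)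
    (h2 : h ∈ orb A B g) : h ∈ orb A B f := Relation.ReflTransGen.trans h1 h2

theorem exists_dipData {Φ : Type*} [Finite Φ] {A B : Φ → Φ} (hA : ∀ x, A (A x) = x)
    (hB : ∀ x, B (B x) = x) (hAf : ∀ x, A x ≠ x) (hBf : ∀ x, B x ≠ x) (f g : Φ)
    (hfg : g ∉ orb A B f) : ∃ S s μ, DipData A B f g S s μ := by
  obtain ⟨μ, hμc, hμf, hμb, hμA, hμB, hμk, hμs⟩ := exists_chain hA hB hAf hBf f
  obtain ⟨ν, hνc, hνf, hνb, hνA, hνB, hνk, hνs⟩ := exists_chain hA hB hAf hBf g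
  have hdis : ∀ x, x ∈ orb A B g → x ∉ orb A B f := fun x h1 h2 =>
    hfg (orb_trans h2 (orb_symm hA hB h1))
  have hfg' : f ∉ orb A B g := fun h => hfg (orb_symm hA hB h)
  have hfne : ∀ x ∈ orb A B f, x ≠ g := by rintro x hx rfl; exact hfg hx
  have hgne : ∀ x ∈ orb A B g, x ≠ f := by rintro x hx rfl; exact hfg' hx
  have iA : ∀ h x, x ∈ orb A B h ↔ A x ∈ orb A B h := fun h x =>
    ⟨orb_A, fun hx => by have := orb_A hx; rwa [hA] at this⟩
  have iB : ∀ h x, x ∈ orb A B h ↔ B x ∈ orb A B h := fun h x =>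
    ⟨orb_B, fun hx => by have := orb_B hx; rwa [hB] at this⟩
  have hff := orb_self A B f
  have hgg := orb_self A B g
  have hpf : ∀ t u x x', x ∈ orb A B f → Relation.ReflTransGen
      (fun u' v => v ≠ f ∧ ((t = 0 ∧ v = A u') ∨ (u = 0 ∧ v = B u'))) x x' →
      x' ∈ orb A B f ∧ APath A B f g t u x x' := by
    intro t u x x' hx hR
    induction hR with
    | refl => exact ⟨hx, Relation.ReflTransGen.refl⟩
    | @tail y z _ hs ih =>
      obtain ⟨h1, h2⟩ := hs
      have h3 : z ∈ orb A B f := by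
        rcases h2 with ⟨_, rfl⟩ | ⟨_, rfl⟩
        · exact orb_A ih.1
        · exact orb_B ih.1
      exact ⟨h3, ih.2.tail ⟨⟨h1, hfne _ h3⟩, h2⟩⟩
  have hpg : ∀ t u x x', x ∈ orb A B g → Relation.ReflTransGen
      (fun u' v => v ≠ g ∧ ((t = 0 ∧ v = A u') ∨ (u = 0 ∧ v = B u'))) x x' →
      x' ∈ orb A B g ∧ APath A B f g t u x x' := by
    intro t u x x' hx hR
    induction hR with
    | refl => exact ⟨hx, Relation.ReflTransGen.refl⟩
    | @tail y z _ hs ih =>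
      obtain ⟨h1, h2⟩ := hs
      have h3 : z ∈ orb A B g := by
        rcases h2 with ⟨_, rfl⟩ | ⟨_, rfl⟩
        · exact orb_A ih.1
        · exact orb_B ih.1
      exact ⟨h3, ih.2.tail ⟨⟨hgne _ h3, h1⟩, h2⟩⟩
  let s : Φ → ℝ := fun x => if x ∈ orb A B f then 1 else -1
  let m : Φ → ℝ → ℝ → ℝ := fun x => if x ∈ orb A B f then μ x else ν x
  have sp : ∀ x, x ∈ orb A B f → s x = 1 := fun x hx => if_pos hx
  have sn : ∀ x, x ∈ orb A B g → s x = -1 := fun x hx => if_neg (hdis x hx)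
  have mp : ∀ x, x ∈ orb A B f → m x = μ x := fun x hx => if_pos hx
  have mn : ∀ x, x ∈ orb A B g → m x = ν x := fun x hx => if_neg (hdis x hx)
  refine ⟨orb A B f ∪ orb A B g, s, m, Or.inl hff, Or.inr hgg, ?_, ?_, sp f hff, sn g hgg,
    ?_, ?_, ?_, ?_, ?_, ?_, ?_, ?_, ?_, ?_, ?_⟩
  · intro x; exact or_congr (iA f x) (iA g x)
  · intro x; exact or_congr (iB f x) (iB g x)
  · intro x; simp only [s]; split_ifs <;> simp
  · rintro x (hx | hx)
    · rw [sp x hx, sp _ (orb_A hx)]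
    · rw [sn x hx, sn _ (orb_A hx)]
  · rintro x (hx | hx)
    · rw [sp x hx, sp _ (orb_B hx)]
    · rw [sn x hx, sn _ (orb_B hx)]
  · intro x
    by_cases hx : x ∈ orb A B f
    · rw [mp x hx]; exact hμc x
    · have : m x = ν x := if_neg hx
      rw [this]; exact hνc x
  · rw [mp f hff]; exact hμf
  · rw [mn g hgg]; exact hνf
  · rintro x (hx | hx)
    · rw [mp x hx]; exact hμb x hx
    · rw [mn x hx]; exact hνb x hx
  · rintro x (hx | hx)
    · rw [mp x hx, mp _ (orb_A hx)]; exact hμA x hx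
    · rw [mn x hx, mn _ (orb_A hx)]; exact hνA x hx
  · rintro x (hx | hx)
    · rw [mp x hx, mp _ (orb_B hx)]; exact hμB x hx
    · rw [mn x hx, mn _ (orb_B hx)]; exact hνB x hx
  · rintro x (hx | hx) hxf hxg x' (hx' | hx') hxf' hxg' hs t u t' u' h1 h2 h3 h4 h5 h6
    · rw [mp x hx, mp x' hx'] at h6
      obtain ⟨e1, e2, e3⟩ := hμk x hx hxf x' hx' hxf' t u t' u' h1 h2 h3 h4 h5 h6
      exact ⟨e1, e2, (hpf _ _ _ _ hx e3).2⟩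
    · rw [sp x hx, sn x' hx'] at hs; norm_num at hs
    · rw [sn x hx, sp x' hx'] at hs; norm_num at hs
    · rw [mn x hx, mn x' hx'] at h6
      obtain ⟨e1, e2, e3⟩ := hνk x hx hxg x' hx' hxg' t u t' u' h1 h2 h3 h4 h5 h6
      exact ⟨e1, e2, (hpg _ _ _ _ hx e3).2⟩
  · rintro σ (rfl | rfl) τ w hw
    · obtain ⟨x, hx, hxf, t, u, h1, h2, h3, h4⟩ := hμs τ w hw
      exact ⟨x, Or.inl hx, hxf, hfne x hx, sp x hx, t, u, h1, h2, h3, by rw [mp x hx, h4]⟩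
    · obtain ⟨x, hx, hxf, t, u, h1, h2, h3, h4⟩ := hνs τ w hw
      exact ⟨x, Or.inr hx, hgne x hx, hxf, sn x hx, t, u, h1, h2, h3, by rw [mn x hx, h4]⟩

/-- The end lemma: at extreme values one is next to the core flag. -/
theorem DipData.fin {Φ : Type*} {A B : Φ → Φ} {f g : Φ} {S : Set Φ} {s : Φ → ℝ}
    {μ : Φ → ℝ → ℝ → ℝ} (D : DipData A B f g S s μ) (hAc : ∀ x, x = f ∨ x = g → A x ≠ f ∧ A x ≠ g)
    (hBc : ∀ x, x = f ∨ x = g → B x ≠ f ∧ B x ≠ g) (x : Φ) (hx : x ∈ S) (hxf : x ≠ f) (hxg : x ≠ g)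
    (t u : ℝ) (ht : 0 ≤ t) (hu : 0 ≤ u) (he : t + u - |μ x t u| = 0) (β : Φ) (hβ : β = f ∨ β = g)
    (hsβ : s x = s β) :
    (0 ≤ μ x t u → t = 0 ∧ APath A B f g t u x (A β)) ∧
    (μ x t u ≤ 0 → u = 0 ∧ APath A B f g t u x (B β)) ∧ μ x t u = u - t := by
  have hβS : β ∈ S := by rcases hβ with rfl | rfl; exacts [D.fS, D.gS]
  have hμβ : ∀ s t, μ β s t = t - s := by rcases hβ with rfl | rfl; exacts [D.μf, D.μg]
  have h1 : 0 ≤ μ x t u → t = 0 ∧ APath A B f g t u x (A β) := by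
    intro h0
    rw [abs_of_nonneg h0] at he
    have h2 : μ (A β) 0 (t + u) = t + u := by rw [D.μA β hβS, hμβ, sub_zero]
    obtain ⟨e1, e2, e3⟩ := D.ker x hx hxf hxg (A β) ((D.AS β).1 hβS) (hAc β hβ).1 (hAc β hβ).2
      (by rw [D.sA β hβS, hsβ]) t u 0 (t + u) ht hu le_rfl (by linarith) (by ring)
      (by rw [h2]; linarith)
    exact ⟨e1, e3⟩
  have h2 : μ x t u ≤ 0 → u = 0 ∧ APath A B f g t u x (B β) := by
    intro h0
    rw [abs_of_nonpos h0] at he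
    have h2 : μ (B β) (t + u) 0 = -(t + u) := by rw [D.μB β hβS, hμβ, zero_sub]
    obtain ⟨e1, e2, e3⟩ := D.ker x hx hxf hxg (B β) ((D.BS β).1 hβS) (hBc β hβ).1 (hBc β hβ).2
      (by rw [D.sB β hβS, hsβ]) t u (t + u) 0 ht hu (by linarith) le_rfl (by ring)
      (by rw [h2]; linarith)
    exact ⟨e2, e3⟩
  refine ⟨h1, h2, ?_⟩
  rcases le_total 0 (μ x t u) with h | h
  · have := (h1 h).1
    rw [abs_of_nonneg h] at he
    linarith
  · have := (h2 h).1
    rw [abs_of_nonpos h] at he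
    linarith

end GlueAux

namespace GlueAux
open Set Filter Topology

set_option maxHeartbeats 1000000 in
theorem dipole_homeo {C Φ Y Y' : Type*} [TopologicalSpace Y] [TopologicalSpace Y']
    {r : C → Φ → Φ} {q : Φ → Orth C → Y} [Finite Φ] [Finite C] (hr : ∀ c f, r c (r c f) = f)
    (hfree : ∀ c f, r c f ≠ f) (h : Pres r zset q) (a b c : C) (hab : a ≠ b) (hac : a ≠ c)
    (hbc : b ≠ c) (hC : ∀ d, d = a ∨ d = b ∨ d = c) (f g : Φ) (hg : g = r c f)
    (hfg : g ∉ orb (r a) (r b) f)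
    {r' : C → {x : Φ // x ≠ f ∧ x ≠ g} → {x : Φ // x ≠ f ∧ x ≠ g}}
    (hr' : ∀ d x, (r' d x : Φ) =
      if r d x = f then r d g else if r d x = g then r d f else r d x)
    {q' : {x : Φ // x ≠ f ∧ x ≠ g} → Orth C → Y'} (h' : Pres r' zset q') :
    Nonempty (Y ≃ₜ Y') := by
  obtain ⟨S, s, μ, D⟩ := exists_dipData (hr a) (hr b) (hfree a) (hfree b) f g hfg
  have hf : f = r c g := by rw [hg, hr]
  have hfgne : f ≠ g := by rw [hg]; exact (hfree c f).symm
  have hgf : f ∉ orb (r a) (r b) g := fun hh => hfg (orb_symm (hr a) (hr b) hh)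
  have hAc : ∀ x, x = f ∨ x = g → r a x ≠ f ∧ r a x ≠ g := by
    rintro x (rfl | rfl)
    · exact ⟨hfree a _, fun e => hfg (e ▸ orb_A (orb_self _ _ _))⟩
    · exact ⟨fun e => hgf (e ▸ orb_A (orb_self _ _ _)), hfree a _⟩
  have hBc : ∀ x, x = f ∨ x = g → r b x ≠ f ∧ r b x ≠ g := by
    rintro x (rfl | rfl)
    · exact ⟨hfree b _, fun e => hfg (e ▸ orb_B (orb_self _ _ _))⟩
    · exact ⟨fun e => hgf (e ▸ orb_B (orb_self _ _ _)), hfree b _⟩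
  have hcc : ∀ x, x ≠ f → x ≠ g → r c x ≠ f ∧ r c x ≠ g := by
    intro x h1 h2
    constructor
    · intro e; apply h2; rw [hg, ← e, hr]
    · intro e; apply h1; rw [hf, ← e, hr]
  have hrc' : ∀ x, (r' c x : Φ) = r c x := by
    intro x
    rw [hr', if_neg (hcc _ x.2.1 x.2.2).1, if_neg (hcc _ x.2.1 x.2.2).2]
  have hrn' : ∀ d (x : {x : Φ // x ≠ f ∧ x ≠ g}), r d x ≠ f → r d x ≠ g → (r' d x : Φ) = r d x := by
    intro d x h1 h2
    rw [hr', if_neg h1, if_neg h2]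
  -- the height function
  let e : Φ → Orth C → ℝ := fun x y => y.1 a + y.1 b - |μ x (y.1 a) (y.1 b)|
  have he0 : ∀ x ∈ S, ∀ y, 0 ≤ e x y := fun x hx y => by
    have := D.le x hx _ _ (y.2 a) (y.2 b); simp only [e]; linarith
  have hμcont : ∀ x, Continuous fun y : Orth C => μ x (y.1 a) (y.1 b) := fun x =>
    (D.cont x).comp ((continuous_coordO a).prodMk (continuous_coordO b))
  have hecont : ∀ x, Continuous (e x) := fun x =>
    ((continuous_coordO a).add (continuous_coordO b)).sub (hμcont x).abs
  have hext : ∀ y y' : Orth C, y.1 a = y'.1 a → y.1 b = y'.1 b → y.1 c = y'.1 c → y = y' := by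
    intro y y' h1 h2 h3
    apply Subtype.ext; funext d
    rcases hC d with rfl | rfl | rfl <;> assumption
  have hmk : ∀ s t u : ℝ, 0 ≤ s → 0 ≤ t → 0 ≤ u →
      ∃ y : Orth C, y.1 a = s ∧ y.1 b = t ∧ y.1 c = u := by
    intro s t u hs ht hu
    refine ⟨⟨fun d => if d = a then s else if d = b then t else u,
      fun d => by dsimp only; split_ifs <;> assumption⟩, ?_, ?_, ?_⟩
    · simp
    · simp [hab.symm]
    · simp [hac.symm, hbc.symm]
  have hcoord : ∀ (y : Orth C) (M : ℝ), y.1 c + (y.1 a + y.1 b) ≤ M → ∀ d, y.1 d ≤ M := by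
    intro y M hM d
    have h1 := y.2 a
    have h2 := y.2 b
    have h3 := y.2 c
    rcases hC d with rfl | rfl | rfl <;> linarith
  let W : Type := {p : ℝ × ℝ × ℝ // 0 ≤ p.1}
  have hWc : IsClosedEmbedding (Subtype.val : W → ℝ × ℝ × ℝ) :=
    IsClosed.isClosedEmbedding_subtypeVal (s := {p : ℝ × ℝ × ℝ | 0 ≤ p.1})
      (isClosed_le continuous_const continuous_fst)
  haveI : WeaklyLocallyCompactSpace W := hWc.weaklyLocallyCompactSpace
  let mkW : ℝ × ℝ × ℝ → W := fun p => ⟨(|p.1|, p.2.1, p.2.2), abs_nonneg _⟩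
  have hmkc : Continuous mkW :=
    Continuous.subtype_mk (continuous_fst.abs.prodMk (continuous_fst.comp continuous_snd |>.prodMk
      (continuous_snd.comp continuous_snd))) _
  have hmkinj : ∀ p p' : ℝ × ℝ × ℝ, 0 ≤ p.1 → 0 ≤ p'.1 → mkW p = mkW p' →
      p.1 = p'.1 ∧ p.2.1 = p'.2.1 ∧ p.2.2 = p'.2.2 := by
    intro p p' h1 h2 hh
    have h3 := congrArg Subtype.val hh
    simp only [mkW, Prod.mk.injEq, abs_of_nonneg h1, abs_of_nonneg h2] at h3
    exact h3
  let N : W → ℝ := fun w => w.1.1 + |w.1.2.1| + |w.1.2.2|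
  have hN : Continuous N := by fun_prop
  let L0 : Φ → Orth C → ℝ × ℝ × ℝ := fun x y =>
    if x = f ∨ x = g then (y.1 c / 2 + e x y, μ x (y.1 a) (y.1 b), s x * (y.1 c / 2))
    else (y.1 c / 2, μ x (y.1 a) (y.1 b), s x * (y.1 c / 2 + e x y))
  let L1 : Φ → Orth C → ℝ × ℝ × ℝ := fun x y => (y.1 c, μ x (y.1 a) (y.1 b), s x * e x y)
  have hcc2 : Continuous fun y : Orth C => y.1 c / 2 := (continuous_coordO c).div_const 2
  have hL0c : ∀ x, Continuous (L0 x) := by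
    intro x
    simp only [L0]
    split_ifs
    · exact (hcc2.add (hecont x)).prodMk ((hμcont x).prodMk (continuous_const.mul hcc2))
    · exact hcc2.prodMk ((hμcont x).prodMk (continuous_const.mul (hcc2.add (hecont x))))
  have hL1c : ∀ x, Continuous (L1 x) := fun x =>
    (continuous_coordO c).prodMk ((hμcont x).prodMk (continuous_const.mul (hecont x)))
  have hs1 : ∀ x, |s x| = 1 := fun x => by rcases D.s1 x with hh | hh <;> rw [hh] <;> norm_num
  have hL0p : ∀ x ∈ S, ∀ y, 0 ≤ (L0 x y).1 := by
    intro x hx y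
    have h1 := he0 x hx y
    have h2 := y.2 c
    simp only [L0]
    split_ifs
    · change 0 ≤ y.1 c / 2 + e x y; linarith
    · change 0 ≤ y.1 c / 2; linarith
  have hL1p : ∀ x y, 0 ≤ (L1 x y).1 := fun x y => y.2 c
  have hN0 : ∀ x ∈ S, ∀ y, N (mkW (L0 x y)) = y.1 c + (y.1 a + y.1 b) := by
    intro x hx y
    have h1 := he0 x hx y
    have h2 := y.2 c
    have h3 : e x y = y.1 a + y.1 b - |μ x (y.1 a) (y.1 b)| := rfl
    simp only [N, mkW, abs_of_nonneg (hL0p x hx y)]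
    simp only [L0]
    split_ifs
    · simp only [abs_mul, hs1, one_mul]
      rw [abs_of_nonneg (by linarith : 0 ≤ y.1 c / 2)]; linarith
    · simp only [abs_mul, hs1, one_mul]
      rw [abs_of_nonneg (by linarith : 0 ≤ y.1 c / 2 + e x y)]; linarith
  have hN1 : ∀ x ∈ S, ∀ y, N (mkW (L1 x y)) = y.1 c + (y.1 a + y.1 b) := by
    intro x hx y
    have h1 := he0 x hx y
    have h3 : e x y = y.1 a + y.1 b - |μ x (y.1 a) (y.1 b)| := rfl
    simp only [N, mkW, abs_of_nonneg (hL1p x y)]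
    simp only [L1, abs_mul, hs1, one_mul, abs_of_nonneg h1]
    linarith
  -- surjectivity
  have hsgn : ∀ v : ℝ, ∃ σ : ℝ, (σ = 1 ∨ σ = -1) ∧ v = σ * |v| := by
    intro v
    rcases le_total 0 v with hv | hv
    · exact ⟨1, Or.inl rfl, by rw [abs_of_nonneg hv]; ring⟩
    · exact ⟨-1, Or.inr rfl, by rw [abs_of_nonpos hv]; ring⟩
  have hsurj1 : ∀ w : W, ∃ x ∈ S, x ≠ f ∧ x ≠ g ∧ ∃ y, mkW (L1 x y) = w := by
    rintro ⟨⟨p, u, v⟩, hp⟩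
    obtain ⟨σ, hσ, hv⟩ := hsgn v
    obtain ⟨x, hx, hxf, hxg, hsx, t, t', ht, ht', hτ, hμ⟩ := D.surj σ hσ (|v| + |u|) u
      (by linarith [abs_nonneg v])
    obtain ⟨y, ya, yb, yc⟩ := hmk t t' p ht ht' hp
    refine ⟨x, hx, hxf, hxg, y, ?_⟩
    apply Subtype.ext
    simp only [mkW, L1, e, ya, yb, yc, hμ, hsx, Prod.mk.injEq, true_and]
    refine ⟨abs_of_nonneg hp, ?_⟩
    rw [hτ, add_sub_cancel_right, ← hv]
  have hsurj0 : ∀ w : W, ∃ x ∈ S, ∃ y, mkW (L0 x y) = w := by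
    rintro ⟨⟨p, u, v⟩, hp⟩
    have hp : 0 ≤ p := hp
    obtain ⟨σ, hσ, hv⟩ := hsgn v
    rcases le_total p |v| with hpv | hpv
    · obtain ⟨x, hx, hxf, hxg, hsx, t, t', ht, ht', hτ, hμ⟩ := D.surj σ hσ (|v| - p + |u|) u
        (by linarith)
      obtain ⟨y, ya, yb, yc⟩ := hmk t t' (2 * p) ht ht' (by linarith)
      refine ⟨x, hx, y, ?_⟩
      apply Subtype.ext
      have : ¬ (x = f ∨ x = g) := by push Not; exact ⟨hxf, hxg⟩
      simp only [mkW, L0, if_neg this, e, ya, yb, yc, hμ, hsx, Prod.mk.injEq, true_and]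
      constructor
      · rw [abs_of_nonneg (by linarith)]; ring
      · rw [hτ]; conv_rhs => rw [hv]
        ring
    · have : ∃ β, (β = f ∨ β = g) ∧ s β = σ := by
        rcases hσ with rfl | rfl
        · exact ⟨f, Or.inl rfl, D.sf⟩
        · exact ⟨g, Or.inr rfl, D.sg⟩
      obtain ⟨β, hβ, hsβ⟩ := this
      have hβS : β ∈ S := by rcases hβ with rfl | rfl; exacts [D.fS, D.gS]
      have hμβ : ∀ s t, μ β s t = t - s := by rcases hβ with rfl | rfl; exacts [D.μf, D.μg]
      have hu1 := neg_abs_le u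
      have hu2 := le_abs_self u
      obtain ⟨y, ya, yb, yc⟩ := hmk ((p - |v| + |u| - u) / 2) ((p - |v| + |u| + u) / 2) (2 * |v|)
        (by linarith) (by linarith) (by positivity)
      refine ⟨β, hβS, y, ?_⟩
      apply Subtype.ext
      have h4 : (p - |v| + |u| + u) / 2 - (p - |v| + |u| - u) / 2 = u := by ring
      simp only [mkW, L0, if_pos hβ, e, ya, yb, yc, hμβ, hsβ, h4, Prod.mk.injEq, true_and]
      constructor
      · rw [abs_of_nonneg (by linarith [abs_nonneg v])]; ring
      · conv_rhs => rw [hv]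
        ring
  -- paths
  have hpath : ∀ x x' (y : Orth C) t u, t = y.1 a → u = y.1 b → APath (r a) (r b) f g t u x x' →
      q x y = q x' y := by
    rintro x x' y _ _ rfl rfl hp
    refine (h.ker _ _ _ _).2 ⟨rfl, ?_⟩
    refine Relation.ReflTransGen.mono ?_ _ _ hp
    rintro u v ⟨_, ⟨h1, rfl⟩ | ⟨h1, rfl⟩⟩
    · exact ⟨a, h1, rfl⟩
    · exact ⟨b, h1, rfl⟩
  have hpath' : ∀ (x : Φ) (hx : x ≠ f ∧ x ≠ g) x' (y : Orth C) t u, t = y.1 a → u = y.1 b →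
      APath (r a) (r b) f g t u x x' → ∃ hx' : x' ≠ f ∧ x' ≠ g, q' ⟨x, hx⟩ y = q' ⟨x', hx'⟩ y := by
    rintro x hx x' y _ _ rfl rfl hp
    induction hp with
    | refl => exact ⟨hx, rfl⟩
    | @tail u v _ hs ih =>
      obtain ⟨hu, hq⟩ := ih
      refine ⟨hs.1, hq.trans ?_⟩
      refine (h'.ker _ _ _ _).2 ⟨rfl, ?_⟩
      obtain ⟨h0, ⟨h1, h2⟩ | ⟨h1, h2⟩⟩ := hs
      · have : (⟨v, h0⟩ : {x : Φ // x ≠ f ∧ x ≠ g}) = r' a ⟨u, hu⟩ := by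
          apply Subtype.ext
          rw [hrn' a ⟨u, hu⟩ (by rw [← h2]; exact h0.1) (by rw [← h2]; exact h0.2), ← h2]
        rw [this]; exact conn.step (mem_zset.2 h1) _
      · have : (⟨v, h0⟩ : {x : Φ // x ≠ f ∧ x ≠ g}) = r' b ⟨u, hu⟩ := by
          apply Subtype.ext
          rw [hrn' b ⟨u, hu⟩ (by rw [← h2]; exact h0.1) (by rw [← h2]; exact h0.2), ← h2]
        rw [this]; exact conn.step (mem_zset.2 h1) _
  have hcore : ∀ x, ∃ β, (β = f ∨ β = g) ∧ s x = s β := by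
    intro x
    rcases D.s1 x with hh | hh
    · exact ⟨f, Or.inl rfl, by rw [hh, D.sf]⟩
    · exact ⟨g, Or.inr rfl, by rw [hh, D.sg]⟩
  have hμβ : ∀ β, (β = f ∨ β = g) → ∀ s t, μ β s t = t - s := by
    rintro β (rfl | rfl); exacts [D.μf, D.μg]
  have hβS : ∀ β, (β = f ∨ β = g) → β ∈ S := by rintro β (rfl | rfl); exacts [D.fS, D.gS]
  have hred : ∀ x ∈ S, x ≠ f → x ≠ g → ∀ y, e x y = 0 → ∃ β, (β = f ∨ β = g) ∧
      q x y = q β y ∧ L0 x y = L0 β y := by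
    intro x hx hxf hxg y hy
    obtain ⟨β, hβ, hsβ⟩ := hcore x
    obtain ⟨F1, F2, F3⟩ := D.fin hAc hBc x hx hxf hxg (y.1 a) (y.1 b) (y.2 a) (y.2 b) hy β hβ hsβ
    refine ⟨β, hβ, ?_, ?_⟩
    · rcases le_total 0 (μ x (y.1 a) (y.1 b)) with hm | hm
      · obtain ⟨h1, h2⟩ := F1 hm
        rw [hpath _ _ y _ _ rfl rfl h2, ← wall h β a y h1]
      · obtain ⟨h1, h2⟩ := F2 hm
        rw [hpath _ _ y _ _ rfl rfl h2, ← wall h β b y h1]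
    · have hn : ¬ (x = f ∨ x = g) := by push Not; exact ⟨hxf, hxg⟩
      have h5 : e β y = 0 := by
        rw [← hy]; simp only [e, F3, hμβ β hβ]
      simp only [L0, if_neg hn, if_pos hβ, hy, h5, F3, hμβ β hβ, hsβ, add_zero]
  have hsne : ∀ x x', s x ≠ s x' → s x' = - s x := by
    intro x x' hh
    rcases D.s1 x with h1 | h1 <;> rcases D.s1 x' with h2 | h2 <;> rw [h1, h2] at hh ⊢ <;> norm_num at *
  have hcancel : ∀ x (t u : ℝ), s x * t = s x * u → t = u := by
    intro x t u hh
    rcases D.s1 x with h1 | h1 <;> rw [h1] at hh <;> linarith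
  have hKcc : ∀ β β', (β = f ∨ β = g) → (β' = f ∨ β' = g) → ∀ y y', L0 β y = L0 β' y' →
      q β y = q β' y' := by
    intro β β' hβ hβ' y y' hh
    simp only [L0, if_pos hβ, if_pos hβ', Prod.mk.injEq] at hh
    obtain ⟨h1, h2, h3⟩ := hh
    simp only [e, hμβ β hβ, hμβ β' hβ'] at h1 h2
    rw [h2] at h1
    have hyc : y.1 c = y'.1 c ∧ (β = β' ∨ y.1 c = 0) := by
      by_cases hss : s β = s β'
      · rw [hss] at h3
        refine ⟨by linarith [hcancel _ _ _ h3], Or.inl ?_⟩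
        have := D.sf
        have := D.sg
        rcases hβ with rfl | rfl <;> rcases hβ' with rfl | rfl <;> first | rfl | (exfalso; linarith)
      · rw [hsne _ _ hss, neg_mul, ← mul_neg] at h3
        have := hcancel _ _ _ h3
        have h4 := y.2 c
        have h5 := y'.2 c
        exact ⟨by linarith, Or.inr (by linarith)⟩
    have hyy : y = y' := hext _ _ (by linarith [hyc.1]) (by linarith [hyc.1]) hyc.1
    subst hyy
    rcases hyc.2 with rfl | h0
    · rfl
    · rcases hβ with rfl | rfl <;> rcases hβ' with rfl | rfl
      · rfl
      · rw [hg]; exact wall h _ c y h0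
      · rw [wall h _ c y h0, ← hf]
      · rfl
  have hK0 : ∀ x ∈ S, ∀ x' ∈ S, ∀ y y', L0 x y = L0 x' y' → q x y = q x' y' := by
    intro x hx x' hx' y y' hh
    have k1 := he0 x hx y
    have k2 := he0 x' hx' y'
    have k3 := y.2 c
    have k4 := y'.2 c
    -- all non-core flags have height zero, or both are non-core of the same class
    have key : ((x ≠ f ∧ x ≠ g) ∧ (x' ≠ f ∧ x' ≠ g) ∧ s x = s x') ∨
        ((x = f ∨ x = g ∨ e x y = 0) ∧ (x' = f ∨ x' = g ∨ e x' y' = 0)) := by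
      by_cases hc : x = f ∨ x = g <;> by_cases hc' : x' = f ∨ x' = g
      · exact Or.inr ⟨by tauto, by tauto⟩
      · refine Or.inr ⟨by tauto, Or.inr (Or.inr ?_)⟩
        simp only [L0, if_pos hc, if_neg hc', Prod.mk.injEq] at hh
        obtain ⟨h1, h2, h3⟩ := hh
        by_cases hss : s x = s x'
        · rw [hss] at h3
          linarith [hcancel _ _ _ h3]
        · rw [hsne _ _ hss, neg_mul, ← mul_neg] at h3
          linarith [hcancel _ _ _ h3]
      · refine Or.inr ⟨Or.inr (Or.inr ?_), by tauto⟩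
        simp only [L0, if_neg hc, if_pos hc', Prod.mk.injEq] at hh
        obtain ⟨h1, h2, h3⟩ := hh
        by_cases hss : s x = s x'
        · rw [hss] at h3
          linarith [hcancel _ _ _ h3]
        · rw [hsne _ _ hss, neg_mul, ← mul_neg] at h3
          linarith [hcancel _ _ _ h3]
      · by_cases hss : s x = s x'
        · push Not at hc hc'
          exact Or.inl ⟨hc, hc', hss⟩
        · right
          simp only [L0, if_neg hc, if_neg hc', Prod.mk.injEq] at hh
          obtain ⟨h1, h2, h3⟩ := hh
          rw [hsne _ _ hss, neg_mul, ← mul_neg] at h3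
          have := hcancel _ _ _ h3
          exact ⟨Or.inr (Or.inr (by linarith)), Or.inr (Or.inr (by linarith))⟩
    rcases key with ⟨hc, hc', hss⟩ | ⟨hc, hc'⟩
    · have hn : ¬ (x = f ∨ x = g) := by push Not; exact hc
      have hn' : ¬ (x' = f ∨ x' = g) := by push Not; exact hc'
      simp only [L0, if_neg hn, if_neg hn', Prod.mk.injEq] at hh
      obtain ⟨h1, h2, h3⟩ := hh
      rw [hss] at h3
      have h4 := hcancel _ _ _ h3
      have h5 : e x y = e x' y' := by linarith
      simp only [e, h2] at h5
      obtain ⟨e1, e2, e3⟩ := D.ker x hx hc.1 hc.2 x' hx' hc'.1 hc'.2 hss _ _ _ _ (y.2 a) (y.2 b)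
        (y'.2 a) (y'.2 b) (by linarith) h2
      have hyy : y = y' := hext _ _ e1 e2 (by linarith)
      subst hyy
      exact hpath _ _ _ _ _ rfl rfl e3
    · have hb : ∀ x ∈ S, ∀ y, (x = f ∨ x = g ∨ e x y = 0) → ∃ β, (β = f ∨ β = g) ∧
          q x y = q β y ∧ L0 x y = L0 β y := by
        intro x hx y hc
        by_cases hcx : x = f ∨ x = g
        · exact ⟨x, hcx, rfl, rfl⟩
        · have : e x y = 0 := by tauto
          push Not at hcx
          exact hred x hx hcx.1 hcx.2 y this
      obtain ⟨β, hβ, h1, h2⟩ := hb x hx y hc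
      obtain ⟨β', hβ', h1', h2'⟩ := hb x' hx' y' hc'
      rw [h1, h1']
      exact hKcc β β' hβ hβ' y y' (by rw [← h2, ← h2', hh])
  have hK1 : ∀ (x x' : {x : Φ // x ≠ f ∧ x ≠ g}), x.1 ∈ S → x'.1 ∈ S → ∀ y y',
      L1 x y = L1 x' y' → q' x y = q' x' y' := by
    intro x x' hx hx' y y' hh
    have k1 := he0 x hx y
    have k2 := he0 x' hx' y'
    simp only [L1, Prod.mk.injEq] at hh
    obtain ⟨h1, h2, h3⟩ := hh
    by_cases hss : s x = s x'
    · rw [hss] at h3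
      have h5 := hcancel _ _ _ h3
      simp only [e, h2] at h5
      obtain ⟨e1, e2, e3⟩ := D.ker x hx x.2.1 x.2.2 x' hx' x'.2.1 x'.2.2 hss _ _ _ _ (y.2 a) (y.2 b)
        (y'.2 a) (y'.2 b) (by linarith) h2
      have hyy : y = y' := hext _ _ e1 e2 (by linarith)
      subst hyy
      exact (hpath' _ x.2 _ _ _ _ rfl rfl e3).2
    · have hs' := hsne _ _ hss
      rw [hs', neg_mul, ← mul_neg] at h3
      have h4 := hcancel _ _ _ h3
      have e1 : e x y = 0 := by linarith
      have e2 : e x' y' = 0 := by linarith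
      obtain ⟨β, hβ, hsβ⟩ := hcore x
      obtain ⟨β', hβ', hsβ'⟩ := hcore x'
      obtain ⟨F1, F2, F3⟩ := D.fin hAc hBc x hx x.2.1 x.2.2 (y.1 a) (y.1 b) (y.2 a) (y.2 b) e1 β hβ hsβ
      obtain ⟨F1', F2', F3'⟩ := D.fin hAc hBc x' hx' x'.2.1 x'.2.2 (y'.1 a) (y'.1 b) (y'.2 a)
        (y'.2 b) e2 β' hβ' hsβ'
      have hyy : y = y' := by
        simp only [e] at e1 e2
        rw [h2] at e1 F3
        exact hext _ _ (by linarith) (by linarith) h1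
      subst hyy
      have hββ : (β = f ∧ β' = g) ∨ (β = g ∧ β' = f) := by
        have hne : β ≠ β' := by
          rintro rfl; exact hss (hsβ.trans hsβ'.symm)
        rcases hβ with h7 | h7 <;> rcases hβ' with h8 | h8
        · exact absurd (h7.trans h8.symm) hne
        · exact Or.inl ⟨h7, h8⟩
        · exact Or.inr ⟨h7, h8⟩
        · exact absurd (h7.trans h8.symm) hne
      have hcross : ∀ d, d = a ∨ d = b → y.1 d = 0 → ∀ (hx1 : r d β ≠ f ∧ r d β ≠ g)
          (hx2 : r d β' ≠ f ∧ r d β' ≠ g), q' ⟨r d β, hx1⟩ y = q' ⟨r d β', hx2⟩ y := by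
        intro d _ hd hx1 hx2
        rw [wall h' ⟨r d β, hx1⟩ d y hd]
        congr 1
        apply Subtype.ext
        rw [hr']
        simp only [hr]
        rcases hββ with ⟨rfl, rfl⟩ | ⟨rfl, rfl⟩
        · rw [if_pos rfl]
        · rw [if_neg hfgne.symm, if_pos rfl]
      rcases le_total 0 (μ x (y.1 a) (y.1 b)) with hm | hm
      · obtain ⟨h5, h6⟩ := F1 hm
        obtain ⟨h5', h6'⟩ := F1' (by rw [← h2]; exact hm)
        obtain ⟨hz, hq⟩ := hpath' _ x.2 _ y _ _ rfl rfl h6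
        obtain ⟨hz', hq'⟩ := hpath' _ x'.2 _ y _ _ rfl rfl h6'
        exact hq.trans ((hcross a (Or.inl rfl) h5 hz hz').trans hq'.symm)
      · obtain ⟨h5, h6⟩ := F2 hm
        obtain ⟨h5', h6'⟩ := F2' (by rw [← h2]; exact hm)
        obtain ⟨hz, hq⟩ := hpath' _ x.2 _ y _ _ rfl rfl h6
        obtain ⟨hz', hq'⟩ := hpath' _ x'.2 _ y _ _ rfl rfl h6'
        exact hq.trans ((hcross b (Or.inr rfl) h5 hz hz').trans hq'.symm)
  -- characteristic maps
  obtain ⟨D0, hD0c, hD0⟩ := descend (Ψ := S) (fun x y => mkW (L0 x y))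
    (fun x => isClosedMap_orth _ (hmkc.comp (hL0c x)) N hN
      (fun y => hcoord y _ (hN0 x x.2 y).ge))
    (fun w => by obtain ⟨x, hx, y, hy⟩ := hsurj0 w; exact ⟨⟨x, hx⟩, y, hy⟩)
    (fun x y => q x y) (fun x => h.cont x)
    (fun x y x' y' hh => by
      obtain ⟨h1, h2, h3⟩ := hmkinj _ _ (hL0p x x.2 y) (hL0p x' x'.2 y') hh
      exact hK0 x x.2 x' x'.2 y y' (Prod.ext h1 (Prod.ext h2 h3)))
  obtain ⟨D1, hD1c, hD1⟩ := descend (Ψ := {x : {x : Φ // x ≠ f ∧ x ≠ g} // x.1 ∈ S})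
    (fun x y => mkW (L1 x.1 y))
    (fun x => isClosedMap_orth _ (hmkc.comp (hL1c x.1)) N hN
      (fun y => hcoord y _ (hN1 x.1 x.2 y).ge))
    (fun w => by
      obtain ⟨x, hx, hxf, hxg, y, hy⟩ := hsurj1 w; exact ⟨⟨⟨x, hxf, hxg⟩, hx⟩, y, hy⟩)
    (fun x y => q' x.1 y) (fun x => h'.cont x.1)
    (fun x y x' y' hh => by
      obtain ⟨h1, h2, h3⟩ := hmkinj _ _ (hL1p x.1 y) (hL1p x'.1 y') hh
      exact hK1 x.1 x'.1 x.2 x'.2 y y' (Prod.ext h1 (Prod.ext h2 h3)))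
  have hL01 : ∀ x, x ≠ f → x ≠ g → ∀ y, y.1 c = 0 → L0 x y = L1 x y := by
    intro x h1 h2 y hy
    have hn : ¬ (x = f ∨ x = g) := by push Not; exact ⟨h1, h2⟩
    simp only [L0, L1, if_neg hn, hy, zero_div, zero_add]
  have hSd : ∀ d, d = a ∨ d = b → ∀ x, x ∈ S ↔ r d x ∈ S := by
    rintro d (rfl | rfl); exacts [D.AS, D.BS]
  have hμd : ∀ d, d = a ∨ d = b → ∀ x ∈ S, ∀ y : Orth C, y.1 d = 0 →
      μ (r d x) (y.1 a) (y.1 b) = μ x (y.1 a) (y.1 b) := by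
    rintro d (rfl | rfl) x hx y hy
    · rw [hy, D.μA x hx]
    · rw [hy, D.μB x hx]
  have hsd : ∀ d, d = a ∨ d = b → ∀ x ∈ S, s (r d x) = s x := by
    rintro d (rfl | rfl); exacts [D.sA, D.sB]
  have heβ : ∀ d, d = a ∨ d = b → ∀ y : Orth C, y.1 d = 0 → ∀ β, (β = f ∨ β = g) → e β y = 0 := by
    rintro d hd y hy β hβ
    simp only [e, hμβ β hβ]
    rcases hd with rfl | rfl
    · rw [hy, sub_zero, abs_of_nonneg (y.2 b)]; ring
    · rw [hy, zero_sub, abs_neg, abs_of_nonneg (y.2 a)]; ring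
  have hed : ∀ d, d = a ∨ d = b → ∀ x ∈ S, ∀ y : Orth C, y.1 d = 0 → e (r d x) y = e x y := by
    intro d hd x hx y hy
    simp only [e, hμd d hd x hx y hy]
  have hL0step : ∀ d, d = a ∨ d = b → ∀ x ∈ S, ∀ y : Orth C, y.1 d = 0 → L0 (r d x) y = L0 x y := by
    intro d hd x hx y hy
    have hzero : (x = f ∨ x = g) ∨ (r d x = f ∨ r d x = g) → e x y = 0 := by
      rintro (hh | hh)
      · exact heβ d hd y hy x hh
      · rw [← hed d hd x hx y hy]; exact heβ d hd y hy _ hh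
    simp only [L0, hed d hd x hx y hy, hμd d hd x hx y hy, hsd d hd x hx]
    split_ifs with h1 h2 h2
    · rfl
    · rw [hzero (Or.inr h1)]; simp
    · rw [hzero (Or.inl h2)]; simp
    · rfl
  have hL1step : ∀ d, d = a ∨ d = b → ∀ x : {x : Φ // x ≠ f ∧ x ≠ g}, x.1 ∈ S → ∀ y : Orth C,
      y.1 d = 0 → L1 (r' d x) y = L1 x y := by
    intro d hd x hx y hy
    have hmu2 : ∀ β β', (β = f ∨ β = g) → (β' = f ∨ β' = g) → r d x = β →
        L1 (r d β') y = L1 x y := by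
      intro β β' hβ hβ' hxβ
      have e1 : e x y = 0 := by rw [← hed d hd x hx y hy, hxβ]; exact heβ d hd y hy β hβ
      have e2 : e (r d β') y = 0 := by
        rw [hed d hd β' (hβS _ hβ') y hy]; exact heβ d hd y hy β' hβ'
      have e3 : μ (r d β') (y.1 a) (y.1 b) = μ x (y.1 a) (y.1 b) := by
        rw [← hμd d hd x hx y hy, hxβ, hμd d hd β' (hβS _ hβ') y hy, hμβ β hβ, hμβ β' hβ']
      simp only [L1, e1, e2, e3, mul_zero]
    rw [hr']
    split_ifs with h1 h2
    · exact hmu2 f g (Or.inl rfl) (Or.inr rfl) h1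
    · exact hmu2 g f (Or.inr rfl) (Or.inl rfl) h2
    · simp only [L1, hed d hd x hx y hy, hμd d hd x hx y hy, hsd d hd x hx]
  have hSd' : ∀ d, d = a ∨ d = b → ∀ x : {x : Φ // x ≠ f ∧ x ≠ g}, (r' d x).1 ∈ S ↔ x.1 ∈ S := by
    intro d hd x
    rw [hr']
    split_ifs with h1 h2
    · refine iff_of_true ((hSd d hd g).1 D.gS) ?_
      rw [hSd d hd, h1]; exact D.fS
    · refine iff_of_true ((hSd d hd f).1 D.fS) ?_
      rw [hSd d hd, h2]; exact D.gS
    · exact (hSd d hd x).symm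
  have hd' : ∀ d, d = c ∨ (d = a ∨ d = b) := by intro d; have := hC d; tauto
  -- the maps
  let G0 : Φ → Orth C → Y' := fun x y =>
    if x ∈ S then D1 (mkW (L0 x y)) else
      if hx : x ≠ f ∧ x ≠ g then q' ⟨x, hx⟩ y else D1 (mkW (L0 x y))
  have hG1 : ∀ x ∈ S, ∀ y, G0 x y = D1 (mkW (L0 x y)) := fun x hx y => if_pos hx
  have hnS : ∀ x, x ∉ S → x ≠ f ∧ x ≠ g := fun x hx =>
    ⟨fun e => hx (e ▸ D.fS), fun e => hx (e ▸ D.gS)⟩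
  have hG2 : ∀ x (hx : x ∉ S) y, G0 x y = q' ⟨x, hnS x hx⟩ y := fun x hx y => by
    simp only [G0, if_neg hx, dif_pos (hnS x hx)]
  have hG3 : ∀ x (hx : x ≠ f ∧ x ≠ g) y, y.1 c = 0 → G0 x y = q' ⟨x, hx⟩ y := by
    intro x hx y hy
    by_cases hxS : x ∈ S
    · rw [hG1 x hxS, hL01 x hx.1 hx.2 y hy]
      exact hD1 ⟨⟨x, hx⟩, hxS⟩ y
    · exact hG2 x hxS y
  have hGstep : ∀ d x y, y.1 d = 0 → G0 (r d x) y = G0 x y := by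
    intro d x y hy
    rcases hd' d with rfl | hd
    · by_cases hx : x = f ∨ x = g
      · have hL : L0 f y = L0 g y := by
          simp only [L0, if_pos (Or.inl rfl : f = f ∨ f = g), if_pos (Or.inr rfl : g = f ∨ g = g), e,
            D.μf, D.μg, hy, zero_div, mul_zero]
        have hGG : G0 f y = G0 g y := by rw [hG1 f D.fS, hG1 g D.gS, hL]
        rcases hx with rfl | rfl
        · rw [← hg, hGG]
        · rw [← hf, hGG]
      · push Not at hx
        rw [hG3 x hx y hy, hG3 _ (hcc x hx.1 hx.2) y hy, wall h' ⟨x, hx⟩ d y hy]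
        congr 1
        exact Subtype.ext (hrc' ⟨x, hx⟩).symm
    · by_cases hx : x ∈ S
      · rw [hG1 x hx, hG1 _ ((hSd d hd x).1 hx), hL0step d hd x hx y hy]
      · have hx2 : r d x ∉ S := fun hh => hx ((hSd d hd x).2 hh)
        rw [hG2 x hx, hG2 _ hx2, wall h' ⟨x, hnS x hx⟩ d y hy]
        congr 1
        exact Subtype.ext (hrn' d ⟨x, hnS x hx⟩ (hnS _ hx2).1 (hnS _ hx2).2).symm
  have hG0c : ∀ x, Continuous (G0 x) := by
    intro x
    by_cases hx : x ∈ S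
    · have : G0 x = fun y => D1 (mkW (L0 x y)) := funext (hG1 x hx)
      rw [this]; exact hD1c.comp (hmkc.comp (hL0c x))
    · have : G0 x = q' ⟨x, hnS x hx⟩ := funext (hG2 x hx)
      rw [this]; exact h'.cont _
  obtain ⟨G, hGc, hG⟩ := descend q h.closed h.surj G0 hG0c (by
    intro x y x' y' hh
    obtain ⟨rfl, h2⟩ := (h.ker _ _ _ _).1 hh
    exact (conn.invariant (fun x => G0 x y) (fun d hd x => hGstep d x y hd) h2).symm)
  let F0 : {x : Φ // x ≠ f ∧ x ≠ g} → Orth C → Y := fun x y =>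
    if x.1 ∈ S then D0 (mkW (L1 x y)) else q x y
  have hF1 : ∀ x, x.1 ∈ S → ∀ y, F0 x y = D0 (mkW (L1 x y)) := fun x hx y => if_pos hx
  have hF2 : ∀ x, x.1 ∉ S → ∀ y, F0 x y = q x y := fun x hx y => if_neg hx
  have hF3 : ∀ x y, y.1 c = 0 → F0 x y = q x y := by
    intro x y hy
    by_cases hxS : x.1 ∈ S
    · rw [hF1 x hxS, ← hL01 x x.2.1 x.2.2 y hy]
      exact hD0 ⟨x, hxS⟩ y
    · exact hF2 x hxS y
  have hFstep : ∀ d x y, y.1 d = 0 → F0 (r' d x) y = F0 x y := by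
    intro d x y hy
    rcases hd' d with rfl | hd
    · rw [hF3 _ y hy, hF3 _ y hy, hrc', ← wall h x d y hy]
    · by_cases hx : x.1 ∈ S
      · rw [hF1 x hx, hF1 _ ((hSd' d hd x).2 hx), hL1step d hd x hx y hy]
      · have hx2 : r d x ∉ S := fun hh => hx ((hSd d hd x).2 hh)
        have hx3 : (r' d x).1 ∉ S := fun hh => hx ((hSd' d hd x).1 hh)
        rw [hF2 x hx, hF2 _ hx3, hrn' d x (hnS _ hx2).1 (hnS _ hx2).2, ← wall h x d y hy]
  have hF0c : ∀ x, Continuous (F0 x) := by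
    intro x
    by_cases hx : x.1 ∈ S
    · have : F0 x = fun y => D0 (mkW (L1 x y)) := funext (hF1 x hx)
      rw [this]; exact hD0c.comp (hmkc.comp (hL1c x))
    · have : F0 x = q x := funext (hF2 x hx)
      rw [this]; exact h.cont _
  obtain ⟨F, hFc, hF⟩ := descend q' h'.closed h'.surj F0 hF0c (by
    intro x y x' y' hh
    obtain ⟨rfl, h2⟩ := (h'.ker _ _ _ _).1 hh
    exact (conn.invariant (fun x => F0 x y) (fun d hd x => hFstep d x y hd) h2).symm)
  refine ⟨⟨⟨G, F, ?_, ?_⟩, hGc, hFc⟩⟩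
  · intro z
    obtain ⟨x, y, rfl⟩ := h.surj z
    rw [hG]
    by_cases hx : x ∈ S
    · obtain ⟨x2, hx2, hxf, hxg, y2, hy2⟩ := hsurj1 (mkW (L0 x y))
      rw [hG1 x hx, ← hy2, hD1 ⟨⟨x2, hxf, hxg⟩, hx2⟩ y2, hF, hF1 _ hx2, hy2]
      exact hD0 ⟨x, hx⟩ y
    · rw [hG2 x hx, hF, hF2 _ hx]
  · intro z
    obtain ⟨x, y, rfl⟩ := h'.surj z
    rw [hF]
    by_cases hx : x.1 ∈ S
    · obtain ⟨x2, hx2, y2, hy2⟩ := hsurj0 (mkW (L1 x y))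
      rw [hF1 x hx, ← hy2, hD0 ⟨x2, hx2⟩ y2, hG, hG1 _ hx2, hy2]
      exact hD1 ⟨x, hx⟩ y
    · rw [hF2 x hx, hG, hG2 _ hx]

end GlueAux

namespace GlueAux
open Set Filter Topology

theorem eucAt_pillow {C Φ Y : Type*} [TopologicalSpace Y] {r : C → Φ → Φ} {q : Φ → Orth C → Y}
    [Finite Φ] [Finite C] (h : Pres r zset q) (a b c : C) (hab : a ≠ b) (hac : a ≠ c)
    (hbc : b ≠ c) (hC : ∀ d, d = a ∨ d = b ∨ d = c) (f g : Φ) (hfg : f ≠ g)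
    (hrf : ∀ d, r d f = g) (hrg : ∀ d, r d g = f)
    (hall : ∀ x, x = f ∨ x = g) (z : Y) : EucAt 3 z := by
  let s : Φ → ℝ := fun x => if x = f then 1 else -1
  have hs1 : ∀ x, |s x| = 1 := fun x => by simp only [s]; split_ifs <;> norm_num
  let m : Orth C → ℝ := fun y => min (y.1 a) (min (y.1 b) (y.1 c))
  have hm0 : ∀ y, 0 ≤ m y := fun y => le_min (y.2 a) (le_min (y.2 b) (y.2 c))
  have hmc : Continuous m := (continuous_coordO a).min ((continuous_coordO b).min (continuous_coordO c))
  let L : Φ → Orth C → Fin 3 → ℝ := fun x y => ![y.1 a - y.1 c, y.1 b - y.1 c, s x * m y]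
  have hLc : ∀ x, Continuous (L x) := by
    intro x
    refine continuous_pi fun i => ?_
    fin_cases i
    · exact (continuous_coordO a).sub (continuous_coordO c)
    · exact (continuous_coordO b).sub (continuous_coordO c)
    · exact continuous_const.mul hmc
  let N : (Fin 3 → ℝ) → ℝ := fun w => |w 2| + 2 * |w 0| + 2 * |w 1|
  have hN : Continuous N := by fun_prop
  have hmin : ∀ y : Orth C, m y = y.1 c + min (y.1 a - y.1 c) (min (y.1 b - y.1 c) 0) := by
    intro y
    simp only [m]
    rw [← min_add_add_left, ← min_add_add_left]
    simp
  have hext : ∀ y y' : Orth C, y.1 a = y'.1 a → y.1 b = y'.1 b → y.1 c = y'.1 c → y = y' := by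
    intro y y' h1 h2 h3
    apply Subtype.ext; funext d
    rcases hC d with rfl | rfl | rfl <;> assumption
  have hcl : ∀ x, IsClosedMap (L x) := by
    intro x
    refine isClosedMap_orth _ (hLc x) N hN ?_
    intro y d
    change y.1 d ≤ |s x * m y| + 2 * |y.1 a - y.1 c| + 2 * |y.1 b - y.1 c|
    rw [abs_mul, hs1, one_mul, abs_of_nonneg (hm0 y)]
    have h1 := le_abs_self (y.1 a - y.1 c)
    have h2 := le_abs_self (y.1 b - y.1 c)
    have h3 := neg_le_abs (y.1 a - y.1 c)
    have h4 := neg_le_abs (y.1 b - y.1 c)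
    have h5 : y.1 a ≤ m y ∨ y.1 b ≤ m y ∨ y.1 c ≤ m y := by
      simp only [m]
      rcases min_choice (y.1 a) (min (y.1 b) (y.1 c)) with e | e
      · left; rw [e]
      · rcases min_choice (y.1 b) (y.1 c) with e' | e'
        · right; left; rw [e, e']
        · right; right; rw [e, e']
    have h6 := abs_nonneg (y.1 a - y.1 c)
    have h7 := abs_nonneg (y.1 b - y.1 c)
    rcases hC d with rfl | rfl | rfl <;> rcases h5 with h5 | h5 | h5 <;> linarith
  have hP : Pres r zset L := by
    refine ⟨hLc, hcl, ?_, ?_⟩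
    · intro w
      have hx : ∃ x, s x * |w 2| = w 2 := by
        rcases le_total 0 (w 2) with h0 | h0
        · exact ⟨f, by simp [s, abs_of_nonneg h0]⟩
        · exact ⟨g, by simp [s, hfg.symm, abs_of_nonpos h0]⟩
      obtain ⟨x, hx⟩ := hx
      let k := min (w 0) (min (w 1) 0)
      have k1 : k ≤ w 0 := min_le_left _ _
      have k2 : k ≤ w 1 := (min_le_right _ _).trans (min_le_left _ _)
      have k3 : k ≤ 0 := (min_le_right _ _).trans (min_le_right _ _)
      have k4 := abs_nonneg (w 2)
      refine ⟨x, ⟨fun d => if d = a then |w 2| - k + w 0 else if d = b then |w 2| - k + w 1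
        else |w 2| - k, ?_⟩, ?_⟩
      · intro d; dsimp only; split_ifs <;> linarith
      · funext i
        fin_cases i
        · change ite _ _ _ - ite _ _ _ = w 0
          simp [hac.symm, hbc.symm]
        · change ite _ _ _ - ite _ _ _ = w 1
          simp [hab.symm, hac.symm, hbc.symm]
        · change s x * m _ = w 2
          rw [hmin]
          simp [hab.symm, hac.symm, hbc.symm, k, hx]
    · intro x y x' y'
      constructor
      · intro hL
        have h0 : y.1 a - y.1 c = y'.1 a - y'.1 c := congrFun hL 0
        have h1 : y.1 b - y.1 c = y'.1 b - y'.1 c := congrFun hL 1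
        have h2 : s x * m y = s x' * m y' := congrFun hL 2
        have h3 : m y = m y' := by
          have := congrArg abs h2
          rwa [abs_mul, abs_mul, hs1, hs1, one_mul, one_mul, abs_of_nonneg (hm0 y),
            abs_of_nonneg (hm0 y')] at this
        have h4 : y.1 c = y'.1 c := by
          rw [hmin, hmin, h0, h1] at h3; linarith
        have hyy := hext y y' (by linarith) (by linarith) h4
        refine ⟨hyy, ?_⟩
        subst hyy
        by_cases hxx : x = x'
        · subst hxx; exact conn.refl _
        · have hx' : ∀ d, x' = r d x := by
            intro d
            rcases hall x with rfl | rfl <;> rcases hall x' with rfl | rfl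
            · exact absurd rfl hxx
            · rw [hrf]
            · rw [hrg]
            · exact absurd rfl hxx
          have hss : s x = - s x' := by
            rcases hall x with rfl | rfl <;> rcases hall x' with rfl | rfl
            · exact absurd rfl hxx
            · simp [s, hfg.symm]
            · simp [s, hfg.symm]
            · exact absurd rfl hxx
          have hm : m y = 0 := by
            rw [hss] at h2
            have : s x' ≠ 0 := fun e => by have := hs1 x'; rw [e] at this; norm_num at this
            have h6 : s x' * m y = 0 := by linarith
            exact (mul_eq_zero.1 h6).resolve_left this
          have : ∃ d, y.1 d = 0 := by
            simp only [m] at hm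
            rcases min_choice (y.1 a) (min (y.1 b) (y.1 c)) with e | e
            · exact ⟨a, by rw [← e, hm]⟩
            · rcases min_choice (y.1 b) (y.1 c) with e' | e'
              · exact ⟨b, by rw [← e', ← e, hm]⟩
              · exact ⟨c, by rw [← e', ← e, hm]⟩
          obtain ⟨d, hd⟩ := this
          rw [hx' d]
          exact conn.step (mem_zset.2 hd) _
      · rintro ⟨rfl, hc⟩
        refine (conn.invariant (fun x => L x y) ?_ hc).symm
        intro d hd x
        have hd : y.1 d = 0 := hd
        have : m y = 0 := by
          refine le_antisymm ?_ (hm0 y)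
          rw [← hd]
          rcases hC d with rfl | rfl | rfl
          · exact min_le_left _ _
          · exact (min_le_right _ _).trans (min_le_left _ _)
          · exact (min_le_right _ _).trans (min_le_right _ _)
        simp only [L, this, mul_zero]
  obtain ⟨e, _⟩ := h.exists_homeo hP (Homeomorph.refl _) (fun _ _ _ => Iff.rfl)
  exact EucAt.of_oph e.toOpenPartialHomeomorph (by simp) (eucAt_pi (by simp) _)

/-- No retraction onto a plane of a cone whose product with a line is a 4-manifold. -/
theorem no_retract {Y : Type*} [TopologicalSpace Y] (p : Y) (hE : EucAt 4 ((p, 0) : Y × ℝ))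
    (Γ : ℂ → Y) (φ : Y → ℂ) (hΓ : Continuous Γ) (hφ : Continuous φ) (hφΓ : ∀ w, φ (Γ w) = w)
    (hp : ∀ y, φ y = 0 → y = p) : False := by
  obtain ⟨ψ, hψ⟩ := hE
  have hΓ0 : Γ 0 = p := hp _ (hφΓ 0)
  let A : Eu 3 → Y × ℝ := fun x => (Γ ⟨x 0, x 1⟩, x 2)
  let B : Y × ℝ → Eu 3 := fun z => !₂[(φ z.1).re, (φ z.1).im, z.2]
  have hA : Continuous A := by
    refine (hΓ.comp ?_).prodMk (by fun_prop)
    have : (fun x : Eu 3 => (⟨x 0, x 1⟩ : ℂ)) = fun x => (x 0 : ℂ) + (x 1 : ℂ) * Complex.I := by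
      funext x; apply Complex.ext <;> simp
    rw [this]; fun_prop
  have hB : Continuous B := by
    have h1 : Continuous fun z : Y × ℝ => (![(φ z.1).re, (φ z.1).im, z.2] : Fin 3 → ℝ) := by
      refine continuous_pi fun i => ?_
      fin_cases i
      · exact Complex.continuous_re.comp (hφ.comp continuous_fst)
      · exact Complex.continuous_im.comp (hφ.comp continuous_fst)
      · exact continuous_snd
    exact (PiLp.continuous_toLp 2 _).comp h1
  have hBA : ∀ x, B (A x) = x := by
    intro x
    ext i
    fin_cases i <;> simp [A, B, hφΓ]
  have hA0 : A 0 = (p, 0) := by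
    have : (⟨0, 0⟩ : ℂ) = 0 := rfl
    simp only [A, PiLp.zero_apply, this, hΓ0]
  have hB0 : ∀ z, B z = 0 → z = (p, 0) := by
    intro z hz
    have h0 : (φ z.1).re = 0 := by simpa [B] using congrArg (fun v : Eu 3 => v 0) hz
    have h1 : (φ z.1).im = 0 := by simpa [B] using congrArg (fun v : Eu 3 => v 1) hz
    have h2 : z.2 = 0 := by simpa [B] using congrArg (fun v : Eu 3 => v 2) hz
    exact Prod.ext (hp _ (Complex.ext h0 h1)) h2
  have hsrc : ψ.source ∈ 𝓝 (A 0) := by rw [hA0]; exact ψ.open_source.mem_nhds hψ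
  refine no_dim_drop 4 3 (by norm_num) (fun x => ψ (A x)) (fun v => B (ψ.symm v)) 0
    (A ⁻¹' ψ.source) (hA.continuousAt.preimage_mem_nhds hsrc) ?_ ψ.target ?_ ?_ ?_ ?_
  · exact ψ.continuousOn.comp hA.continuousOn (fun x hx => hx)
  · rw [hA0]; exact ψ.open_target.mem_nhds (ψ.map_source hψ)
  · exact hB.comp_continuousOn ψ.continuousOn_symm
  · intro x hx
    rw [ψ.left_inv hx, hBA]
  · intro v hv hv0
    rw [hA0, ← hB0 _ hv0, ψ.right_inv hv]

/-- The dual cocycle of a closed dual path crossing one `c`-edge only. -/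
theorem exists_cocycle {C Φ : Type*} {r : C → Φ → Φ} (hr : ∀ c f, r c (r c f) = f)
    (hfree : ∀ c f, r c f ≠ f) (ε : Φ → ℤ) (hε1 : ∀ x, ε x * ε x = 1)
    (hε : ∀ d x, ε (r d x) = - ε x) (a b c : C) (hab : a ≠ b) (hac : a ≠ c)
    (hbc : b ≠ c) (f g : Φ) (hg : g = r c f) (hfg : g ∈ orb (r a) (r b) f) :
    ∃ κ : Φ → C → ℤ, (∀ d x, κ (r d x) d = κ x d) ∧ (∀ x, κ x a + κ x b + κ x c = 0) ∧
      (∀ x, κ x c = if x = f ∨ x = g then 1 else 0) := by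
  have hwalk : ∀ z, z ∈ orb (r a) (r b) f → ∃ κ : Φ → C → ℤ, (∀ d x, κ (r d x) d = κ x d) ∧
      (∀ x, κ x a + κ x b = ε f * (if x = f then 1 else 0) - ε z * (if x = z then 1 else 0)) ∧
      (∀ x, κ x c = 0) := by
    intro z hz
    have hst : ∀ y d, (d = a ∨ d = b) → (∃ κ : Φ → C → ℤ, (∀ d x, κ (r d x) d = κ x d) ∧
      (∀ x, κ x a + κ x b = ε f * (if x = f then 1 else 0) - ε y * (if x = y then 1 else 0)) ∧
      (∀ x, κ x c = 0)) → ∃ κ : Φ → C → ℤ, (∀ d x, κ (r d x) d = κ x d) ∧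
      (∀ x, κ x a + κ x b = ε f * (if x = f then 1 else 0) - ε (r d y) * (if x = r d y then 1 else 0)) ∧
      (∀ x, κ x c = 0) := by
      rintro y d hd ⟨κ, h1, h2, h3⟩
      have hdc : c ≠ d := by rcases hd with rfl | rfl; exacts [hac.symm, hbc.symm]
      refine ⟨fun x e => κ x e + if e = d then ε y * ((if x = y then 1 else 0) +
        (if x = r d y then 1 else 0)) else 0, ?_, ?_, ?_⟩
      · intro e x
        dsimp only
        rw [h1]
        by_cases he : e = d
        · subst he
          have e1 : (r e x = y) ↔ (x = r e y) := by
            constructor <;> intro hh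
            · rw [← hh, hr]
            · rw [hh, hr]
          have e2 : (r e x = r e y) ↔ x = y := by
            constructor <;> intro hh
            · rw [← hr e x, hh, hr]
            · rw [hh]
          simp only [e1, e2, if_true]
          ring
        · simp only [if_neg he]
      · intro x
        have := h2 x
        dsimp only
        rw [hε]
        rcases hd with rfl | rfl
        · rw [if_pos rfl, if_neg hab.symm]
          linear_combination this
        · rw [if_pos rfl, if_neg hab]
          linear_combination this
      · intro x
        dsimp only
        rw [h3, if_neg hdc, add_zero]
    unfold orb at hz
    induction hz with
    | refl => exact ⟨fun _ _ => 0, by simp, by simp, by simp⟩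
    | tail _ hs ih =>
      rcases hs with rfl | rfl
      · exact hst _ a (Or.inl rfl) ih
      · exact hst _ b (Or.inr rfl) ih
  obtain ⟨κ, h1, h2, h3⟩ := hwalk g hfg
  have hgf : f ≠ g := by rw [hg]; exact (hfree c f).symm
  have hd : ∀ x : Φ, ((if x = f then 1 else 0 : ℤ) + if x = g then 1 else 0) =
      if x = f ∨ x = g then 1 else 0 := by
    intro x
    by_cases h4 : x = f
    · have : x ≠ g := by rw [h4]; exact hgf
      simp [h4, hgf]
    · simp [h4]
  refine ⟨fun x e => if e = c then (if x = f ∨ x = g then 1 else 0) else - ε f * κ x e, ?_, ?_, ?_⟩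
  · intro e x
    dsimp only
    split_ifs with h4 h5 h6 h6
    · rfl
    · exfalso; subst h4; apply h6
      rcases h5 with h5 | h5
      · right; rw [hg, ← h5, hr]
      · left; rw [← hr e x, h5, hg, hr]
    · exfalso; subst h4; apply h5
      rcases h6 with rfl | rfl
      · right; exact hg.symm
      · left; rw [hg, hr]
    · rfl
    · rw [h1]
  · intro x
    dsimp only
    rw [if_neg hac, if_neg hbc, if_pos rfl, ← hd]
    have h5 := h2 x
    have h6 : ε g = - ε f := by rw [hg, hε]
    rw [h6] at h5
    linear_combination (-ε f) * h5 - ((if x = f then 1 else 0) + if x = g then 1 else 0) * hε1 f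
  · intro x; simp

theorem continuous_spiral {A : Type*} [TopologicalSpace A] (σ t : A → ℝ) (hσ : Continuous σ)
    (ht : Continuous t) : Continuous fun x => (σ x : ℂ) * Complex.exp ((t x / σ x : ℝ) * Complex.I) := by
  rw [continuous_iff_continuousAt]
  intro x
  by_cases hx : σ x = 0
  · unfold ContinuousAt
    have h0 : (σ x : ℂ) * Complex.exp ((t x / σ x : ℝ) * Complex.I) = 0 := by rw [hx]; simp
    simp only [h0]
    refine squeeze_zero_norm (a := fun x => |σ x|) ?_ ?_
    · intro y
      rw [norm_mul, Complex.norm_exp_ofReal_mul_I, mul_one, Complex.norm_real, Real.norm_eq_abs]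
    · have := (hσ.abs).tendsto x
      rwa [hx, abs_zero] at this
  · have h1 : ContinuousAt (fun x => t x / σ x) x := ht.continuousAt.div hσ.continuousAt hx
    have h2 : ContinuousAt (fun x => ((t x / σ x : ℝ) : ℂ)) x :=
      Complex.continuous_ofReal.continuousAt.comp h1
    exact (Complex.continuous_ofReal.comp hσ).continuousAt.mul
      (Complex.continuous_exp.continuousAt.comp (h2.mul continuousAt_const))

end GlueAux

namespace GlueAux
open Set Filter Topology

theorem orb_conn {C Φ : Type*} {r : C → Φ → Φ} {T : Set C} {a b : C} (ha : a ∈ T) (hb : b ∈ T)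
    {f x : Φ} (hx : x ∈ orb (r a) (r b) f) : conn r T f x := by
  refine Relation.ReflTransGen.mono ?_ _ _ hx
  rintro u v (rfl | rfl)
  · exact ⟨a, ha, rfl⟩
  · exact ⟨b, hb, rfl⟩

theorem no_crystal {C Φ Y : Type*} [TopologicalSpace Y] {r : C → Φ → Φ} {q : Φ → Orth C → Y}
    [Finite Φ] [Finite C] (hr : ∀ c f, r c (r c f) = f) (hfree : ∀ c f, r c f ≠ f)
    (h : Pres r zset q) (ε : Φ → ℤ) (hε1 : ∀ x, ε x * ε x = 1)
    (hε : ∀ d x, ε (r d x) = - ε x) (a b c : C) (hab : a ≠ b) (hac : a ≠ c)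
    (hbc : b ≠ c) (hC : ∀ d, d = a ∨ d = b ∨ d = c) (f : Φ)
    (h1 : ∀ x, x ∈ orb (r a) (r b) f) (h2 : ∀ x, x ∈ orb (r a) (r c) f)
    (h3 : ∀ x, x ∈ orb (r b) (r c) f) (f2 : Φ) (hf2 : f2 ≠ f) (hf2' : f2 ≠ r c f)
    (hE : ∀ z : Y × ℝ, EucAt 4 z) : False := by
  obtain ⟨κ, k1, k2, k3⟩ := exists_cocycle hr hfree ε hε1 hε a b c hab hac hbc f (r c f) rfl (h1 _)
  have kf : κ f c = 1 := by rw [k3, if_pos (Or.inl rfl)]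
  have kf2 : κ f2 c = 0 := by rw [k3, if_neg (by push Not; exact ⟨hf2, hf2'⟩)]
  let σ : Orth C → ℝ := fun y => y.1 a + y.1 b + y.1 c
  have hσc : Continuous σ := ((continuous_coordO a).add (continuous_coordO b)).add (continuous_coordO c)
  have hσ0 : ∀ y, 0 ≤ σ y := fun y => add_nonneg (add_nonneg (y.2 a) (y.2 b)) (y.2 c)
  let t : Φ → Orth C → ℝ := fun x y =>
    2 * Real.pi * (y.1 b * ((κ x c : ℝ) - 1 / 2) - y.1 c * (κ x b : ℝ))
  have htc : ∀ x, Continuous (t x) := fun x => continuous_const.mul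
    (((continuous_coordO b).mul continuous_const).sub ((continuous_coordO c).mul continuous_const))
  let φ0 : Φ → Orth C → ℂ := fun x y =>
    (σ y : ℂ) * Complex.exp ((t x y / σ y : ℝ) * Complex.I)
  have hφn : ∀ x y, ‖φ0 x y‖ = σ y := by
    intro x y
    simp only [φ0]
    rw [norm_mul, Complex.norm_exp_ofReal_mul_I, mul_one, Complex.norm_real, Real.norm_eq_abs,
      abs_of_nonneg (hσ0 y)]
  have hstep : ∀ d x y, y.1 d = 0 → φ0 (r d x) y = φ0 x y := by
    intro d x y hy
    have hk : ∃ k : ℤ, t (r d x) y = t x y + (k * (2 * Real.pi)) * σ y := by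
      rcases hC d with rfl | rfl | rfl
      · refine ⟨κ (r d x) c - κ x c, ?_⟩
        have e1 := k2 (r d x)
        have e2 := k2 x
        have e3 := k1 d x
        have e4 : (κ (r d x) b : ℝ) = κ x b + κ x c - κ (r d x) c := by
          have : κ (r d x) b = κ x b + κ x c - κ (r d x) c := by linarith
          exact_mod_cast this
        simp only [t, σ, e4, hy]
        push_cast
        ring
      · refine ⟨0, ?_⟩
        simp only [t, k1 d x, hy]; push_cast; ring
      · refine ⟨0, ?_⟩
        simp only [t, k1 d x, hy]; push_cast; ring
    obtain ⟨k, hk⟩ := hk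
    by_cases h0 : σ y = 0
    · simp only [φ0, h0]; simp
    · simp only [φ0, hk]
      congr 1
      rw [Complex.exp_eq_exp_iff_exists_int]
      refine ⟨k, ?_⟩
      rw [add_div, mul_div_assoc _ (σ y), div_self h0]
      push_cast
      ring
  obtain ⟨φ, hφc, hφ⟩ := descend q h.closed h.surj φ0
    (fun x => continuous_spiral σ (t x) hσc (htc x)) (by
    intro x y x' y' hh
    obtain ⟨rfl, h2⟩ := (h.ker _ _ _ _).1 hh
    exact (conn.invariant (fun x => φ0 x y) (fun d hd x => hstep d x y hd) h2).symm)
  -- the section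
  let θ : ℂ → ℝ := fun w => Real.arccos (w.re / ‖w‖)
  let τ : ℂ → ℝ := fun w => ‖w‖ * (θ w / Real.pi)
  have hpi := Real.pi_pos
  have hθ0 : ∀ w, 0 ≤ θ w / Real.pi := fun w => div_nonneg (Real.arccos_nonneg _) hpi.le
  have hθ1 : ∀ w, θ w / Real.pi ≤ 1 := fun w => (div_le_one hpi).2 (Real.arccos_le_pi _)
  have hτ0 : ∀ w, 0 ≤ τ w := fun w => mul_nonneg (norm_nonneg _) (hθ0 w)
  have hτ1 : ∀ w, τ w ≤ ‖w‖ := fun w => mul_le_of_le_one_right (norm_nonneg _) (hθ1 w)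
  have hτc : Continuous τ := by
    rw [continuous_iff_continuousAt]
    intro w
    by_cases hw : w = 0
    · subst hw
      unfold ContinuousAt
      have h0 : τ 0 = 0 := by simp [τ]
      rw [h0]
      refine squeeze_zero_norm (a := fun w : ℂ => ‖w‖) ?_ ?_
      · intro w; rw [Real.norm_eq_abs, abs_of_nonneg (hτ0 w)]; exact hτ1 w
      · have := (continuous_norm (E := ℂ)).tendsto 0
        rwa [norm_zero] at this
    · have hw' : ‖w‖ ≠ 0 := norm_ne_zero_iff.2 hw
      have e1 : ContinuousAt (fun w : ℂ => w.re / ‖w‖) w :=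
        Complex.continuous_re.continuousAt.div continuous_norm.continuousAt hw'
      have e2 : ContinuousAt θ w := Real.continuous_arccos.continuousAt.comp e1
      exact continuous_norm.continuousAt.mul (e2.div_const _)
  let yy : ℂ → Orth C := fun w => ⟨fun d => if d = b then τ w else if d = a then ‖w‖ - τ w else 0,
    fun d => by
      dsimp only
      split_ifs
      · exact hτ0 w
      · linarith [hτ1 w]
      · exact le_rfl⟩
  have yb : ∀ w, (yy w).1 b = τ w := fun w => if_pos rfl
  have ya : ∀ w, (yy w).1 a = ‖w‖ - τ w := fun w => by simp [yy, hab]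
  have yc : ∀ w, (yy w).1 c = 0 := fun w => by simp [yy, hac.symm, hbc.symm]
  have hyc : Continuous yy := by
    refine Continuous.subtype_mk (continuous_pi fun d => ?_) _
    split_ifs
    · exact hτc
    · exact continuous_norm.sub hτc
    · exact continuous_const
  have hσy : ∀ w, σ (yy w) = ‖w‖ := fun w => by simp only [σ, ya, yb, yc]; ring
  let Γ : ℂ → Y := fun w => if 0 ≤ w.im then q f (yy w) else q f2 (yy w)
  have hΓc : Continuous Γ := by
    refine Continuous.if_le ((h.cont f).comp hyc) ((h.cont f2).comp hyc) continuous_const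
      Complex.continuous_im ?_
    intro w hw
    refine (h.ker _ _ _ _).2 ⟨rfl, ?_⟩
    have hn : ‖w‖ = |w.re| := by
      have : w = (w.re : ℂ) := Complex.ext rfl (by simpa using hw.symm)
      conv_lhs => rw [this]
      rw [Complex.norm_real, Real.norm_eq_abs]
    by_cases hw0 : w.re = 0
    · have hn0 : ‖w‖ = 0 := by rw [hn, hw0, abs_zero]
      have hτw : τ w = 0 := by simp only [τ, hn0, zero_mul]
      exact orb_conn (mem_zset.2 (by rw [yb, hτw])) (mem_zset.2 (yc w)) (h3 f2)
    · rcases lt_or_gt_of_ne hw0 with hneg | hpos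
      · have hτw : τ w = ‖w‖ := by
          have : w.re / ‖w‖ = -1 := by
            rw [hn, abs_of_neg hneg, div_neg, div_self hw0]
          simp only [τ, θ, this, Real.arccos_neg_one]
          rw [div_self hpi.ne', mul_one]
        exact orb_conn (mem_zset.2 (by rw [ya, hτw, sub_self])) (mem_zset.2 (yc w)) (h2 f2)
      · have hτw : τ w = 0 := by
          have : w.re / ‖w‖ = 1 := by
            rw [hn, abs_of_pos hpos, div_self hw0]
          simp only [τ, θ, this, Real.arccos_one, zero_div, mul_zero]
        exact orb_conn (mem_zset.2 (by rw [yb, hτw])) (mem_zset.2 (yc w)) (h3 f2)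
  have hφΓ : ∀ w, φ (Γ w) = w := by
    intro w
    by_cases hw0 : w = 0
    · have : ‖φ (Γ w)‖ = 0 := by
        simp only [Γ]
        split_ifs <;> rw [hφ, hφn, hσy, hw0, norm_zero]
      rw [norm_eq_zero.1 this, hw0]
    · have hn : ‖w‖ ≠ 0 := norm_ne_zero_iff.2 hw0
      have hval : ∀ x, φ (q x (yy w)) = ‖w‖ * Complex.exp ((2 * θ w * ((κ x c : ℝ) - 1 / 2) : ℝ) * Complex.I) := by
        intro x
        rw [hφ]
        simp only [φ0, hσy]
        congr 4
        simp only [t, yb, yc, τ]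
        field_simp
        ring
      simp only [Γ]
      split_ifs with him
      · rw [hval, kf]
        have : (2 * θ w * (((1 : ℤ) : ℝ) - 1 / 2)) = Complex.arg w := by
          rw [Complex.arg_of_im_nonneg_of_ne_zero him hw0]; push_cast; simp only [θ]; ring
        rw [this]
        exact Complex.norm_mul_exp_arg_mul_I w
      · rw [hval, kf2]
        have : (2 * θ w * (((0 : ℤ) : ℝ) - 1 / 2)) = Complex.arg w := by
          rw [Complex.arg_of_im_neg (not_le.1 him)]; push_cast; simp only [θ]; ring
        rw [this]
        exact Complex.norm_mul_exp_arg_mul_I w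
  refine no_retract (q f ⟨fun _ => 0, fun _ => le_rfl⟩) (hE _) Γ φ hΓc hφc hφΓ ?_
  intro z hz
  obtain ⟨x, y, rfl⟩ := h.surj z
  have h0 : σ y = 0 := by rw [← hφn x y, ← hφ, hz, norm_zero]
  have hy : y = ⟨fun _ => 0, fun _ => le_rfl⟩ := by
    have e1 := y.2 a
    have e2 := y.2 b
    have e3 := y.2 c
    simp only [σ] at h0
    apply Subtype.ext; funext d
    rcases hC d with rfl | rfl | rfl <;> dsimp only <;> linarith
  rw [hy]
  exact ((h.ker _ _ _ _).2 ⟨rfl, orb_conn (mem_zset.2 rfl) (mem_zset.2 rfl) (h1 x)⟩).symm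

theorem eucAt_nodipole {C Φ Y : Type*} [TopologicalSpace Y] {r : C → Φ → Φ} {q : Φ → Orth C → Y}
    [Finite Φ] [Finite C] (hr : ∀ c f, r c (r c f) = f)
    (h : Pres r zset q) (ε : Φ → ℤ) (hε1 : ∀ x, ε x * ε x = 1)
    (hε : ∀ d x, ε (r d x) = - ε x) (a b c : C) (hab : a ≠ b) (hac : a ≠ c)
    (hbc : b ≠ c) (hC : ∀ d, d = a ∨ d = b ∨ d = c) (f : Φ) (hf : ∀ x, conn r univ f x)
    (h1 : ∀ x, r c x ∈ orb (r a) (r b) x) (h2 : ∀ x, r b x ∈ orb (r a) (r c) x)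
    (h3 : ∀ x, r a x ∈ orb (r b) (r c) x)
    (hE : ∀ z : Y × ℝ, EucAt 4 z) (z : Y) : EucAt 3 z := by
  have hfree : ∀ c f, r c f ≠ f := by
    intro c x hx
    have e1 := hε c x
    have e2 := hε1 x
    rw [hx] at e1
    have : ε x = 0 := by linarith
    rw [this] at e2; norm_num at e2
  have horb : ∀ a b c : C, (∀ d, d = a ∨ d = b ∨ d = c) → (∀ x, r c x ∈ orb (r a) (r b) x) →
      ∀ x, x ∈ orb (r a) (r b) f := by
    intro a b c hC h1 x
    have hx := hf x
    induction hx with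
    | refl => exact orb_self _ _ _
    | tail _ hs ih =>
      obtain ⟨d, _, rfl⟩ := hs
      rcases hC d with rfl | rfl | rfl
      · exact orb_A ih
      · exact orb_B ih
      · exact orb_trans ih (h1 _)
  by_cases hall : ∀ x, x = f ∨ x = r c f
  · have hrf : ∀ d, r d f = r c f := fun d => (hall _).resolve_left (hfree d f)
    exact eucAt_pillow h a b c hab hac hbc hC f (r c f) (hfree c f).symm hrf
      (fun d => by rw [← hrf d, hr]) hall z
  · push Not at hall
    obtain ⟨f2, hf2, hf2'⟩ := hall
    exact (no_crystal hr hfree h ε hε1 hε a b c hab hac hbc hC f (horb a b c hC h1)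
      (horb a c b (fun d => by have := hC d; tauto) h2)
      (horb b c a (fun d => by have := hC d; tauto) h3) f2 hf2 hf2' hE).elim

theorem eucAt_three_bip {C : Type} [Fintype C] (hcard : Fintype.card C = 3) (k : ℕ) :
    ∀ (Φ Y : Type) [TopologicalSpace Y] [Finite Φ] (r : C → Φ → Φ) (q : Φ → Orth C → Y)
    (_ : ∀ c f, r c (r c f) = f) (_ : Pres r zset q) (ε : Φ → ℤ) (_ : ∀ x, ε x * ε x = 1)
    (_ : ∀ d x, ε (r d x) = - ε x) (_ : Nat.card Φ ≤ k)
    (_ : ∀ z : Y × ℝ, EucAt 4 z) (z : Y), EucAt 3 z := by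
  have hC3 : ∀ a b c : C, a ≠ b → a ≠ c → b ≠ c → ∀ d, d = a ∨ d = b ∨ d = c := by
    intro a b c hab hac hbc d
    have h1 : ({a, b, c} : Finset C) = Finset.univ :=
      Finset.eq_univ_of_card _ (by rw [Finset.card_eq_three.2 ⟨a, b, c, hab, hac, hbc, rfl⟩, hcard])
    have := Finset.mem_univ d
    rw [← h1] at this
    simpa using this
  induction k with
  | zero =>
    intro Φ Y _ _ r q hr h ε hε1 hε hk hE z
    obtain ⟨f, _, _⟩ := h.surj z
    have : Nonempty Φ := ⟨f⟩
    have := Nat.card_pos (α := Φ)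
    omega
  | succ k ih =>
    intro Φ Y _ _ r q hr h ε hε1 hε hk hE z
    have hfree : ∀ c f, r c f ≠ f := by
      intro c x hx
      have e1 := hε c x
      have e2 := hε1 x
      rw [hx] at e1
      have : ε x = 0 := by linarith
      rw [this] at e2; norm_num at e2
    by_cases hdip : ∃ a b c : C, a ≠ b ∧ a ≠ c ∧ b ≠ c ∧ ∃ f, r c f ∉ orb (r a) (r b) f
    · obtain ⟨a, b, c, hab, hac, hbc, f, hfg⟩ := hdip
      have hC := hC3 a b c hab hac hbc
      obtain ⟨g, hg⟩ : ∃ g, g = r c f := ⟨_, rfl⟩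
      rw [← hg] at hfg
      have hf : f = r c g := by rw [hg, hr]
      have hgf : f ∉ orb (r a) (r b) g := fun hh => hfg (orb_symm (hr a) (hr b) hh)
      have hfgne : f ≠ g := by rw [hg]; exact (hfree c f).symm
      have hAf : ∀ d, d ≠ c → r d f ≠ g := by
        intro d hd e
        apply hfg
        rw [← e]
        rcases hC d with rfl | rfl | rfl
        · exact orb_A (orb_self _ _ _)
        · exact orb_B (orb_self _ _ _)
        · exact absurd rfl hd
      have hAg : ∀ d, d ≠ c → r d g ≠ f := by
        intro d hd e
        apply hAf d hd
        rw [← e, hr]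
      have hdc : ∀ d x, x ≠ f → x ≠ g → (r d x = f ∨ r d x = g) → d ≠ c := by
        rintro d x h1 h2 h3 rfl
        rcases h3 with h3 | h3
        · apply h2; rw [hg, ← h3, hr]
        · apply h1; rw [hf, ← h3, hr]
      let r' : C → {x : Φ // x ≠ f ∧ x ≠ g} → {x : Φ // x ≠ f ∧ x ≠ g} := fun d x =>
        ⟨if r d x = f then r d g else if r d x = g then r d f else r d x, by
          split_ifs with h1 h2
          · exact ⟨hAg d (hdc d x x.2.1 x.2.2 (Or.inl h1)), hfree d g⟩
          · exact ⟨hfree d f, hAf d (hdc d x x.2.1 x.2.2 (Or.inr h2))⟩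
          · exact ⟨h1, h2⟩⟩
      have hr'v : ∀ d x, (r' d x : Φ) =
        if r d x = f then r d g else if r d x = g then r d f else r d x := fun d x => rfl
      have hr' : ∀ d x, r' d (r' d x) = x := by
        intro d x
        apply Subtype.ext
        rw [hr'v d (r' d x), hr'v d x]
        by_cases h1 : r d x = f
        · rw [if_pos h1, hr, if_neg hfgne.symm, if_pos rfl]
          have h3 := congrArg (r d) h1
          rw [hr] at h3
          exact h3.symm
        · rw [if_neg h1]
          by_cases h2 : r d x = g
          · rw [if_pos h2, hr, if_pos rfl]
            have h3 := congrArg (r d) h2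
            rw [hr] at h3
            exact h3.symm
          · rw [if_neg h2, hr, if_neg x.2.1, if_neg x.2.2]
      have hεg : ε g = - ε f := by rw [hg, hε]
      have hε' : ∀ d x, ε (r' d x : Φ) = - ε (x : Φ) := by
        intro d x
        have h0 := hε d x
        rw [hr'v d x]
        split_ifs with h1 h2
        · rw [hε, hεg, ← h0, h1]; ring
        · rw [hε, ← h0, h2, hεg]
        · exact h0
      have hP := pres_canonical r' hr' (zset (C := C)) isClosed_zset
      obtain ⟨e⟩ := dipole_homeo hr hfree h a b c hab hac hbc hC f g hg hfg hr'v hP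
      have hlt : Nat.card {x : Φ // x ≠ f ∧ x ≠ g} < Nat.card Φ := by
        have : ∃ x : Φ, ¬ (x ≠ f ∧ x ≠ g) := ⟨f, by simp⟩
        exact Finite.card_subtype_lt this.choose_spec
      refine EucAt.of_oph e.toOpenPartialHomeomorph (by simp) ?_
      refine ih _ _ r' _ hr' hP (fun x => ε x) (fun x => hε1 x) hε' (by omega) ?_ _
      intro w
      refine EucAt.of_oph (e.symm.prodCongr (Homeomorph.refl ℝ)).toOpenPartialHomeomorph (by simp) ?_
      exact hE _
    · push Not at hdip
      obtain ⟨a, b, c, hab, hac, hbc, _⟩ := Finset.card_eq_three.1 (Finset.card_univ.trans hcard)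
      have hC := hC3 a b c hab hac hbc
      obtain ⟨f, y, rfl⟩ := h.surj z
      obtain ⟨hop, hP⟩ := h.restrictFlags (fullOrb r f) (fullOrb_iff hr f)
      refine (EucAt.of_openEmbedding hop.isOpenEmbedding_subtypeVal ⟨q f y, f, conn.refl f, y, rfl⟩).2 ?_
      have hor : ∀ a b (x y : fullOrb r f), y.1 ∈ orb (r a) (r b) x.1 →
          y ∈ orb (fun x : fullOrb r f => (⟨r a x, (fullOrb_iff hr f a x).1 x.2⟩ : fullOrb r f))
          (fun x => (⟨r b x, (fullOrb_iff hr f b x).1 x.2⟩ : fullOrb r f)) x := by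
        intro a b x y hy
        obtain ⟨y, hyO⟩ := y
        dsimp only at hy
        unfold orb at hy
        induction hy with
        | refl => exact orb_self _ _ _
        | @tail u v _ hs ih =>
          rcases hs with rfl | rfl
          · exact orb_A (ih ((fullOrb_iff hr f a u).2 hyO))
          · exact orb_B (ih ((fullOrb_iff hr f b u).2 hyO))
      refine eucAt_nodipole (fun c x => Subtype.ext (hr c x)) hP (fun x => ε x) (fun x => hε1 x)
        (fun d x => hε d x) a b c hab hac hbc hC ⟨f, conn.refl f⟩ ?_ ?_ ?_ ?_ ?_ _
      · rintro ⟨x, hx⟩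
        have hx' := hx
        induction hx' with
        | refl => exact conn.refl _
        | @tail u v h1 hs ih =>
          obtain ⟨d, _, rfl⟩ := hs
          exact (ih h1).trans (conn.step (mem_univ d) _)
      · exact fun x => hor _ _ _ _ (hdip a b c hab hac hbc x.1)
      · exact fun x => hor _ _ _ _ (hdip a c b hac hab hbc.symm x.1)
      · exact fun x => hor _ _ _ _ (hdip b c a hbc hab.symm hac.symm x.1)
      · intro w
        have := (EucAt.of_openEmbedding (n := 4)
          (hop.isOpenEmbedding_subtypeVal.prodMap (IsOpenEmbedding.id (X := ℝ))) w).1 (hE _)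
        exact this

end GlueAux

namespace GlueAux
open Set Filter Topology

theorem exists_flip (m : ℕ) (i : Fin m) : ∃ R : Eu m →L[ℝ] Eu m, (∀ x, ‖R x‖ = ‖x‖) ∧ R.det = -1 ∧
    ∀ x j, (R x) j = if j = i then - x j else x j := by
  let M : Matrix (Fin m) (Fin m) ℝ := Matrix.diagonal (fun j => if j = i then -1 else 1)
  have hv : ∀ x j, (Matrix.toEuclideanLin M x) j = if j = i then - x j else x j := by
    intro x j
    rw [Matrix.toLpLin_apply]
    simp only [M, Matrix.mulVec_diagonal]
    split_ifs <;> simp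
  refine ⟨LinearMap.toContinuousLinearMap (Matrix.toEuclideanLin M), ?_, ?_, ?_⟩
  · intro x
    rw [EuclideanSpace.norm_eq, EuclideanSpace.norm_eq]
    congr 1
    refine Finset.sum_congr rfl fun j _ => ?_
    rw [LinearMap.coe_toContinuousLinearMap', hv]
    split_ifs <;> simp
  · rw [LinearMap.det_toContinuousLinearMap, Matrix.toEuclideanLin_eq_toLin_orthonormal,
      LinearMap.det_toLin, Matrix.det_diagonal]
    simp
  · intro x j
    exact hv x j

section bip
variable {C Φ Y : Type*} [TopologicalSpace Y] {r : C → Φ → Φ} {q : Φ → Orth C → Y}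

/-- Splitting off the last coordinate. -/
def coordSplit {m : ℕ} (κ : Fin m ≃ Option C) : Eu m ≃ₜ (C → ℝ) × ℝ where
  toFun x := (fun d => x (κ.symm (some d)), x (κ.symm none))
  invFun p := WithLp.toLp 2 (fun i => (κ i).elim p.2 p.1)
  left_inv x := by
    ext i
    show (κ i).elim (x (κ.symm none)) (fun d => x (κ.symm (some d))) = x i
    rcases h : κ i with _ | d
    · show x (κ.symm none) = x i
      rw [← h, Equiv.symm_apply_apply]
    · show x (κ.symm (some d)) = x i
      rw [← h, Equiv.symm_apply_apply]
  right_inv p := by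
    apply Prod.ext
    · funext d
      show (κ (κ.symm (some d))).elim p.2 p.1 = p.1 d
      rw [Equiv.apply_symm_apply]; rfl
    · show (κ (κ.symm none)).elim p.2 p.1 = p.2
      rw [Equiv.apply_symm_apply]; rfl
  continuous_toFun := by fun_prop
  continuous_invFun := by
    refine (PiLp.continuous_toLp 2 _).comp (continuous_pi fun i => ?_)
    rcases κ i with _ | d
    · exact continuous_snd
    · exact (continuous_apply d).comp continuous_fst

theorem abs_coord_le {m : ℕ} (x : Eu m) (i : Fin m) : |x i| ≤ ‖x‖ := by
  have := PiLp.norm_apply_le x i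
  simpa using this

/-- The point of the double chart with moving centre. -/
def mvPt (s τ δ : ℝ) (c : C) (x : C → ℝ) : C → ℝ := fun d => (if d = c then τ * s else s) + δ * x d

theorem no_odd [Finite Φ] [Fintype C] {k : ℕ} (hk : Fintype.card C = k)
    (hk0 : 1 ≤ k) (hr : ∀ c f, r c (r c f) = f)
    (hfree : ∀ c f, r c f ≠ f) (h : Pres r zset q) (hE : ∀ z : Y × ℝ, EucAt (k + 1) z) (f0 : Φ) :
    ¬ conn (fun c (p : Φ × ℤ) => (r c p.1, - p.2)) univ (f0, 1) (f0, -1) := by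
  intro hodd
  have hco : Fintype.card (Option C) = k + 1 := by rw [Fintype.card_option, hk]
  let κ : Fin (k + 1) ≃ Option C := (Fintype.equivFinOfCardEq hco).symm
  let L := coordSplit κ
  have hL1 : ∀ x d, (L x).1 d = x (κ.symm (some d)) := fun x d => rfl
  have hL2 : ∀ x, (L x).2 = x (κ.symm none) := fun x => rfl
  obtain ⟨ψ, hψ⟩ := hE (q f0 ⟨fun _ => 0, fun _ => le_rfl⟩, 0)
  set o : Orth C := ⟨fun _ => 0, fun _ => le_rfl⟩ with ho
  have hapex : ∀ f, conn r univ f0 f → q f o = q f0 o := by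
    intro f hf
    refine ((h.ker _ _ _ _).2 ⟨rfl, ?_⟩).symm
    exact hf.mono fun c _ => mem_zset.2 rfl
  -- a uniform size
  obtain ⟨s, hs, hsrc⟩ : ∃ s : ℝ, 0 < s ∧ ∀ f, conn r univ f0 f → ∀ (y : Orth C) (t : ℝ),
      (∀ d, y.1 d ≤ 2 * s) → |t| ≤ s → (q f y, t) ∈ ψ.source := by
    have h1 : ∀ f, conn r univ f0 f → ∀ᶠ p : Orth C × ℝ in 𝓝 (o, 0), (q f p.1, p.2) ∈ ψ.source := by
      intro f hf
      have hc : Continuous fun p : Orth C × ℝ => (q f p.1, p.2) :=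
        ((h.cont f).comp continuous_fst).prodMk continuous_snd
      refine hc.continuousAt.preimage_mem_nhds (ψ.open_source.mem_nhds ?_)
      simp only [hapex f hf]
      exact hψ
    have h2 : ∀ᶠ p : Orth C × ℝ in 𝓝 (o, 0), ∀ f, conn r univ f0 f → (q f p.1, p.2) ∈ ψ.source := by
      rw [eventually_all]
      intro f
      by_cases hf : conn r univ f0 f
      · filter_upwards [h1 f hf] with p hp _ using hp
      · exact Eventually.of_forall fun p h => absurd h hf
    obtain ⟨ρ, hρ, hb⟩ := Metric.eventually_nhds_iff.1 h2
    refine ⟨ρ / 3, by positivity, fun f hf y t hy ht => ?_⟩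
    refine hb (y := (y, t)) ?_ f hf
    rw [Prod.dist_eq, max_lt_iff]
    constructor
    · rw [Subtype.dist_eq, dist_pi_lt_iff hρ]
      intro d
      rw [Real.dist_eq, ho]
      simp only [sub_zero]
      rw [abs_of_nonneg (y.2 d)]
      linarith [hy d]
    · simp only [Real.dist_eq, sub_zero]
      linarith
  obtain ⟨c0⟩ : Nonempty C := Fintype.card_pos_iff.1 (by omega)
  -- the chart at the centre of the chamber `f0`
  let Uc : Set (C → ℝ) := {y | ∀ d, d ≠ c0 → 0 < y d}
  have hUo : IsOpen Uc := by
    have : Uc = ⋂ d : {d // d ≠ c0}, {y | 0 < y d.1} := by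
      ext y; simp [Uc]
    rw [this]
    exact isOpen_iInter_of_finite fun d => isOpen_lt continuous_const (continuous_apply _)
  have hj := (dbl_openEmbedding hr hfree h f0 c0).prodMap (IsOpenEmbedding.id (X := ℝ))
  have hv := hUo.isOpenEmbedding_subtypeVal.prodMap (IsOpenEmbedding.id (X := ℝ))
  let bs : Eu (k + 1) := L.symm (fun _ => s, 0)
  have hbs : L bs = (fun _ => s, 0) := L.apply_symm_apply _
  have : Nonempty (Uc × ℝ) := ⟨(⟨fun _ => s, fun _ _ => hs⟩, 0)⟩
  let H : OpenPartialHomeomorph (Eu (k+1)) (Eu (k+1)) :=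
    ((((Homeomorph.addLeft bs).toOpenPartialHomeomorph.trans L.toOpenPartialHomeomorph).trans
    (hv.toOpenPartialHomeomorph _).symm).trans (hj.toOpenPartialHomeomorph _)).trans ψ
  have hLadd : ∀ x y, L (x + y) = L x + L y := fun x y => rfl
  have hLsm : ∀ (a : ℝ) x, L (a • x) = a • L x := fun x y => rfl
  have hHv : ∀ x : Eu (k+1), (∀ d, 0 ≤ s + (L x).1 d) → (∀ d, d ≠ c0 → 0 < s + (L x).1 d) → 
      ∃ y : Uc × ℝ, (hv.toOpenPartialHomeomorph _).symm (L (bs + x)) = y ∧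
        L (bs + x) ∈ range (Prod.map (Subtype.val : Uc → C → ℝ) (id : ℝ → ℝ)) ∧
        y.1.1 = (fun d => s + (L x).1 d) ∧ y.2 = (L x).2 := by
    intro x hx0 hx
    let y : Uc × ℝ := (⟨fun d => s + (L x).1 d, hx⟩, (L x).2)
    have hy : L (bs + x) = Prod.map (Subtype.val : Uc → C → ℝ) (id : ℝ → ℝ) y := by
      rw [hLadd, hbs]
      simp only [y, Prod.map]
      apply Prod.ext
      · rfl
      · simp
    refine ⟨y, ?_, ⟨y, hy.symm⟩, rfl, rfl⟩
    rw [hy]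
    exact IsOpenEmbedding.toOpenPartialHomeomorph_left_inv _ hv
  have hHval : ∀ x : Eu (k+1), ∀ hx : (∀ d, 0 ≤ s + (L x).1 d), (∀ d, d ≠ c0 → 0 < s + (L x).1 d) → 
      H x = ψ (q f0 ⟨fun d => s + (L x).1 d, hx⟩, (L x).2) := by
    intro x hx0 hx
    obtain ⟨y, hy, _, hy1, hy2⟩ := hHv x hx0 hx
    have e1 : H x = ψ (hj.toOpenPartialHomeomorph _
        ((hv.toOpenPartialHomeomorph _).symm (L (bs + x)))) := rfl
    rw [e1, hy, IsOpenEmbedding.toOpenPartialHomeomorph_apply]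
    simp only [Prod.map, id, hy1, hy2]
    rw [← dbl_orth (r := r) (q := q) f0 c0]
  have hH0 : (0 : Eu (k+1)) ∈ H.source := by
    have e0 : ∀ d, (L 0).1 d = 0 := fun d => rfl
    obtain ⟨y, hy, hyr, hy1, hy2⟩ := hHv 0 (fun d => by rw [e0]; linarith)
      (fun d _ => by rw [e0]; linarith)
    simp only [H, OpenPartialHomeomorph.trans_source, mem_inter_iff, mem_preimage]
    refine ⟨⟨⟨⟨by simp, by simp⟩, ?_⟩, ?_⟩, ?_⟩
    · simpa using hyr
    · simp
    · show hj.toOpenPartialHomeomorph _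
        ((hv.toOpenPartialHomeomorph _).symm (L (bs + 0))) ∈ ψ.source
      rw [hy, IsOpenEmbedding.toOpenPartialHomeomorph_apply]
      simp only [Prod.map, id, hy1, hy2]
      have : (fun d => s + (L 0).1 d) = (⟨fun _ => s, fun _ => hs.le⟩ : Orth C).1 := by
        funext d; simp [e0]
      rw [this, dbl_orth]
      refine hsrc f0 (conn.refl _) _ _ (fun d => by simp; linarith) ?_
      show |(L 0).2| ≤ s
      have : (L 0).2 = 0 := rfl
      rw [this, abs_zero]; exact hs.le
  obtain ⟨δ0, hδ0, hno⟩ := no_local_reflect (k + 1) (by omega) H hH0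
  obtain ⟨δ, hδ, hδ1, hδ2⟩ : ∃ δ : ℝ, 0 < δ ∧ δ ≤ δ0 ∧ δ < s :=
    ⟨min δ0 (s / 2), lt_min hδ0 (by positivity), min_le_left _ _,
      lt_of_le_of_lt (min_le_right _ _) (by linarith)⟩
  have hsph : ∀ x : Sph (k+1), ‖(x : Eu (k+1))‖ = 1 := fun x => by
    have := x.2; simpa using this
  have hx1 : ∀ x : Sph (k+1), ∀ i, |δ * (x : Eu (k+1)) i| ≤ δ := fun x i => by
    rw [abs_mul, abs_of_pos hδ]
    have := abs_coord_le (x : Eu (k+1)) i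
    rw [hsph] at this
    nlinarith
  -- the maps
  let U : Φ → Eu (k+1) → Eu (k+1) := fun f x =>
    ψ (q f (absO fun d => s + δ * (L x).1 d), δ * (L x).2) - ψ (q f (absO fun _ => s), 0)
  have claim : ∀ p : Φ × ℤ, conn (fun c (p : Φ × ℤ) => (r c p.1, - p.2)) univ (f0, 1) p →
      conn r univ f0 p.1 ∧
      ∃ R : Eu (k+1) →L[ℝ] Eu (k+1), (∀ x, ‖R x‖ = ‖x‖) ∧ R.det = p.2 ∧
      ∃ a b : C(Sph (k+1), Pun (k+1)), (∀ x, (a x : Eu (k+1)) = U f0 x) ∧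
        (∀ x, (b x : Eu (k+1)) = U p.1 (R x)) ∧ a.Homotopic b := by
    have homot : ∀ f c, conn r univ f0 f → ∀ R : Eu (k+1) →L[ℝ] Eu (k+1), (∀ x, ‖R x‖ = ‖x‖) →
        ∀ Rc : Eu (k+1) →L[ℝ] Eu (k+1), (∀ x j, (Rc x) j = if j = κ.symm (some c) then - x j else x j) →
        ∃ a b : C(Sph (k+1), Pun (k+1)), (∀ x, (a x : Eu (k+1)) = U f (R x)) ∧
        (∀ x, (b x : Eu (k+1)) = U (r c f) (Rc (R x))) ∧ a.Homotopic b := by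
      intro f c hf R hR Rc hRc
      have hRx : ∀ x : Sph (k+1), ‖R (x : Eu (k+1))‖ = 1 := fun x => by rw [hR, hsph]
      let Rs : Sph (k+1) → Sph (k+1) := fun x => ⟨R x, by simpa using hRx x⟩
      let m : ℝ → (C → ℝ) → C → ℝ := fun τ x d => (if d = c then τ * s else s) + δ * x d
      have hmc : Continuous fun p : ℝ × (C → ℝ) => m p.1 p.2 := by
        refine continuous_pi fun d => ?_
        by_cases hd : d = c
        · simp only [m, if_pos hd]; fun_prop
        · simp only [m, if_neg hd]; fun_prop
      have hm : ∀ τ : ℝ, |τ| ≤ 1 → ∀ x : C → ℝ, (∀ d, |δ * x d| ≤ δ) → ∀ t, |t| ≤ s →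
          (dbl r q f c (m τ x), t) ∈ ψ.source ∧ ∀ d, d ≠ c → 0 < m τ x d := by
        intro τ hτ x hx t ht
        constructor
        · have h1 : ∀ d, (absO (m τ x)).1 d ≤ 2 * s := by
            intro d
            rw [absO_val]
            simp only [m]
            refine (abs_add_le _ _).trans ?_
            have := hx d
            have h2 : |if d = c then τ * s else s| ≤ s := by
              split_ifs
              · rw [abs_mul, abs_of_pos hs]; nlinarith
              · rw [abs_of_pos hs]
            linarith
          unfold dbl
          split_ifs
          · exact hsrc f hf _ _ h1 ht
          · exact hsrc _ (hf.trans (conn.step (mem_univ c) f)) _ _ h1 ht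
        · intro d hd
          simp only [m, if_neg hd]
          have := abs_le.1 (hx d)
          linarith
      let G : ℝ → Eu (k+1) → Eu (k+1) := fun τ x =>
        ψ (dbl r q f c (m τ (L x).1), δ * (L x).2) - ψ (dbl r q f c (m τ 0), 0)
      have hm0 : ∀ τ : ℝ, |τ| ≤ 1 → (dbl r q f c (m τ 0), (0 : ℝ)) ∈ ψ.source ∧
          ∀ d, d ≠ c → 0 < m τ 0 d := fun τ hτ => hm τ hτ 0 (fun d => by simpa using hδ.le) 0
          (by simpa using hs.le)
      have hmx : ∀ τ : ℝ, |τ| ≤ 1 → ∀ x : Sph (k+1),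
          (dbl r q f c (m τ (L x).1), δ * (L x).2) ∈ ψ.source ∧
          ∀ d, d ≠ c → 0 < m τ (L x).1 d := fun τ hτ x => hm τ hτ _ (fun d => hx1 x _) _
          ((hx1 x _).trans hδ2.le)
      have hGne : ∀ τ : ℝ, |τ| ≤ 1 → ∀ x : Sph (k+1), G τ x ≠ 0 := by
        intro τ hτ x hG
        have h1 := ψ.injOn (hmx τ hτ x).1 (hm0 τ hτ).1 (sub_eq_zero.1 hG)
        have h2 := (Prod.ext_iff.1 h1).1
        have h3 : δ * (L x).2 = 0 := (Prod.ext_iff.1 h1).2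
        have h4 := (dbl_openEmbedding hr hfree h f c).injective
          (a₁ := ⟨_, (hmx τ hτ x).2⟩) (a₂ := ⟨_, (hm0 τ hτ).2⟩) h2
        have h5 : m τ (L x).1 = m τ 0 := congrArg Subtype.val h4
        have h6 : L x = 0 := by
          apply Prod.ext
          · funext d
            have := congrFun h5 d
            simp only [m, Pi.zero_apply, mul_zero, add_zero] at this
            have h7 : δ * (L x).1 d = 0 := by linarith
            exact (mul_eq_zero.1 h7).resolve_left hδ.ne'
          · exact (mul_eq_zero.1 h3).resolve_left hδ.ne'
        have h8 : (x : Eu (k+1)) = 0 := L.injective (h6.trans rfl)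
        have := hsph x
        rw [h8, norm_zero] at this
        exact zero_ne_one this
      have hτ : ∀ t : unitInterval, |1 - 2 * (t : ℝ)| ≤ 1 := fun t => by
        rw [abs_le]; constructor <;> linarith [t.2.1, t.2.2]
      have hRsc : Continuous Rs := Continuous.subtype_mk (R.continuous.comp continuous_subtype_val) _
      have hFc : Continuous fun p : unitInterval × Sph (k+1) => G (1 - 2 * (p.1 : ℝ)) (Rs p.2) := by
        have hLc : Continuous fun p : unitInterval × Sph (k+1) => L (Rs p.2) :=
          L.continuous.comp (continuous_subtype_val.comp (hRsc.comp continuous_snd))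
        have ht : Continuous fun p : unitInterval × Sph (k+1) => (1 - 2 * (p.1 : ℝ)) := by fun_prop
        refine Continuous.sub ?_ ?_
        · refine ψ.continuousOn.comp_continuous (Continuous.prodMk ?_ ?_)
            (fun p => (hmx _ (hτ p.1) (Rs p.2)).1)
          · exact (continuous_dbl h f c).comp (hmc.comp (ht.prodMk (continuous_fst.comp hLc)))
          · exact continuous_const.mul (continuous_snd.comp hLc)
        · refine ψ.continuousOn.comp_continuous (Continuous.prodMk ?_ continuous_const)
            (fun p => (hm0 _ (hτ p.1)).1)
          exact (continuous_dbl h f c).comp (hmc.comp (ht.prodMk continuous_const))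
      let F : C(unitInterval × Sph (k+1), Pun (k+1)) :=
        ⟨fun p => ⟨G (1 - 2 * (p.1 : ℝ)) (Rs p.2), hGne _ (hτ p.1) _⟩, hFc.subtype_mk _⟩
      let a : C(Sph (k+1), Pun (k+1)) := F.comp ((ContinuousMap.const _ 0).prodMk (ContinuousMap.id _))
      let b : C(Sph (k+1), Pun (k+1)) := F.comp ((ContinuousMap.const _ 1).prodMk (ContinuousMap.id _))
      have hpos : ∀ x : Sph (k+1), ∀ d, 0 ≤ s + δ * (L x).1 d := fun x d => by
        have := abs_le.1 (hx1 x (κ.symm (some d)))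
        rw [hL1]; linarith
      refine ⟨a, b, ?_, ?_, ⟨⟨F, fun x => rfl, fun x => rfl⟩⟩⟩
      · intro x
        show G (1 - 2 * ((0 : unitInterval) : ℝ)) (Rs x) = U f (R x)
        have e1 : m (1 - 2 * ((0 : unitInterval) : ℝ)) 0 = (absO fun _ : C => s).1 := by
          funext d
          rw [absO_val]
          simp [m, abs_of_pos hs]
        have e2 : m (1 - 2 * ((0 : unitInterval) : ℝ)) (L (Rs x)).1 =
            (absO fun d : C => s + δ * (L (Rs x)).1 d).1 := by
          funext d
          rw [absO_val, abs_of_nonneg (hpos (Rs x) d)]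
          simp [m]
        simp only [G]
        rw [e1, e2, dbl_orth, dbl_orth]
      · intro x
        show G (1 - 2 * ((1 : unitInterval) : ℝ)) (Rs x) = U (r c f) (Rc (R x))
        have hRL : ∀ d, (L (Rc (R x))).1 d = if d = c then - (L (Rs x)).1 d else (L (Rs x)).1 d := by
          intro d
          rw [hL1, hRc]
          simp only [EmbeddingLike.apply_eq_iff_eq, Option.some_inj]
          rfl
        have hRL2 : (L (Rc (R x))).2 = (L (Rs x)).2 := by
          rw [hL2, hRc, if_neg (by simp)]
          rfl
        have hpos' : ∀ d, 0 ≤ s + δ * (L (Rc (R x))).1 d := by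
          intro d
          have := abs_le.1 (hx1 (Rs x) (κ.symm (some d)))
          rw [hRL, hL1]
          split_ifs <;> linarith
        have e1 : m (1 - 2 * ((1 : unitInterval) : ℝ)) 0 = flipC c (absO fun _ : C => s).1 := by
          funext d
          unfold flipC
          rw [absO_val, abs_of_pos hs]
          simp only [m]
          split_ifs <;> norm_num
        have e2 : m (1 - 2 * ((1 : unitInterval) : ℝ)) (L (Rs x)).1 =
            flipC c (absO fun d : C => s + δ * (L (Rc (R x))).1 d).1 := by
          funext d
          unfold flipC
          rw [absO_val, abs_of_nonneg (hpos' d), hRL]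
          simp only [m]
          split_ifs <;> norm_num <;> ring
        simp only [G]
        rw [e1, e2, dbl_flip h, dbl_flip h, ← hRL2]
    intro p hp
    induction hp with
    | refl =>
      refine ⟨conn.refl _, ContinuousLinearMap.id ℝ _, fun x => rfl, by simp [ContinuousLinearMap.det], ?_⟩
      obtain ⟨Rc, -, -, hRc⟩ := exists_flip (k+1) (κ.symm (some c0))
      obtain ⟨a, b, ha, hb, hab⟩ := homot f0 c0 (conn.refl _) (ContinuousLinearMap.id ℝ _)
        (fun x => rfl) Rc hRc
      exact ⟨a, a, ha, ha, ContinuousMap.Homotopic.refl _⟩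
    | @tail u v _ hs ih =>
      obtain ⟨c, _, rfl⟩ := hs
      obtain ⟨hf, R, hR, hdet, a, b, ha, hb, hab⟩ := ih
      obtain ⟨Rc, hRcn, hRcd, hRc⟩ := exists_flip (k+1) (κ.symm (some c))
      obtain ⟨a', b', ha', hb', hab'⟩ := homot u.1 c hf R hR Rc hRc
      have e : b = a' := by
        ext x : 1
        apply Subtype.ext
        rw [hb, ha']
      subst e
      refine ⟨hf.trans (conn.step (mem_univ c) _), Rc.comp R, fun x => ?_, ?_, a, b', ha, hb',
        hab.trans hab'⟩
      · show ‖Rc (R x)‖ = _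
        rw [hRcn, hR]
      · have : (Rc.comp R).det = Rc.det * R.det := by
          simp only [ContinuousLinearMap.det, ContinuousLinearMap.toLinearMap_comp, LinearMap.det_comp]
        rw [this, hRcd, hdet]
        simp
  obtain ⟨-, R, hR, hdet, a, b, ha, hb, hab⟩ := claim _ hodd
  have hUH : ∀ x : Eu (k+1), ‖x‖ = 1 → U f0 x = H (δ • x) - H 0 := by
    intro x hx
    have hp : ∀ d, 0 < s + δ * (L x).1 d := by
      intro d
      have := abs_le.1 (hx1 ⟨x, by simpa using hx⟩ (κ.symm (some d)))
      rw [hL1]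
      simp only at this
      linarith
    have e1 := hHval (δ • x) (fun d => (hp d).le) (fun d _ => hp d)
    have e2 := hHval 0 (fun d => by show 0 ≤ s + 0; linarith) (fun d _ => by show 0 < s + 0; linarith)
    rw [e1, e2]
    simp only [U]
    congr 3
    · congr 1
      apply Subtype.ext
      funext d
      rw [absO_val, abs_of_pos (hp d)]
      rfl
    · congr 1
      apply Subtype.ext
      funext d
      rw [absO_val, abs_of_pos hs]
      show s = s + 0
      rw [add_zero]
  refine hno δ hδ hδ1 R hR (by rw [hdet]; simp) a b (fun x => ?_) (fun x => ?_) hab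
  · rw [ha, hUH _ (hsph x)]
  · rw [hb, hUH _ (by rw [hR, hsph])]

end bip

/-- Proposition 7. -/
theorem eucAt_factor {C Φ Y : Type} [TopologicalSpace Y] {r : C → Φ → Φ} {q : Φ → Orth C → Y}
    [Finite Φ] [Fintype C] {m : ℕ} (hm : m = 1 ∨ m = 2 ∨ m = 3) (hcard : Fintype.card C = m)
    (hr : ∀ c f, r c (r c f) = f)
    (hfree : ∀ c f, r c f ≠ f) (h : Pres r zset q) (hE : ∀ z : Y × ℝ, EucAt (m + 1) z) (z : Y) :
    EucAt m z := by
  obtain ⟨f, y, rfl⟩ := h.surj z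
  rcases hm with rfl | rfl | rfl
  · obtain ⟨c, hc⟩ := Fintype.card_eq_one_iff.1 hcard
    exact eucAt_wall hr hfree h hcard f y c (fun d _ => hc d)
  · exact eucAt_two hcard hr hfree h _
  · obtain ⟨hop, hP⟩ := h.restrictFlags (fullOrb r f) (fullOrb_iff hr f)
    let rr : C → Φ × ℤ → Φ × ℤ := fun c p => (r c p.1, - p.2)
    have hrr : ∀ c p, rr c (rr c p) = p := fun c p => by simp [rr, hr]
    have hno : ¬ conn rr univ (f, 1) (f, -1) := no_odd hcard (by omega) hr hfree h hE f
    have hneg : ∀ a b, conn rr univ a b → conn rr univ (a.1, -a.2) (b.1, -b.2) := by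
      intro a b hab
      induction hab with
      | refl => exact conn.refl _
      | @tail u v _ hs ih =>
        obtain ⟨c, hc, rfl⟩ := hs
        exact ih.trans (conn.step hc (u.1, - u.2))
    have hlift : ∀ x, conn r univ f x → conn rr univ (f, 1) (x, 1) ∨ conn rr univ (f, 1) (x, -1) := by
      intro x hx
      induction hx with
      | refl => exact Or.inl (conn.refl _)
      | @tail u v _ hs ih =>
        obtain ⟨c, hc, rfl⟩ := hs
        rcases ih with ih | ih
        · exact Or.inr (ih.trans (conn.step hc (u, 1)))
        · refine Or.inl (ih.trans ?_)
          have := conn.step (r := rr) hc (u, -1)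
          simpa [rr] using this
    have hnot : ∀ x, ¬ (conn rr univ (f, 1) (x, 1) ∧ conn rr univ (f, 1) (x, -1)) := by
      rintro x ⟨h1, h2⟩
      have h3 := hneg _ _ h2
      simp only [neg_neg] at h3
      exact hno (h1.trans (h3.symm hrr))
    let ε : fullOrb r f → ℤ := fun x => if conn rr univ (f, 1) (x, 1) then 1 else -1
    have hstep1 : ∀ d x, conn rr univ (f, 1) (x, 1) → conn rr univ (f, 1) (r d x, -1) :=
      fun d x hx => hx.trans (conn.step (mem_univ d) (x, 1))
    have hstep2 : ∀ d x, conn rr univ (f, 1) (x, -1) → conn rr univ (f, 1) (r d x, 1) := by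
      intro d x hx
      have := conn.step (r := rr) (mem_univ d) (x, -1)
      simp only [rr, neg_neg] at this
      exact hx.trans this
    have key := eucAt_three_bip hcard _ _ _ _ _
      (fun c x => Subtype.ext (hr c x)) hP ε
      (fun x => by simp only [ε]; split_ifs <;> norm_num)
      (fun d x => by
        simp only [ε]
        by_cases hx : conn rr univ (f, 1) (x, 1)
        · rw [if_pos hx, if_neg fun h' => hnot _ ⟨h', hstep1 d x hx⟩]
        · rw [if_neg hx, if_pos (hstep2 d x ((hlift x x.2).resolve_left hx)), neg_neg])
      le_rfl
      (fun z => by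
        have hoe : IsOpenEmbedding (Prod.map (Subtype.val : {y : Y | ∃ f' ∈ fullOrb r f, ∃ a, q f' a = y} → Y)
          (id : ℝ → ℝ)) := hop.isOpenEmbedding_subtypeVal.prodMap IsOpenEmbedding.id
        exact (EucAt.of_openEmbedding hoe z).1 (hE _))
      ⟨q f y, ⟨f, conn.refl f, y, rfl⟩⟩
    exact (EucAt.of_openEmbedding hop.isOpenEmbedding_subtypeVal _).2 key

end GlueAux

namespace GlueAux
open Set Filter Topology

/-! ### Chamber coordinates -/

/-- The vector with prescribed gaps. -/
def tailSum {n : ℕ} (y : Fin (n + 1) → ℝ) : Fin (n + 1) → ℝ := fun c => ∑ d, if c ≤ d then y d else 0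

/-- The gaps of a vector. -/
def gaps {n : ℕ} (x : Fin (n + 1) → ℝ) : Fin (n + 1) → ℝ := fun c =>
  if c = Fin.last n then x c else x c - x (c + 1)

theorem tailSum_last {n : ℕ} (y : Fin (n + 1) → ℝ) : tailSum y (Fin.last n) = y (Fin.last n) := by
  unfold tailSum
  simp [Fin.last_le_iff]

theorem lt_succ_of_ne_last {n : ℕ} {c : Fin (n + 1)} (hc : c ≠ Fin.last n) :
    ((c + 1 : Fin (n + 1)) : ℕ) = c + 1 :=
  Fin.val_add_one_of_lt (Fin.lt_last_iff_ne_last.2 hc)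

theorem tailSum_step {n : ℕ} (y : Fin (n + 1) → ℝ) {c : Fin (n + 1)} (hc : c ≠ Fin.last n) :
    tailSum y c = y c + tailSum y (c + 1) := by
  unfold tailSum
  have h1 := lt_succ_of_ne_last hc
  have : ∀ d, (if c ≤ d then y d else 0) = (if d = c then y d else 0) + (if c + 1 ≤ d then y d else 0) := by
    intro d
    have h2 : c + 1 ≤ d ↔ (c : ℕ) + 1 ≤ d := by rw [Fin.le_def, h1]
    have h3 : c ≤ d ↔ (c : ℕ) ≤ d := Iff.rfl
    have h4 : d = c ↔ (d : ℕ) = c := Fin.ext_iff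
    simp only [h2, h3, h4]
    split_ifs <;> first | omega | simp
  rw [Finset.sum_congr rfl fun d _ => this d, Finset.sum_add_distrib]
  simp

theorem gaps_tailSum {n : ℕ} (y : Fin (n + 1) → ℝ) : gaps (tailSum y) = y := by
  funext c
  unfold gaps
  split_ifs with h
  · rw [h, tailSum_last]
  · rw [tailSum_step y h]; ring

theorem down_induction {n : ℕ} {p : Fin (n + 1) → Prop} (h0 : p (Fin.last n))
    (h1 : ∀ c, c ≠ Fin.last n → p (c + 1) → p c) (c : Fin (n + 1)) : p c := by
  induction c using Fin.reverseInduction with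
  | last => exact h0
  | cast i ih =>
    refine h1 _ (Fin.castSucc_lt_last i).ne ?_
    rwa [Fin.coeSucc_eq_succ]

theorem tailSum_gaps {n : ℕ} (x : Fin (n + 1) → ℝ) : tailSum (gaps x) = x := by
  funext c
  induction c using down_induction with
  | h0 => rw [tailSum_last]; simp [gaps]
  | h1 c hc ih => rw [tailSum_step _ hc, ih]; simp [gaps, hc]

theorem continuous_tailSum {n : ℕ} : Continuous (tailSum (n := n)) := by
  refine continuous_pi fun c => continuous_finsetSum _ fun d _ => ?_
  split_ifs <;> fun_prop

theorem continuous_gaps {n : ℕ} : Continuous (gaps (n := n)) := by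
  refine continuous_pi fun c => ?_
  unfold gaps
  split_ifs <;> fun_prop

theorem gaps_nonneg {n : ℕ} {x : Fin (n + 1) → ℝ} (h0 : ∀ v, 0 ≤ x v) (h1 : Antitone x) (c) :
    0 ≤ gaps x c := by
  unfold gaps
  split_ifs with h
  · exact h0 c
  · have : c ≤ c + 1 := by rw [Fin.le_def, lt_succ_of_ne_last h]; omega
    linarith [h1 this]

theorem tailSum_antitone {n : ℕ} {y : Fin (n + 1) → ℝ} (h0 : ∀ v, 0 ≤ y v) : Antitone (tailSum y) := by
  intro a b hab
  unfold tailSum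
  refine Finset.sum_le_sum fun d _ => ?_
  have := h0 d
  by_cases h1 : b ≤ d
  · rw [if_pos h1, if_pos (hab.trans h1)]
  · rw [if_neg h1]; split_ifs <;> simp [this]

theorem exists_sort {n : ℕ} (x : Fin (n + 1) → ℝ) : ∃ π : Equiv.Perm (Fin (n + 1)), Antitone (x ∘ π) := by
  refine ⟨Tuple.sort (fun v => - x v), ?_⟩
  have := Tuple.monotone_sort (fun v => - x v)
  intro a b hab
  have := this hab
  simp only [Function.comp] at this ⊢
  linarith

theorem unique_sort {n : ℕ} {x : Fin (n + 1) → ℝ} {π ρ : Equiv.Perm (Fin (n + 1))}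
    (h1 : Antitone (x ∘ π)) (h2 : Antitone (x ∘ ρ)) : x ∘ π = x ∘ ρ := by
  have := Tuple.unique_monotone (f := fun v => - x v) (σ := π) (τ := ρ)
    (fun a b hab => neg_le_neg (h1 hab)) (fun a b hab => neg_le_neg (h2 hab))
  funext c
  have := congrFun this c
  simp only [Function.comp] at this ⊢
  linarith

/-! ### The flags -/

section flags
variable {n : ℕ} (D : GlueingDatum n)

/-- Flags of the glueing datum. -/
abbrev Flag : Type := D.I × Equiv.Perm (Fin (n + 1))

instance : Finite (Flag D) := by
  have := D.fintypeI
  infer_instance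

/-- The adjacency of flags. -/
def adj (c : Fin (n + 1)) (f : Flag D) : Flag D :=
  if c = Fin.last n then
    ((D.P (f.1, f.2 (Fin.last n))).1, D.glue (f.1, f.2 (Fin.last n)) * f.2)
  else (f.1, f.2 * Equiv.swap c (c + 1))

theorem adj_last (f : Flag D) : adj D (Fin.last n) f =
    ((D.P (f.1, f.2 (Fin.last n))).1, D.glue (f.1, f.2 (Fin.last n)) * f.2) := if_pos rfl

theorem adj_ne {c : Fin (n + 1)} (hc : c ≠ Fin.last n) (f : Flag D) :
    adj D c f = (f.1, f.2 * Equiv.swap c (c + 1)) := if_neg hc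

theorem adj_adj (c : Fin (n + 1)) (f : Flag D) : adj D c (adj D c f) = f := by
  by_cases hc : c = Fin.last n
  · subst hc
    rw [adj_last D f, adj_last]
    have h1 : (D.glue (f.1, f.2 (Fin.last n)) * f.2) (Fin.last n) = (D.P (f.1, f.2 (Fin.last n))).2 := by
      rw [Equiv.Perm.mul_apply]
      exact D.glue_face (f.1, f.2 (Fin.last n))
    simp only [h1]
    have h2 : ((D.P (f.1, f.2 (Fin.last n))).1, (D.P (f.1, f.2 (Fin.last n))).2) =
      D.P (f.1, f.2 (Fin.last n)) := rfl
    rw [h2, D.P_involutive, D.glue_symm]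
    refine Prod.ext rfl ?_
    ext1 v
    simp [Equiv.Perm.mul_apply]
  · rw [adj_ne D hc f, adj_ne D hc]
    refine Prod.ext rfl ?_
    simp [mul_assoc]

theorem adj_free (c : Fin (n + 1)) (f : Flag D) : adj D c f ≠ f := by
  by_cases hc : c = Fin.last n
  · subst hc
    rw [adj_last D f]
    intro h
    have h1 := congrArg Prod.fst h
    have h2 : D.glue (f.1, f.2 (Fin.last n)) * f.2 = f.2 := congrArg Prod.snd h
    have h3 := congrFun (congrArg DFunLike.coe h2) (Fin.last n)
    rw [Equiv.Perm.mul_apply] at h3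
    have h4 := D.glue_face (f.1, f.2 (Fin.last n))
    simp only at h1 h4
    refine D.P_fixedPointFree (f.1, f.2 (Fin.last n)) (Prod.ext h1 ?_)
    rw [← h4, h3]
  · rw [adj_ne D hc f]
    intro h
    have h2 : f.2 * Equiv.swap c (c + 1) = f.2 := congrArg Prod.snd h
    have h3 := Equiv.swap_eq_one_iff.1 (mul_eq_left.1 h2)
    have := lt_succ_of_ne_last hc
    rw [← h3] at this
    omega

theorem conn_of_stab {X : Fin (n + 1) → ℝ} (hX : Antitone X) (i : D.I) (ρ : Equiv.Perm (Fin (n + 1)))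
    (hρ : X ∘ ρ = X) (π : Equiv.Perm (Fin (n + 1))) :
    conn (adj D) {c | gaps X c = 0} (i, π) (i, π * ρ) := by
  let Q : Equiv.Perm (Fin (n + 1)) → Prop := fun ρ =>
    ∀ π, conn (adj D) {c | gaps X c = 0} (i, π) (i, π * ρ)
  have hmul : ∀ a b, Q a → Q b → Q (a * b) := fun a b ha hb π => by
    rw [← mul_assoc]
    exact (ha π).trans (hb _)
  have hadj : ∀ c, c ≠ Fin.last n → X c = X (c + 1) → Q (Equiv.swap c (c + 1)) := by
    intro c hc hXc π
    have := conn.step (r := adj D) (T := {c | gaps X c = 0}) (c := c)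
      (by show gaps X c = 0; unfold gaps; rw [if_neg hc, hXc, sub_self]) (i, π)
    rwa [adj_ne D hc] at this
  have hswap : ∀ k : ℕ, ∀ a b : Fin (n + 1), (b : ℕ) = a + k + 1 → X a = X b → Q (Equiv.swap a b) := by
    intro k
    induction k with
    | zero =>
      intro a b hb hab
      have ha : a ≠ Fin.last n := by
        intro h; have := b.2; rw [h] at hb; simp at hb; omega
      have : b = a + 1 := by
        apply Fin.ext; rw [lt_succ_of_ne_last ha, hb]
      rw [this] at hab ⊢
      exact hadj a ha hab
    | succ k ih =>
      intro a b hb hab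
      have ha : a ≠ Fin.last n := by
        intro h; have := b.2; rw [h] at hb; simp at hb; omega
      have h1 := lt_succ_of_ne_last ha
      have h2 : X a = X (a + 1) := by
        apply le_antisymm
        · rw [hab]; exact hX (by rw [Fin.le_def, h1]; omega)
        · exact hX (by rw [Fin.le_def, h1]; omega)
      have h3 := ih (a + 1) b (by rw [h1]; omega) (by rw [← h2, hab])
      have h4 := hadj a ha h2
      have hne1 : a ≠ b := fun h => by rw [h] at hb; omega
      have hne2 : a + 1 ≠ b := fun h => by rw [← h, h1] at hb; omega
      have h5 : Equiv.swap a b = Equiv.swap a (a + 1) * Equiv.swap (a + 1) b * Equiv.swap a (a + 1) := by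
        have := Equiv.swap_mul_swap_mul_swap (x := b) (y := a + 1) (z := a) hne2.symm hne1.symm
        rw [Equiv.swap_comm (a + 1) b, Equiv.swap_comm a (a + 1)]
        exact this.symm
      rw [h5]
      exact hmul _ _ (hmul _ _ h4 h3) h4
  have hswap' : ∀ a b : Fin (n + 1), X a = X b → Q (Equiv.swap a b) := by
    intro a b hab
    rcases lt_trichotomy (a : ℕ) b with h | h | h
    · exact hswap (b - a - 1) a b (by omega) hab
    · rw [Fin.ext h, Equiv.swap_self]
      intro π
      exact conn.refl _
    · rw [Equiv.swap_comm]
      exact hswap (a - b - 1) b a (by omega) hab.symm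
  have main : ∀ k : ℕ, ∀ ρ : Equiv.Perm (Fin (n + 1)), ρ.support.card ≤ k → X ∘ ρ = X → Q ρ := by
    intro k
    induction k with
    | zero =>
      intro ρ h _ π
      have : ρ = 1 := Equiv.Perm.support_eq_empty_iff.1 (Finset.card_eq_zero.1 (Nat.le_zero.1 h))
      rw [this, mul_one]
      exact conn.refl _
    | succ k ih =>
      intro ρ h hρ
      by_cases h1 : ρ = 1
      · intro π
        rw [h1, mul_one]
        exact conn.refl _
      · obtain ⟨a, ha⟩ : ∃ a, ρ a ≠ a := by
          by_contra hcon
          push Not at hcon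
          exact h1 (Equiv.ext hcon)
        have hXa : X a = X (ρ a) := (congrFun hρ a).symm
        have hsw : X ∘ Equiv.swap a (ρ a) = X := by
          funext v
          simp only [Function.comp, Equiv.swap_apply_def]
          split_ifs with h2 h3
          · rw [h2, hXa]
          · rw [h3, hXa]
          · rfl
        have h2 := ih (Equiv.swap a (ρ a) * ρ)
          (by have := Equiv.Perm.card_support_swap_mul ha; omega)
          (by rw [Equiv.Perm.coe_mul, ← Function.comp_assoc, hsw, hρ])
        have h3 : ρ = Equiv.swap a (ρ a) * (Equiv.swap a (ρ a) * ρ) := by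
          rw [← mul_assoc, Equiv.swap_mul_self, one_mul]
        rw [h3]
        exact hmul _ _ (hswap' _ _ hXa) h2
  exact main _ ρ le_rfl hρ π

end flags

/-! ### The presentation of the glued space -/

section glue
variable {n : ℕ} (D : GlueingDatum n) (p : (Fin (n + 1) → ℝ) → Prop)

/-- The glueing relation on simplices cut by an invariant condition. -/
def relP : (Σ _ : D.I, {x : Fin (n + 1) → ℝ // p x}) → (Σ _ : D.I, {x : Fin (n + 1) → ℝ // p x}) → Prop :=
  fun a b => ∃ k : Fin (n + 1), a.2.1 k = 0 ∧ (D.P (a.1, k)).1 = b.1 ∧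
    (b.2.1 : Fin (n + 1) → ℝ) = a.2.1 ∘ ⇑(D.glue (a.1, k)).symm

/-- The model chamber. -/
abbrev Cham : Type := {y : Orth (Fin (n + 1)) // p (tailSum y.1)}

variable {p} (hp : ∀ x, p x → ∀ π : Equiv.Perm (Fin (n + 1)), p (x ∘ π))

/-- The point of the disjoint union. -/
def totPt (f : Flag D) (a : Cham p) : Σ _ : D.I, {x : Fin (n + 1) → ℝ // p x} :=
  ⟨f.1, tailSum a.1.1 ∘ f.2.symm, hp _ a.2 _⟩

/-- The chamber map. -/
def glueMk (f : Flag D) (a : Cham p) : Quot (relP D p) := Quot.mk _ (totPt D hp f a)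

theorem exists_totPt (h0 : ∀ x, p x → ∀ v, 0 ≤ x v) (z : Σ _ : D.I, {x : Fin (n + 1) → ℝ // p x})
    (π : Equiv.Perm (Fin (n + 1))) (hπ : Antitone (z.2.1 ∘ π)) :
    ∃ a : Cham p, z = totPt D hp (z.1, π) a ∧ a.1.1 = gaps (z.2.1 ∘ π) := by
  obtain ⟨i, x, hx⟩ := z
  refine ⟨⟨⟨gaps (x ∘ π), gaps_nonneg (h0 _ (hp _ hx _)) hπ⟩, ?_⟩, ?_, rfl⟩
  · rw [tailSum_gaps]; exact hp _ hx _
  · unfold totPt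
    simp only [tailSum_gaps]
    congr 2
    funext v
    simp

theorem totPt_sorted (f : Flag D) (a : Cham p) : (totPt D hp f a).2.1 ∘ f.2 = tailSum a.1.1 := by
  funext v
  simp [totPt]

/-- The canonical quotient. -/
abbrev ChamQuot : Type := PresQuot (adj D) (adj_adj D) (fun a : Cham p => zset a.1)

theorem presMk_eq (f g : Flag D) (a b : Cham p) (h : a = b) (hc : conn (adj D) (zset a.1) f g) :
    presMk (adj D) (adj_adj D) (fun a : Cham p => zset a.1) f a =
    presMk (adj D) (adj_adj D) (fun a : Cham p => zset a.1) g b :=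
  Quotient.sound ⟨h, hc⟩

theorem totPt_conn {f g : Flag D} {a b : Cham p} (h : totPt D hp f a = totPt D hp g b) :
    a = b ∧ conn (adj D) (zset a.1) f g := by
  have h1 := totPt_sorted D hp f a
  have h2 := totPt_sorted D hp g b
  rw [h] at h1
  have hs1 : Antitone ((totPt D hp g b).2.1 ∘ f.2) := h1 ▸ tailSum_antitone a.1.2
  have hs2 : Antitone ((totPt D hp g b).2.1 ∘ g.2) := h2 ▸ tailSum_antitone b.1.2
  have hu := unique_sort hs1 hs2
  have hab : tailSum a.1.1 = tailSum b.1.1 := by rw [← h1, ← h2, hu]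
  have hab' : a.1.1 = b.1.1 := by rw [← gaps_tailSum a.1.1, hab, gaps_tailSum]
  have hi : f.1 = g.1 := congrArg Sigma.fst h
  refine ⟨Subtype.ext (Subtype.ext hab'), ?_⟩
  have key := conn_of_stab D (tailSum_antitone a.1.2) f.1 (f.2⁻¹ * g.2) (by
    rw [← h1, Function.comp_assoc, ← Equiv.Perm.coe_mul, mul_inv_cancel_left, ← hu]) f.2
  rw [mul_inv_cancel_left] at key
  have e1 : {c | gaps (tailSum a.1.1) c = 0} = zset a.1 := by
    rw [gaps_tailSum]; rfl
  rw [e1] at key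
  have e2 : (f.1, g.2) = g := by rw [hi]
  rwa [e2] at key

/-- The comparison map. -/
theorem exists_compare (h0 : ∀ x, p x → ∀ v, 0 ≤ x v) : ∃ Θ : Quot (relP D p) → ChamQuot D (p := p),
    ∀ f a, Θ (glueMk D hp f a) = presMk (adj D) (adj_adj D) (fun a : Cham p => zset a.1) f a := by
  have hex : ∀ z : Σ _ : D.I, {x : Fin (n + 1) → ℝ // p x}, ∃ fa : Flag D × Cham p,
      z = totPt D hp fa.1 fa.2 := by
    intro z
    obtain ⟨π, hπ⟩ := exists_sort z.2.1
    obtain ⟨a, ha, _⟩ := exists_totPt D hp h0 z π hπ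
    exact ⟨((z.1, π), a), ha⟩
  choose s hs using hex
  let θ : (Σ _ : D.I, {x : Fin (n + 1) → ℝ // p x}) → ChamQuot D (p := p) := fun z =>
    presMk (adj D) (adj_adj D) (fun a : Cham p => zset a.1) (s z).1 (s z).2
  have hθ : ∀ f a, θ (totPt D hp f a) =
      presMk (adj D) (adj_adj D) (fun a : Cham p => zset a.1) f a := by
    intro f a
    obtain ⟨h1, h2⟩ := totPt_conn D hp (hs (totPt D hp f a))
    exact (presMk_eq D _ _ _ _ h1 h2).symm
  refine ⟨Quot.lift θ ?_, fun f a => hθ f a⟩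
  rintro z w ⟨k, hk, hP, hw⟩
  obtain ⟨π, hπ⟩ := exists_sort z.2.1
  -- arrange that the last entry is `k`
  obtain ⟨π', hπ', hlast⟩ : ∃ π' : Equiv.Perm (Fin (n + 1)), Antitone (z.2.1 ∘ π') ∧
      π' (Fin.last n) = k := by
    refine ⟨π * Equiv.swap (Fin.last n) (π.symm k), ?_, by simp⟩
    have h1 : z.2.1 (π (Fin.last n)) = z.2.1 k := by
      apply le_antisymm
      · have := hπ (Fin.le_last (π.symm k))
        simpa using this
      · rw [hk]; exact h0 _ z.2.2 _
    have : z.2.1 ∘ ⇑(π * Equiv.swap (Fin.last n) (π.symm k)) = z.2.1 ∘ π := by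
      funext v
      simp only [Function.comp, Equiv.Perm.mul_apply, Equiv.swap_apply_def]
      split_ifs with h2 h3
      · rw [h2, h1]; simp
      · rw [h3, h1]; simp
      · rfl
    rw [this]; exact hπ
  obtain ⟨a, ha, hag⟩ := exists_totPt D hp h0 z π' hπ'
  have hw' : w = totPt D hp (adj D (Fin.last n) (z.1, π')) a := by
    rw [adj_last]
    obtain ⟨i, x, hx⟩ := z
    obtain ⟨j, y, hy⟩ := w
    simp only at hP hw hlast hag ⊢
    subst hP
    unfold totPt
    rw [hlast]
    congr 2
    rw [hag, tailSum_gaps, hw]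
    funext v
    simp [Equiv.Perm.mul_def]
  rw [hw', hθ]
  conv_lhs => rw [ha]
  rw [hθ]
  refine presMk_eq D _ _ _ _ rfl (conn.step ?_ _)
  rw [mem_zset, hag]
  simp [gaps, hlast, hk]

theorem pres_glue (h0 : ∀ x, p x → ∀ v, 0 ≤ x v) :
    Pres (adj D) (fun a : Cham p => zset a.1) (glueMk D hp) := by
  obtain ⟨Θ, hΘ⟩ := exists_compare D hp h0
  have hstep : ∀ (a : Cham p) (f : Flag D) (c), a.1.1 c = 0 → glueMk D hp f a = glueMk D hp (adj D c f) a := by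
    intro a f c hc
    by_cases hl : c = Fin.last n
    · subst hl
      refine Quot.sound ⟨f.2 (Fin.last n), ?_, ?_, ?_⟩
      · simp [totPt, tailSum_last, hc]
      · rw [adj_last]; rfl
      · rw [adj_last]
        funext v
        simp [totPt, Equiv.Perm.mul_def]
    · unfold glueMk
      congr 1
      rw [adj_ne D hl]
      unfold totPt
      congr 2
      funext v
      have hx : tailSum a.1.1 c = tailSum a.1.1 (c + 1) := by
        rw [tailSum_step _ hl, hc, zero_add]
      simp only [Function.comp, Equiv.Perm.mul_def, Equiv.symm_trans_apply, Equiv.symm_swap,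
        Equiv.swap_apply_def]
      split_ifs with h2 h3
      · rw [h2, hx]
      · rw [h3, hx]
      · rfl
  have hker : ∀ f a g b, glueMk D hp f a = glueMk D hp g b ↔ a = b ∧ conn (adj D) (zset a.1) f g := by
    intro f a g b
    constructor
    · intro h
      have := congrArg Θ h
      rw [hΘ, hΘ] at this
      exact Quotient.exact this
    · rintro ⟨rfl, hc⟩
      induction hc with
      | refl => rfl
      | tail _ hs ih =>
        obtain ⟨c, hc, rfl⟩ := hs
        rw [ih, ← hstep a _ c hc]
  refine ⟨?_, ?_, ?_, hker⟩
  · intro f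
    refine continuous_quot_mk.comp ?_
    refine (continuous_sigmaMk (σ := fun _ : D.I => {x : Fin (n + 1) → ℝ // p x}) (i := f.1)).comp ?_
    refine Continuous.subtype_mk ?_ _
    refine continuous_pi fun v => ?_
    exact (continuous_apply _).comp (continuous_tailSum.comp
      (continuous_subtype_val.comp continuous_subtype_val))
  · intro f K hK
    have hq : IsQuotientMap (Quot.mk (relP D p)) := isQuotientMap_quot_mk
    rw [← hq.isClosed_preimage, isClosed_sigma_iff]
    intro i
    have : (Sigma.mk (β := fun _ : D.I => {x : Fin (n + 1) → ℝ // p x}) i) ⁻¹' (Quot.mk (relP D p) ⁻¹' (glueMk D hp f '' K)) =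
        ⋃ π : Equiv.Perm (Fin (n + 1)), {x | ∃ h : Antitone (x.1 ∘ π), ∃ a ∈ K,
          a.1.1 = gaps (x.1 ∘ π) ∧ conn (adj D) (zset a.1) f (i, π)} := by
      ext x
      simp only [mem_preimage, mem_iUnion, mem_image]
      constructor
      · rintro ⟨a, ha, he⟩
        obtain ⟨π, hπ⟩ := exists_sort x.1
        obtain ⟨b, hb, hbg⟩ := exists_totPt D hp h0 ⟨i, x⟩ π hπ
        rw [hb] at he
        obtain ⟨rfl, h2⟩ := (hker _ _ _ _).1 he
        exact ⟨π, hπ, a, ha, hbg, h2⟩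
      · rintro ⟨π, hπ, a, ha, hag, hc⟩
        obtain ⟨b, hb, hbg⟩ := exists_totPt D hp h0 ⟨i, x⟩ π hπ
        have hab : a = b := Subtype.ext (Subtype.ext (hag.trans hbg.symm))
        refine ⟨a, ha, ?_⟩
        rw [hb]
        exact (hker _ _ _ _).2 ⟨hab, hc⟩
    rw [this]
    refine isClosed_iUnion_of_finite fun π => ?_
    have hA : IsClosed {x : {x : Fin (n + 1) → ℝ // p x} | Antitone (x.1 ∘ π)} := by
      have : {x : {x : Fin (n + 1) → ℝ // p x} | Antitone (x.1 ∘ π)} =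
          ⋂ (a : Fin (n+1)) (b : Fin (n + 1)) (_ : a ≤ b), {x | x.1 (π b) ≤ x.1 (π a)} := by
        ext x; simp [Antitone]
      rw [this]
      refine isClosed_iInter fun a => isClosed_iInter fun b => isClosed_iInter fun _ => ?_
      exact isClosed_le ((continuous_apply _).comp continuous_subtype_val)
        ((continuous_apply _).comp continuous_subtype_val)
    let A := {x : {x : Fin (n + 1) → ℝ // p x} | Antitone (x.1 ∘ π)}
    let γ : A → Cham p := fun x => ⟨⟨gaps (x.1.1 ∘ π), gaps_nonneg (h0 _ (hp _ x.1.2 _)) x.2⟩, by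
      rw [tailSum_gaps]; exact hp _ x.1.2 _⟩
    have hγ : Continuous γ := by
      refine Continuous.subtype_mk (Continuous.subtype_mk (continuous_gaps.comp ?_) _) _
      refine continuous_pi fun v => ?_
      exact (continuous_apply _).comp (continuous_subtype_val.comp continuous_subtype_val)
    have hcl : IsClosed (K ∩ {a : Cham p | conn (adj D) (zset a.1) f (i, π)}) :=
      hK.inter (isClosed_conn (Z := fun a : Cham p => zset a.1)
        (fun c => (isClosed_zset c).preimage continuous_subtype_val) _ _)
    have h3 := hA.isClosedEmbedding_subtypeVal.isClosedMap _ (hcl.preimage hγ)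
    convert h3 using 1
    ext x
    constructor
    · rintro ⟨hx, a, ha, hag, hc⟩
      have e : γ ⟨x, hx⟩ = a := Subtype.ext (Subtype.ext hag.symm)
      refine ⟨⟨x, hx⟩, ?_, rfl⟩
      rw [mem_preimage, e]
      exact ⟨ha, hc⟩
    · rintro ⟨⟨x', hx'⟩, ⟨h4, h5⟩, rfl⟩
      exact ⟨hx', _, h4, rfl, h5⟩
  · intro y
    induction y using Quot.ind with
    | mk z =>
      obtain ⟨π, hπ⟩ := exists_sort z.2.1
      obtain ⟨a, ha, _⟩ := exists_totPt D hp h0 z π hπ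
      exact ⟨(z.1, π), a, congrArg _ ha.symm⟩

end glue

end GlueAux

namespace GlueAux
open Set Filter Topology

theorem Pres.exists_openEmbedding {C C' Φ A A' Y Y' : Type*} [TopologicalSpace A] [TopologicalSpace A']
    [TopologicalSpace Y] [TopologicalSpace Y'] [Finite Φ] {r : C → Φ → Φ} {Z : A → Set C}
    {q : Φ → A → Y} {r' : C' → Φ → Φ} {Z' : A' → Set C'} {q' : Φ → A' → Y'}
    (h : Pres r Z q) (h' : Pres r' Z' q') (j : A' → A) (hj : IsOpenEmbedding j)
    (hc : ∀ a f g, conn r' (Z' a) f g ↔ conn r (Z (j a)) f g) :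
    ∃ J : Y' → Y, IsOpenEmbedding J ∧ ∀ f a, J (q' f a) = q f (j a) := by
  let S : Set Y := {y | ∃ f, ∃ a ∈ range j, q f a = y}
  have hST : ∀ f a, q f a ∈ S ↔ a ∈ range j := by
    intro f a
    constructor
    · rintro ⟨g, b, hb, he⟩
      rw [← ((h.ker _ _ _ _).1 he).1]
      exact hb
    · intro ha
      exact ⟨f, a, ha, rfl⟩
  have hS : IsOpen S := by
    rw [h.isOpen_iff]
    intro f
    have : q f ⁻¹' S = range j := by ext a; exact hST f a
    rw [this]
    exact hj.isOpen_range
  obtain ⟨e, he⟩ := h'.exists_homeo (h.restrict S (range j) hST) hj.isEmbedding.toHomeomorph hc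
  refine ⟨fun y => (e y : Y), hS.isOpenEmbedding_subtypeVal.comp e.isOpenEmbedding, ?_⟩
  intro f a
  simp only [he]
  rfl

/-! ### Linear functionals -/

/-- The weight. -/
def Wt {n : ℕ} (v : Fin n → ℝ) : ℝ := ∑ c : Fin n, (3 * (c : ℝ) + 2) * v c

/-- The total mass of the vector with gaps `y`. -/
def Nm {n : ℕ} (y : Fin (n + 1) → ℝ) : ℝ := y 0 + ∑ c : Fin n, ((c : ℝ) + 2) * y c.succ

theorem Wt_smul {n : ℕ} (a : ℝ) (v : Fin n → ℝ) : Wt (fun c => a * v c) = a * Wt v := by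
  unfold Wt
  rw [Finset.mul_sum]
  exact Finset.sum_congr rfl fun c _ => by ring

theorem Nm_smul {n : ℕ} (a : ℝ) (v : Fin (n + 1) → ℝ) : Nm (fun c => a * v c) = a * Nm v := by
  unfold Nm
  rw [mul_add, Finset.mul_sum]
  congr 1
  exact Finset.sum_congr rfl fun c _ => by ring

theorem continuous_Wt {n : ℕ} : Continuous (Wt (n := n)) := by
  unfold Wt; fun_prop

theorem continuous_Nm {n : ℕ} : Continuous (Nm (n := n)) := by
  unfold Nm; fun_prop

theorem tailSum_zero {n : ℕ} (y : Fin (n + 1) → ℝ) : tailSum y 0 = y 0 + ∑ c : Fin n, y c.succ := by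
  unfold tailSum
  simp [Fin.sum_univ_succ]

theorem sum_tailSum {n : ℕ} (y : Fin (n + 1) → ℝ) : ∑ v, tailSum y v = Nm y := by
  unfold tailSum Nm
  rw [Finset.sum_comm]
  have : ∀ d : Fin (n + 1), (∑ c : Fin (n + 1), if c ≤ d then y d else 0) = ((d : ℝ) + 1) * y d := by
    intro d
    rw [← Finset.sum_filter, Finset.sum_const, nsmul_eq_mul]
    congr 1
    have : (Finset.univ.filter fun c : Fin (n + 1) => c ≤ d) = Finset.Iic d := by ext; simp
    rw [this, Fin.card_Iic]
    push_cast; ring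
  rw [Finset.sum_congr rfl fun d _ => this d, Fin.sum_univ_succ]
  congr 1
  · simp
  · refine Finset.sum_congr rfl fun c _ => ?_
    rw [Fin.val_succ]
    push_cast; ring

theorem functional_facts {n : ℕ} (y : Fin (n + 1) → ℝ) (hy : ∀ c, 0 ≤ y c) :
    Wt (fun c => y (Fin.succ c)) = 3 * Nm y - 4 * tailSum y 0 + y 0 ∧ 0 ≤ Nm y - tailSum y 0 ∧
    2 * (Nm y - tailSum y 0) ≤ Wt (fun c => y (Fin.succ c)) ∧
    Wt (fun c => y (Fin.succ c)) ≤ 3 * (Nm y - tailSum y 0) := by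
  have hV : Nm y - tailSum y 0 = ∑ c : Fin n, ((c : ℝ) + 1) * y c.succ := by
    rw [tailSum_zero, Nm, add_sub_add_left_eq_sub, ← Finset.sum_sub_distrib]
    exact Finset.sum_congr rfl fun c _ => by ring
  have hc : ∀ c : Fin n, (0 : ℝ) ≤ c := fun c => Nat.cast_nonneg _
  refine ⟨?_, ?_, ?_, ?_⟩
  · rw [tailSum_zero, Nm, Wt, mul_add, mul_add, Finset.mul_sum, Finset.mul_sum]
    have : ∑ c : Fin n, (3 * (c : ℝ) + 2) * y c.succ =
      ∑ c : Fin n, 3 * (((c : ℝ) + 2) * y c.succ) - ∑ c : Fin n, 4 * y c.succ := by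
      rw [← Finset.sum_sub_distrib]
      exact Finset.sum_congr rfl fun c _ => by ring
    rw [this]; ring
  · rw [hV]
    exact Finset.sum_nonneg fun c _ => mul_nonneg (by linarith [hc c]) (hy _)
  · rw [hV, Wt, Finset.mul_sum]
    refine Finset.sum_le_sum fun c _ => ?_
    nlinarith [hc c, hy c.succ, mul_nonneg (hc c) (hy c.succ)]
  · rw [hV, Wt, Finset.mul_sum]
    refine Finset.sum_le_sum fun c _ => ?_
    nlinarith [hc c, hy c.succ, mul_nonneg (hc c) (hy c.succ)]

/-! ### Bands -/

/-- The base of the bands. -/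
abbrev Bs (n : ℕ) : Type := {v : Orth (Fin n) // Wt v.1 = 1}

/-- The coordinates of a point of a band. -/
def bcoord {n : ℕ} {J : Set ℝ} (a : Bs n × J) : Fin (n + 1) → ℝ := Fin.cons (a.2 : ℝ) a.1.1.1

theorem bcoord_zero {n : ℕ} {J : Set ℝ} (a : Bs n × J) : bcoord a 0 = a.2 := rfl
theorem bcoord_succ {n : ℕ} {J : Set ℝ} (a : Bs n × J) (c : Fin n) : bcoord a c.succ = a.1.1.1 c := rfl

/-- The zero set in a band. -/
def bz {n : ℕ} {J : Set ℝ} (a : Bs n × J) : Set (Fin (n + 1)) := {c | bcoord a c = 0}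

theorem continuous_bcoord {n : ℕ} {J : Set ℝ} : Continuous (bcoord (n := n) (J := J)) := by
  refine continuous_pi fun c => ?_
  cases c using Fin.cases with
  | zero => exact continuous_subtype_val.comp continuous_snd
  | succ c =>
    exact (continuous_apply c).comp
      (continuous_subtype_val.comp (continuous_subtype_val.comp continuous_fst))

theorem isClosed_bz {n : ℕ} {J : Set ℝ} (c : Fin (n + 1)) :
    IsClosed {a : Bs n × J | c ∈ bz a} :=
  isClosed_eq ((continuous_apply c).comp continuous_bcoord) continuous_const

/-- The unnormalised band. -/
def Sb (n : ℕ) (J : Set ℝ) : Set (Fin (n + 1) → ℝ) :=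
  {y | (∀ c, 0 ≤ y c) ∧ Nm y = 1 ∧ 0 < Wt (fun c => y (Fin.succ c)) ∧
    y 0 / Wt (fun c => y (Fin.succ c)) ∈ J}

theorem Nm_bcoord_pos {n : ℕ} {J : Set ℝ} (hJ : J ⊆ Ici 0) (a : Bs n × J) : 0 < Nm (bcoord a) := by
  have h0 : ∀ c, 0 ≤ bcoord a c := by
    intro c
    cases c using Fin.cases with
    | zero => exact hJ a.2.2
    | succ c => exact a.1.1.2 c
  obtain ⟨h1, h2, h3, h4⟩ := functional_facts (bcoord a) h0
  have h5 : Wt (fun c : Fin n => bcoord a c.succ) = 1 := a.1.2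
  have h6 : 0 ≤ tailSum (bcoord a) 0 := by
    rw [tailSum_zero]
    exact add_nonneg (h0 _) (Finset.sum_nonneg fun c _ => h0 _)
  linarith

/-- Normalising a band. -/
def bandHomeo (n : ℕ) (J : Set ℝ) (hJ : J ⊆ Ici 0) : Sb n J ≃ₜ Bs n × J where
  toFun y := (⟨⟨fun c => (Wt (fun c => y.1 (Fin.succ c)))⁻¹ * y.1 c.succ, fun c =>
      mul_nonneg (inv_nonneg.2 y.2.2.2.1.le) (y.2.1 _)⟩, by
      rw [Wt_smul (n := n) _ (fun c => y.1 (Fin.succ c)), inv_mul_cancel₀ y.2.2.2.1.ne']⟩,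
    ⟨y.1 0 / Wt (fun c => y.1 (Fin.succ c)), y.2.2.2.2⟩)
  invFun a := ⟨fun c => (Nm (bcoord a))⁻¹ * bcoord a c, by
    have hN := Nm_bcoord_pos hJ a
    have h5 : Wt (fun c : Fin n => bcoord a c.succ) = 1 := a.1.2
    have h6 : Wt (fun c : Fin n => (Nm (bcoord a))⁻¹ * bcoord a c.succ) = (Nm (bcoord a))⁻¹ := by
      rw [Wt_smul (n := n) _ (fun c => bcoord a (Fin.succ c)), h5, mul_one]
    refine ⟨?_, ?_, ?_, ?_⟩
    · intro c
      refine mul_nonneg (inv_nonneg.2 hN.le) ?_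
      cases c using Fin.cases with
      | zero => exact hJ a.2.2
      | succ c => exact a.1.1.2 c
    · rw [Nm_smul, inv_mul_cancel₀ hN.ne']
    · rw [h6]; exact inv_pos.2 hN
    · have e : (Nm (bcoord a))⁻¹ * bcoord a 0 /
          Wt (fun c : Fin n => (Nm (bcoord a))⁻¹ * bcoord a c.succ) = a.2 := by
        rw [h6, bcoord_zero]
        field_simp
      exact e.symm ▸ a.2.2⟩
  left_inv y := by
    apply Subtype.ext
    have hw := y.2.2.2.1.ne'
    set w := Wt (fun c => y.1 (Fin.succ c)) with hwd
    have hb : ∀ a : Bs n × J, (∀ c, a.1.1.1 c = w⁻¹ * y.1 c.succ) → (a.2 : ℝ) = y.1 0 / w →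
        bcoord a = fun c => w⁻¹ * y.1 c := by
      intro a h1 h2
      funext c
      cases c using Fin.cases with
      | zero => rw [bcoord_zero, h2]; field_simp
      | succ c => rw [bcoord_succ, h1]
    funext c
    dsimp only
    rw [hb _ (fun _ => rfl) rfl, Nm_smul, y.2.2.1]
    field_simp
  right_inv a := by
    have hN := Nm_bcoord_pos hJ a
    have h5 : Wt (fun c : Fin n => bcoord a c.succ) = 1 := a.1.2
    have h6 : Wt (fun c : Fin n => (Nm (bcoord a))⁻¹ * bcoord a c.succ) = (Nm (bcoord a))⁻¹ := by
      rw [Wt_smul (n := n) _ (fun c => bcoord a (Fin.succ c)), h5, mul_one]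
    apply Prod.ext
    · apply Subtype.ext
      apply Subtype.ext
      funext c
      dsimp only
      rw [h6, bcoord_succ]
      field_simp
    · apply Subtype.ext
      dsimp only
      rw [h6, bcoord_zero]
      field_simp
  continuous_toFun := by
    have hw : Continuous fun y : Sb n J => Wt (fun c => y.1 (Fin.succ c)) :=
      continuous_Wt.comp (continuous_pi fun c => (continuous_apply _).comp continuous_subtype_val)
    refine Continuous.prodMk ?_ ?_
    · refine Continuous.subtype_mk (Continuous.subtype_mk (continuous_pi fun c => ?_) _) _
      exact (hw.inv₀ fun y => y.2.2.2.1.ne').mul ((continuous_apply _).comp continuous_subtype_val)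
    · refine Continuous.subtype_mk ?_ _
      exact ((continuous_apply _).comp continuous_subtype_val).div hw fun y => y.2.2.2.1.ne'
  continuous_invFun := by
    refine Continuous.subtype_mk (continuous_pi fun c => ?_) _
    exact ((continuous_Nm.comp continuous_bcoord).inv₀ fun a => (Nm_bcoord_pos hJ a).ne').mul
      ((continuous_apply c).comp continuous_bcoord)

theorem exists_band_homeo {n : ℕ} {J : Set ℝ} (hJ : J ⊆ Ici 0) {A : Type*} [TopologicalSpace A]
    (ι : A → Fin (n + 1) → ℝ) (hι : IsEmbedding ι) (hr : range ι = Sb n J) :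
    ∃ σ : A ≃ₜ Bs n × J, ∀ a c, c ∈ bz (σ a) ↔ ι a c = 0 := by
  refine ⟨(hι.toHomeomorph.trans (Homeomorph.setCongr hr)).trans (bandHomeo n J hJ), ?_⟩
  intro a c
  have hmem : ι a ∈ Sb n J := hr ▸ mem_range_self a
  show bcoord (bandHomeo n J hJ ⟨ι a, hmem⟩) c = 0 ↔ _
  have hw := hmem.2.2.1.ne'
  cases c using Fin.cases with
  | zero =>
    show ι a 0 / Wt (fun c => ι a (Fin.succ c)) = 0 ↔ _
    simp [hw]
  | succ c =>
    show (Wt (fun c => ι a (Fin.succ c)))⁻¹ * ι a c.succ = 0 ↔ _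
    simp [hw]

/-- The glued band. -/
abbrev WB {n : ℕ} (D : GlueingDatum n) (J : Set ℝ) : Type :=
  PresQuot (adj D) (adj_adj D) (bz (n := n) (J := J))

theorem pres_WB {n : ℕ} (D : GlueingDatum n) (J : Set ℝ) :
    Pres (adj D) bz (presMk (adj D) (adj_adj D) (bz (n := n) (J := J))) :=
  pres_canonical _ _ _ isClosed_bz

/-- The conditions. -/
def pD (n : ℕ) (x : Fin (n + 1) → ℝ) : Prop := (∀ v, 0 ≤ x v) ∧ ∑ v, x v = 1
/-- The conditions. -/
def pT (n : ℕ) (x : Fin (n + 1) → ℝ) : Prop := ((∀ v, 0 ≤ x v) ∧ ∑ v, x v = 1) ∧ ∀ v, x v ≤ 3 / 4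

theorem pD_perm {n : ℕ} (x : Fin (n + 1) → ℝ) (hx : pD n x) (π : Equiv.Perm (Fin (n + 1))) :
    pD n (x ∘ π) := ⟨fun v => hx.1 _, by rw [← hx.2]; exact Equiv.sum_comp π x⟩

theorem pT_perm {n : ℕ} (x : Fin (n + 1) → ℝ) (hx : pT n x) (π : Equiv.Perm (Fin (n + 1))) :
    pT n (x ∘ π) := ⟨pD_perm x hx.1 π, fun v => hx.2 _⟩

theorem mem_level {n : ℕ} (D : GlueingDatum n) {p : (Fin (n + 1) → ℝ) → Prop}
    (hp : ∀ x, p x → ∀ π : Equiv.Perm (Fin (n + 1)), p (x ∘ π)) (h0 : ∀ x, p x → ∀ v, 0 ≤ x v)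
    (s : ℝ) (f : Flag D) (a : Cham p) :
    (∃ z : Σ _ : D.I, {x : Fin (n + 1) → ℝ // p x}, (∃ v, z.2.1 v = s) ∧
      Quot.mk (relP D p) z = glueMk D hp f a) ↔ ∃ v, tailSum a.1.1 v = s := by
  constructor
  · rintro ⟨z, ⟨v, hv⟩, hz⟩
    obtain ⟨π, hπ⟩ := exists_sort z.2.1
    obtain ⟨b, hb, _⟩ := exists_totPt D hp h0 z π hπ
    have h1 : glueMk D hp (z.1, π) b = glueMk D hp f a := by
      rw [← hz, hb]; rfl
    obtain ⟨rfl, _⟩ := ((pres_glue D hp h0).ker _ _ _ _).1 h1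
    refine ⟨π.symm v, ?_⟩
    rw [← totPt_sorted D hp (z.1, π) b, ← hb]
    simpa using hv
  · rintro ⟨v, hv⟩
    exact ⟨totPt D hp f a, ⟨f.2 v, by rw [← hv, ← totPt_sorted D hp f a]; rfl⟩, rfl⟩

theorem tailSum_nonneg {n : ℕ} {y : Fin (n + 1) → ℝ} (hy : ∀ c, 0 ≤ y c) (v) : 0 ≤ tailSum y v :=
  Finset.sum_nonneg fun d _ => by split_ifs <;> simp [hy d]

theorem tailSum_le_zero {n : ℕ} {y : Fin (n + 1) → ℝ} (hy : ∀ c, 0 ≤ y c) (v) :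
    tailSum y v ≤ tailSum y 0 := tailSum_antitone hy (Fin.zero_le _)

theorem star_homeo {n : ℕ} (D : GlueingDatum n) : Nonempty (GlueSpaceStar D ≃ₜ WB D (Ici 0)) := by
  have hP := pres_glue D (pD_perm (n := n)) (fun x hx => hx.1)
  let S : Set (GlueSpace D) := (vertexImage D)ᶜ
  let T : Set (Cham (pD n)) := {a | ¬ ∃ v, tailSum a.1.1 v = 1}
  have hST : ∀ f a, glueMk D pD_perm f a ∈ S ↔ a ∈ T := fun f a =>
    not_congr (mem_level D pD_perm (fun x hx => hx.1) 1 f a)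
  have hR := hP.restrict S T hST
  obtain ⟨σ, hσ⟩ := exists_band_homeo (n := n) (J := Ici 0) (fun _ h => h) (A := T)
    (fun a => a.1.1.1)
    (IsEmbedding.subtypeVal.comp (IsEmbedding.subtypeVal.comp IsEmbedding.subtypeVal)) (by
      ext y
      constructor
      · rintro ⟨⟨a, ha⟩, rfl⟩
        have hy := a.1.2
        obtain ⟨h1, h2, h3, h4⟩ := functional_facts a.1.1 hy
        have hN : Nm a.1.1 = 1 := by rw [← sum_tailSum]; exact a.2.2
        have h5 : tailSum a.1.1 0 ≠ 1 := fun h => ha ⟨0, h⟩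
        have h6 : 0 < Nm a.1.1 - tailSum a.1.1 0 := lt_of_le_of_ne h2 fun h => h5 (by linarith)
        refine ⟨hy, hN, by linarith, ?_⟩
        exact mem_Ici.2 (div_nonneg (hy 0) (by linarith))
      · rintro ⟨hy, hN, hw, _⟩
        obtain ⟨h1, h2, h3, h4⟩ := functional_facts y hy
        refine ⟨⟨⟨⟨y, hy⟩, tailSum_nonneg hy, by rw [sum_tailSum]; exact hN⟩, ?_⟩, rfl⟩
        rintro ⟨v, hv⟩
        have := tailSum_le_zero hy v
        simp only at hv
        linarith)
  obtain ⟨e, _⟩ := hR.exists_homeo (pres_WB D (Ici 0)) σ (fun a f g => by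
    have : bz (σ a) = zset a.1.1 := by ext c; exact hσ a c
    rw [this])
  exact ⟨e⟩

theorem trunc_homeo {n : ℕ} (D : GlueingDatum n) : Nonempty (TruncSpace D ≃ₜ WB D (Icc 0 1)) := by
  have hP := pres_glue D (pT_perm (n := n)) (fun x hx => hx.1.1)
  obtain ⟨σ, hσ⟩ := exists_band_homeo (n := n) (J := Icc 0 1) (fun _ h => h.1) (A := Cham (pT n))
    (fun a => a.1.1) (IsEmbedding.subtypeVal.comp IsEmbedding.subtypeVal) (by
      ext y
      constructor
      · rintro ⟨a, rfl⟩
        have hy := a.1.2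
        obtain ⟨h1, h2, h3, h4⟩ := functional_facts a.1.1 hy
        have hN : Nm a.1.1 = 1 := by rw [← sum_tailSum]; exact a.2.1.2
        have h5 := a.2.2 0
        have h6 := hy 0
        have hw : 0 < Wt (fun c => a.1.1 (Fin.succ c)) := by linarith
        refine ⟨hy, hN, hw, div_nonneg h6 hw.le, ?_⟩
        rw [div_le_one hw]; linarith
      · rintro ⟨hy, hN, hw, h7, h8⟩
        obtain ⟨h1, h2, h3, h4⟩ := functional_facts y hy
        refine ⟨⟨⟨y, hy⟩, ⟨tailSum_nonneg hy, by rw [sum_tailSum]; exact hN⟩, fun v => ?_⟩, rfl⟩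
        have := tailSum_le_zero hy v
        rw [div_le_one hw] at h8
        simp only
        linarith)
  obtain ⟨e, _⟩ := hP.exists_homeo (pres_WB D (Icc 0 1)) σ (fun a f g => by
    have : bz (σ a) = zset a.1 := by ext c; exact hσ a c
    rw [this])
  exact ⟨e⟩

theorem interior_homeo {n : ℕ} (D : GlueingDatum n) :
    Nonempty (↥((truncBoundary D)ᶜ) ≃ₜ WB D (Ico 0 1)) := by
  have hP := pres_glue D (pT_perm (n := n)) (fun x hx => hx.1.1)
  let S : Set (TruncSpace D) := (truncBoundary D)ᶜ
  let T : Set (Cham (pT n)) := {a | ¬ ∃ v, tailSum a.1.1 v = 3 / 4}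
  have hST : ∀ f a, glueMk D pT_perm f a ∈ S ↔ a ∈ T := fun f a =>
    not_congr (mem_level D pT_perm (fun x hx => hx.1.1) (3 / 4) f a)
  have hR := hP.restrict S T hST
  obtain ⟨σ, hσ⟩ := exists_band_homeo (n := n) (J := Ico 0 1) (fun _ h => h.1) (A := T)
    (fun a => a.1.1.1)
    (IsEmbedding.subtypeVal.comp (IsEmbedding.subtypeVal.comp IsEmbedding.subtypeVal)) (by
      ext y
      constructor
      · rintro ⟨⟨a, ha⟩, rfl⟩
        have hy := a.1.2
        obtain ⟨h1, h2, h3, h4⟩ := functional_facts a.1.1 hy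
        have hN : Nm a.1.1 = 1 := by rw [← sum_tailSum]; exact a.2.1.2
        have h5 := a.2.2 0
        have h6 := hy 0
        have h7 : tailSum a.1.1 0 < 3 / 4 := lt_of_le_of_ne h5 fun h => ha ⟨0, h⟩
        have hw : 0 < Wt (fun c => a.1.1 (Fin.succ c)) := by linarith
        refine ⟨hy, hN, hw, div_nonneg h6 hw.le, ?_⟩
        simp only
        rw [div_lt_one hw]; linarith
      · rintro ⟨hy, hN, hw, h7, h8⟩
        obtain ⟨h1, h2, h3, h4⟩ := functional_facts y hy
        rw [div_lt_one hw] at h8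
        refine ⟨⟨⟨⟨y, hy⟩, ⟨tailSum_nonneg hy, by rw [sum_tailSum]; exact hN⟩, fun v => ?_⟩, ?_⟩, rfl⟩
        · have := tailSum_le_zero hy v
          simp only
          linarith
        · rintro ⟨v, hv⟩
          have := tailSum_le_zero hy v
          simp only at hv
          linarith)
  obtain ⟨e, _⟩ := hR.exists_homeo (pres_WB D (Ico 0 1)) σ (fun a f g => by
    have : bz (σ a) = zset a.1.1 := by ext c; exact hσ a c
    rw [this])
  exact ⟨e⟩

end GlueAux

namespace GlueAux
open Set Filter Topology

/-- Extension by one. -/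
def extOne {n : ℕ} (c : Fin n) (u : Orth {d : Fin n // d ≠ c}) : Fin n → ℝ :=
  fun d => if h : d = c then 1 else u.1 ⟨d, h⟩

theorem extOne_self {n : ℕ} (c : Fin n) (u : Orth {d : Fin n // d ≠ c}) : extOne c u c = 1 := by
  simp [extOne]

theorem extOne_ne {n : ℕ} (c : Fin n) (u : Orth {d : Fin n // d ≠ c}) (d : {d : Fin n // d ≠ c}) :
    extOne c u d.1 = u.1 d := by
  simp [extOne, d.2]

theorem extOne_nonneg {n : ℕ} (c : Fin n) (u : Orth {d : Fin n // d ≠ c}) (d : Fin n) :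
    0 ≤ extOne c u d := by
  unfold extOne
  split_ifs with h
  · exact zero_le_one
  · exact u.2 _

theorem continuous_extOne {n : ℕ} (c : Fin n) : Continuous (extOne c) := by
  refine continuous_pi fun d => ?_
  unfold extOne
  by_cases h : d = c
  · simp only [h, dif_pos]; exact continuous_const
  · simp only [h, dif_neg, not_false_eq_true]
    exact (continuous_apply _).comp continuous_subtype_val

theorem Wt_extOne_pos {n : ℕ} (c : Fin n) (u : Orth {d : Fin n // d ≠ c}) : 0 < Wt (extOne c u) := by
  unfold Wt
  refine Finset.sum_pos' (fun d _ => mul_nonneg (by positivity) (extOne_nonneg c u d)) ⟨c, Finset.mem_univ _, ?_⟩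
  rw [extOne_self]
  positivity

/-- A chart of the base. -/
def jcHomeo {n : ℕ} (c : Fin n) :
    Orth {d : Fin n // d ≠ c} ≃ₜ {b : Bs n // 0 < b.1.1 c} where
  toFun u := ⟨⟨⟨fun d => (Wt (extOne c u))⁻¹ * extOne c u d, fun d =>
      mul_nonneg (inv_nonneg.2 (Wt_extOne_pos c u).le) (extOne_nonneg c u d)⟩, by
      rw [Wt_smul, inv_mul_cancel₀ (Wt_extOne_pos c u).ne']⟩, by
      show 0 < (Wt (extOne c u))⁻¹ * extOne c u c
      rw [extOne_self, mul_one]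
      exact inv_pos.2 (Wt_extOne_pos c u)⟩
  invFun b := ⟨fun d => b.1.1.1 d.1 / b.1.1.1 c, fun d => div_nonneg (b.1.1.2 _) b.2.le⟩
  left_inv u := by
    apply Subtype.ext
    funext d
    have h := (Wt_extOne_pos c u).ne'
    show (Wt (extOne c u))⁻¹ * extOne c u d.1 / ((Wt (extOne c u))⁻¹ * extOne c u c) = u.1 d
    rw [extOne_self, extOne_ne]
    field_simp
  right_inv b := by
    apply Subtype.ext
    apply Subtype.ext
    apply Subtype.ext
    have hb := b.2.ne'
    have hW : Wt b.1.1.1 = 1 := b.1.2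
    have key : ∀ u : Orth {d : Fin n // d ≠ c}, (∀ d, u.1 d = b.1.1.1 d.1 / b.1.1.1 c) →
        extOne c u = fun d => (b.1.1.1 c)⁻¹ * b.1.1.1 d := by
      intro u hu
      funext d
      by_cases h : d = c
      · subst h; rw [extOne_self]; field_simp
      · rw [extOne_ne c u ⟨d, h⟩, hu]; field_simp
    funext d
    dsimp only
    rw [key _ (fun _ => rfl), Wt_smul, hW]
    field_simp
  continuous_toFun := by
    refine Continuous.subtype_mk (Continuous.subtype_mk (Continuous.subtype_mk
      (continuous_pi fun d => ?_) _) _) _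
    exact ((continuous_Wt.comp (continuous_extOne c)).inv₀ fun u => (Wt_extOne_pos c u).ne').mul
      ((continuous_apply d).comp (continuous_extOne c))
  continuous_invFun := by
    have h : ∀ d, Continuous fun b : {b : Bs n // 0 < b.1.1 c} => b.1.1.1 d := fun d =>
      (continuous_apply d).comp (continuous_subtype_val.comp
        (continuous_subtype_val.comp continuous_subtype_val))
    refine Continuous.subtype_mk (continuous_pi fun d => ?_) _
    exact (h _).div (h _) fun b => ne_of_gt b.2

/-- The chart map. -/
def jc {n : ℕ} (c : Fin n) (u : Orth {d : Fin n // d ≠ c}) : Bs n := (jcHomeo c u).1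

theorem isOpenEmbedding_jc {n : ℕ} (c : Fin n) : IsOpenEmbedding (jc c) := by
  have hop : IsOpen {b : Bs n | 0 < b.1.1 c} :=
    isOpen_lt continuous_const ((continuous_apply c).comp (continuous_subtype_val.comp
        continuous_subtype_val))
  exact hop.isOpenEmbedding_subtypeVal.comp (jcHomeo c).isOpenEmbedding

theorem jc_ne_zero {n : ℕ} (c : Fin n) (u) : (jc c u).1.1 c ≠ 0 := (jcHomeo c u).2.ne'

theorem jc_eq_zero {n : ℕ} (c : Fin n) (u) (d : {d : Fin n // d ≠ c}) :
    (jc c u).1.1 d.1 = 0 ↔ u.1 d = 0 := by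
  show (Wt (extOne c u))⁻¹ * extOne c u d.1 = 0 ↔ _
  have h := (Wt_extOne_pos c u).ne'
  rw [extOne_ne]
  simp [h]

theorem exists_jc {n : ℕ} (b : Bs n) : ∃ c u, jc c u = b := by
  have : ∃ c, 0 < b.1.1 c := by
    by_contra h
    push Not at h
    have h0 : ∀ c, b.1.1 c = 0 := fun c => le_antisymm (h c) (b.1.2 c)
    have := b.2
    simp [Wt, h0] at this
  obtain ⟨c, hc⟩ := this
  exact ⟨c, (jcHomeo c).symm ⟨b, hc⟩, by simp [jc]⟩

/-- Splitting off the zeroth coordinate. -/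
def splitZero {n : ℕ} (c : Fin n) :
    Orth {e : Fin (n + 1) // e ≠ c.succ} ≃ₜ Orth {d : Fin n // d ≠ c} × ↥(Ici (0 : ℝ)) where
  toFun y := (⟨fun d => y.1 ⟨d.1.succ, fun h => d.2 (Fin.succ_injective _ h)⟩, fun d => y.2 _⟩,
    ⟨y.1 ⟨0, (Fin.succ_ne_zero c).symm⟩, mem_Ici.2 (y.2 _)⟩)
  invFun a := ⟨fun e => if h : e.1 = 0 then (a.2 : ℝ) else
      a.1.1 ⟨e.1.pred h, fun h' => e.2 ((Fin.succ_pred e.1 h).symm.trans (congrArg Fin.succ h'))⟩, fun e => by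
      dsimp only
      split_ifs with h
      · exact a.2.2
      · exact a.1.2 _⟩
  left_inv y := by
    apply Subtype.ext
    funext e
    obtain ⟨e, he⟩ := e
    dsimp only
    split_ifs with h
    · subst h; rfl
    · simp
  right_inv a := by
    apply Prod.ext
    · apply Subtype.ext
      funext d
      simp
    · apply Subtype.ext
      simp
  continuous_toFun := by
    refine Continuous.prodMk (Continuous.subtype_mk (continuous_pi fun d => ?_) _)
      (Continuous.subtype_mk ?_ _)
    · exact (continuous_apply _).comp continuous_subtype_val
    · exact (continuous_apply _).comp continuous_subtype_val
  continuous_invFun := by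
    refine Continuous.subtype_mk (continuous_pi fun e => ?_) _
    by_cases h : e.1 = 0
    · simp only [h, dif_pos]; exact continuous_subtype_val.comp continuous_snd
    · simp only [h, dif_neg, not_false_eq_true]
      exact (continuous_apply _).comp (continuous_subtype_val.comp continuous_fst)

variable {n : ℕ} (D : GlueingDatum n)

/-- The local model at a chart. -/
abbrev YL (c : Fin n) : Type :=
  PresQuot (fun d : {d : Fin n // d ≠ c} => adj D d.1.succ) (fun d => adj_adj D d.1.succ)
    (zset (C := {d : Fin n // d ≠ c}))

/-- The other local model at a chart. -/
abbrev YF (c : Fin n) : Type :=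
  PresQuot (fun e : {e : Fin (n + 1) // e ≠ c.succ} => adj D e.1) (fun e => adj_adj D e.1)
    (zset (C := {e : Fin (n + 1) // e ≠ c.succ}))

theorem pres_YL (c : Fin n) : Pres (fun d : {d : Fin n // d ≠ c} => adj D d.1.succ) zset
    (presMk (fun d : {d : Fin n // d ≠ c} => adj D d.1.succ) (fun d => adj_adj D d.1.succ)
    (zset (C := {d : Fin n // d ≠ c}))) := pres_canonical _ _ _ isClosed_zset

theorem pres_YF (c : Fin n) : Pres (fun e : {e : Fin (n + 1) // e ≠ c.succ} => adj D e.1) zset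
    (presMk (fun e : {e : Fin (n + 1) // e ≠ c.succ} => adj D e.1) (fun e => adj_adj D e.1)
    (zset (C := {e : Fin (n + 1) // e ≠ c.succ}))) := pres_canonical _ _ _ isClosed_zset

theorem exists_emb_YF (c : Fin n) : ∃ E : YF D c → WB D (Ici 0), IsOpenEmbedding E ∧
    ∀ f u t, ∃ y, E y = presMk (adj D) (adj_adj D) bz f (jc c u, t) := by
  obtain ⟨E, hE, hE'⟩ := (pres_WB D (Ici 0)).exists_openEmbedding (pres_YF D c)
    (fun y => Prod.map (jc c) id (splitZero c y))
    (((isOpenEmbedding_jc c).prodMap IsOpenEmbedding.id).comp (splitZero c).isOpenEmbedding) (by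
      intro a f g
      rw [← conn_reindex (r := adj D) (Subtype.val : {e : Fin (n + 1) // e ≠ c.succ} → Fin (n + 1))]
      · have : zset a = Subtype.val ⁻¹' bz (Prod.map (jc c) id (splitZero c a)) := by
          ext ⟨e, he⟩
          show a.1 ⟨e, he⟩ = 0 ↔ bcoord _ e = 0
          cases e using Fin.cases with
          | zero => exact Iff.rfl
          | succ d =>
            rw [bcoord_succ]
            exact (jc_eq_zero c (splitZero c a).1 ⟨d, fun h => he (by rw [h])⟩).symm
        rw [this]
      · intro e he
        simp only [Subtype.range_coe_subtype, mem_ofPred_eq]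
        rintro rfl
        exact jc_ne_zero c (splitZero c a).1 he)
  refine ⟨E, hE, fun f u t => ⟨presMk _ _ _ f ((splitZero c).symm (u, t)), ?_⟩⟩
  rw [hE']
  simp

theorem exists_emb_YL (c : Fin n) (J0 J : Set ℝ) (hpos : ∀ t ∈ J0, 0 < t) (hJ : J0 ⊆ J)
    (ho : IsOpenEmbedding (inclusion hJ)) : ∃ E : YL D c × J0 → WB D J, IsOpenEmbedding E ∧
    ∀ f u t, E (presMk _ _ _ f u, t) = presMk (adj D) (adj_adj D) bz f (jc c u, inclusion hJ t) := by
  obtain ⟨E, hE, hE'⟩ := (pres_WB D J).exists_openEmbedding ((pres_YL D c).prod J0)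
    (Prod.map (jc c) (inclusion hJ)) ((isOpenEmbedding_jc c).prodMap ho) (by
      intro a f g
      rw [← conn_reindex (r := adj D) (fun d : {d : Fin n // d ≠ c} => d.1.succ)]
      · have : zset a.1 = (fun d : {d : Fin n // d ≠ c} => d.1.succ) ⁻¹'
            bz (Prod.map (jc c) (inclusion hJ) a) := by
          ext d
          exact (jc_eq_zero c a.1 d).symm
        rw [this]
      · intro e he
        cases e using Fin.cases with
        | zero => exact absurd he (hpos _ a.2.2).ne'
        | succ d =>
          refine ⟨⟨d, ?_⟩, rfl⟩
          rintro rfl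
          exact jc_ne_zero d a.1 he)
  exact ⟨E, hE, fun f u t => hE' f (u, t)⟩

theorem exists_homeo_Ico : Nonempty (WB D (Ico 0 1) ≃ₜ WB D (Ici 0)) := by
  let τ : ↥(Ico (0 : ℝ) 1) ≃ₜ ↥(Ici (0 : ℝ)) :=
    { toFun := fun t => ⟨t.1 / (1 - t.1), mem_Ici.2 (div_nonneg t.2.1 (by linarith [t.2.2]))⟩
      invFun := fun s => ⟨s.1 / (1 + s.1), by
        have h : (0 : ℝ) ≤ s.1 := s.2
        exact ⟨by positivity, by rw [div_lt_one (by linarith)]; linarith⟩⟩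
      left_inv := fun t => by
        apply Subtype.ext
        have h : 1 - t.1 ≠ 0 := by have := t.2.2; exact (by linarith : (0:ℝ) < 1 - t.1).ne'
        dsimp only
        field_simp
        ring
      right_inv := fun s => by
        apply Subtype.ext
        have h : 1 + s.1 ≠ 0 := by have : (0:ℝ) ≤ s.1 := s.2; positivity
        dsimp only
        field_simp
        ring
      continuous_toFun := by
        refine Continuous.subtype_mk ?_ _
        exact continuous_subtype_val.div (continuous_const.sub continuous_subtype_val)
          fun t => by have := t.2.2; exact (by linarith : (0:ℝ) < 1 - t.1).ne'
      continuous_invFun := by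
        refine Continuous.subtype_mk ?_ _
        exact continuous_subtype_val.div (continuous_const.add continuous_subtype_val)
          fun s => by have : (0:ℝ) ≤ s.1 := s.2; positivity }
  obtain ⟨e, _⟩ := (pres_WB D (Ico 0 1)).exists_homeo (pres_WB D (Ici 0))
    ((Homeomorph.refl _).prodCongr τ) (by
      intro a f g
      have : bz a = bz ((Homeomorph.refl _).prodCongr τ a) := by
        ext e
        show bcoord _ e = 0 ↔ bcoord _ e = 0
        cases e using Fin.cases with
        | zero =>
          show a.2.1 = 0 ↔ a.2.1 / (1 - a.2.1) = 0
          have h : 1 - a.2.1 ≠ 0 := by have := a.2.2.2; exact (by linarith : (0:ℝ) < 1 - a.2.1).ne'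
          simp [h]
        | succ d => exact Iff.rfl
      rw [this])
  exact ⟨e⟩

theorem exists_emb_Ico : ∃ E : WB D (Ico 0 1) → WB D (Icc 0 1), IsOpenEmbedding E ∧
    ∀ f b t, E (presMk _ _ _ f (b, t)) =
      presMk (adj D) (adj_adj D) bz f (b, inclusion Ico_subset_Icc_self t) := by
  have ho : IsOpenEmbedding (inclusion (Ico_subset_Icc_self : Ico (0:ℝ) 1 ⊆ Icc 0 1)) := by
    refine ⟨IsEmbedding.inclusion _, ?_⟩
    have : range (inclusion (Ico_subset_Icc_self : Ico (0:ℝ) 1 ⊆ Icc 0 1)) =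
        {t : ↥(Icc (0:ℝ) 1) | (t : ℝ) < 1} := by
      ext t
      simp only [range_inclusion, mem_ofPred_eq, mem_Ico]
      exact ⟨fun h => h.2, fun h => ⟨t.2.1, h⟩⟩
    rw [this]
    exact isOpen_lt continuous_subtype_val continuous_const
  obtain ⟨E, hE, hE'⟩ := (pres_WB D (Icc 0 1)).exists_openEmbedding (pres_WB D (Ico 0 1))
    (Prod.map id (inclusion Ico_subset_Icc_self)) (IsOpenEmbedding.id.prodMap ho) (by
      intro a f g
      have : bz (n := n) (Prod.map id (inclusion (Ico_subset_Icc_self : Ico (0:ℝ) 1 ⊆ Icc 0 1)) a) = bz a := by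
        ext e
        cases e using Fin.cases <;> exact Iff.rfl
      rw [this])
  exact ⟨E, hE, fun f b t => hE' f (b, t)⟩

theorem HalfAt.prod_Ici {m : ℕ} {Y : Type*} [TopologicalSpace Y] {y : Y} (h : EucAt m y)
    (t : ↥(Ici (0 : ℝ))) : HalfAt (m + 1) (y, t) := by
  obtain ⟨ψ, hψ⟩ := h
  let e0 : Eu m ≃ₜ (Fin (m + 1 - 1) → ℝ) := euPi (by simp)
  exact ⟨(ψ.trans e0.toOpenPartialHomeomorph).prod (OpenPartialHomeomorph.refl _), by simp [hψ]⟩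

theorem halfAt_Icc {m : ℕ} (D : GlueingDatum (m + 1)) (hm : m = 1 ∨ m = 2 ∨ m = 3)
    (hE : ∀ z : WB D (Ici 0), EucAt (m + 1) z) (z : WB D (Icc 0 1)) : HalfAt (m + 1) z := by
  obtain ⟨f, ⟨b, t⟩, rfl⟩ := (pres_WB D (Icc 0 1)).surj z
  rcases lt_or_eq_of_le t.2.2 with ht | ht
  · obtain ⟨E, hE1, hE2⟩ := exists_emb_Ico D
    have := hE2 f b ⟨t, t.2.1, ht⟩
    obtain ⟨e⟩ := exists_homeo_Ico D
    refine EucAt.half (by omega) ?_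
    have h3 : presMk (adj D) (adj_adj D) bz f (b, t) = E (presMk _ _ _ f (b, ⟨t, t.2.1, ht⟩)) := by
      rw [this]
    rw [h3, EucAt.of_openEmbedding hE1, ← EucAt.of_openEmbedding e.isOpenEmbedding]
    exact hE _
  · obtain ⟨c, u, rfl⟩ := exists_jc b
    have hY : ∀ z : YL D c × ℝ, EucAt (m + 1) z := by
      have ho : IsOpenEmbedding (inclusion (Ioi_subset_Ici_self (a := (0:ℝ)))) := by
        refine ⟨IsEmbedding.inclusion _, ?_⟩
        have : range (inclusion (Ioi_subset_Ici_self (a := (0:ℝ)))) =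
            {t : ↥(Ici (0:ℝ)) | 0 < (t : ℝ)} := by
          ext t
          simp only [range_inclusion, mem_ofPred_eq, mem_Ioi]
        rw [this]
        exact isOpen_lt continuous_const continuous_subtype_val
      obtain ⟨E, hE1, hE2⟩ := exists_emb_YL D c (Ioi 0) (Ici 0) (fun t ht => ht)
        Ioi_subset_Ici_self ho
      intro z
      let ex : YL D c × ℝ ≃ₜ YL D c × ↥(Ioi (0 : ℝ)) :=
        (Homeomorph.refl _).prodCongr Real.expOrderIso.toHomeomorph
      rw [← EucAt.of_openEmbedding ex.isOpenEmbedding, ← EucAt.of_openEmbedding hE1]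
      exact hE _
    have hY' := eucAt_factor (C := {d : Fin (m + 1) // d ≠ c}) hm (by simp) (fun d => adj_adj D d.1.succ)
      (fun d => adj_free D d.1.succ) (pres_YL D c) hY
    have ho : IsOpenEmbedding (inclusion (Ioc_subset_Icc_self : Ioc (0:ℝ) 1 ⊆ Icc 0 1)) := by
      refine ⟨IsEmbedding.inclusion _, ?_⟩
      have : range (inclusion (Ioc_subset_Icc_self : Ioc (0:ℝ) 1 ⊆ Icc 0 1)) =
          {t : ↥(Icc (0:ℝ) 1) | 0 < (t : ℝ)} := by
        ext t
        simp only [range_inclusion, mem_ofPred_eq, mem_Ioc]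
        exact ⟨fun h => h.1, fun h => ⟨h, t.2.2⟩⟩
      rw [this]
      exact isOpen_lt continuous_const continuous_subtype_val
    obtain ⟨E, hE1, hE2⟩ := exists_emb_YL D c (Ioc 0 1) (Icc 0 1) (fun t ht => ht.1)
        Ioc_subset_Icc_self ho
    have h3 : presMk (adj D) (adj_adj D) bz f (jc c u, t) =
        E (presMk _ _ _ f u, ⟨t, by rw [ht]; norm_num⟩) := by
      rw [hE2]
    rw [h3, HalfAt.of_openEmbedding hE1]
    let κ : ↥(Ioc (0 : ℝ) 1) → ↥(Ici (0 : ℝ)) := fun s => ⟨1 - s.1, mem_Ici.2 (by linarith [s.2.2])⟩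
    have hκ : IsOpenEmbedding κ := by
      have h1 : IsEmbedding (fun s : ↥(Ioc (0 : ℝ) 1) => 1 - s.1) :=
        (Homeomorph.subLeft (1 : ℝ)).isEmbedding.comp IsEmbedding.subtypeVal
      have h2 : IsEmbedding (Subtype.val ∘ κ) := h1
      refine ⟨IsEmbedding.of_comp ?_ continuous_subtype_val h2, ?_⟩
      · exact Continuous.subtype_mk (continuous_const.sub continuous_subtype_val) _
      · have : range κ = {t : ↥(Ici (0:ℝ)) | (t : ℝ) < 1} := by
          ext s
          constructor
          · rintro ⟨x, rfl⟩
            show 1 - x.1 < 1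
            linarith [x.2.1]
          · intro hs
            have h0 : (0:ℝ) ≤ s.1 := s.2
            have hs' : s.1 < 1 := hs
            exact ⟨⟨1 - s.1, by linarith, by linarith⟩, Subtype.ext (by simp [κ])⟩
        rw [this]
        exact isOpen_lt continuous_subtype_val continuous_const
    have hP : IsOpenEmbedding (Prod.map id κ : YL D c × ↥(Ioc (0 : ℝ) 1) → _) :=
      IsOpenEmbedding.id.prodMap hκ
    rw [← HalfAt.of_openEmbedding hP]
    exact HalfAt.prod_Ici (hY' _) _

theorem eucAt_Ici {m : ℕ} (D : GlueingDatum (m + 1))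
    (hH : ∀ z : WB D (Icc 0 1), HalfAt (m + 1) z) (z : WB D (Ici 0)) : EucAt (m + 1) z := by
  have h1 : ∀ z : WB D (Ici 0), HalfAt (m + 1) z := by
    intro z
    obtain ⟨e⟩ := exists_homeo_Ico D
    obtain ⟨E, hE1, hE2⟩ := exists_emb_Ico D
    rw [← HalfAt.of_openEmbedding e.symm.isOpenEmbedding, ← HalfAt.of_openEmbedding hE1]
    exact hH _
  obtain ⟨f, ⟨b, t⟩, rfl⟩ := (pres_WB D (Ici 0)).surj z
  obtain ⟨c, u, rfl⟩ := exists_jc b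
  obtain ⟨E, hE1, hE2⟩ := exists_emb_YF D c
  obtain ⟨y, hy⟩ := hE2 f u t
  rw [← hy, EucAt.of_openEmbedding hE1]
  refine eucAt_of_half (C := {e : Fin (m + 1 + 1) // e ≠ c.succ}) (fun e => adj_adj D e.1) (fun e => adj_free D e.1) (pres_YF D c)
    (by simp) (by omega) (fun y => ?_) y
  rw [← HalfAt.of_openEmbedding hE1]
  exact h1 _

theorem final {m : ℕ} (D : GlueingDatum (m + 1)) (hm : m = 1 ∨ m = 2 ∨ m = 3) :
    (LocEuclidean (m + 1) (GlueSpaceStar D) ↔ LocHalfEuclidean (m + 1) (TruncSpace D)) ∧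
    Nonempty (GlueSpaceStar D ≃ₜ ↥((truncBoundary D)ᶜ)) := by
  obtain ⟨e1⟩ := star_homeo D
  obtain ⟨e2⟩ := trunc_homeo D
  obtain ⟨e3⟩ := interior_homeo D
  obtain ⟨e4⟩ := exists_homeo_Ico D
  refine ⟨?_, ⟨(e1.trans e4.symm).trans e3.symm⟩⟩
  rw [locEuclidean_iff, locHalfEuclidean_iff]
  constructor
  · intro h z
    rw [← HalfAt.of_openEmbedding e2.isOpenEmbedding]
    refine halfAt_Icc D hm (fun w => ?_) _
    rw [← EucAt.of_openEmbedding e1.symm.isOpenEmbedding]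
    exact h _
  · intro h z
    rw [← EucAt.of_openEmbedding e1.isOpenEmbedding]
    refine eucAt_Ici D (fun w => ?_) _
    rw [← HalfAt.of_openEmbedding e2.symm.isOpenEmbedding]
    exact h _

end GlueAux

/-- Part (1) of the Proposition relating the main questions: for `n ∈ {2,3,4}`, the
complement `X*` of the vertices in the glued space is an open `n`-manifold if and only
if the glueing `X^∂` of the truncated simplices is an `n`-manifold with boundary, and in
this case `X*` is homeomorphic to `X^∂ ∖ ∂X^∂`. -/
theorem star_manifold_iff_trunc_manifold_with_boundary
    (n : ℕ) (hn : n = 2 ∨ n = 3 ∨ n = 4) (D : GlueingDatum n) :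
    (LocEuclidean n (GlueSpaceStar D) ↔ LocHalfEuclidean n (TruncSpace D)) ∧
    (LocEuclidean n (GlueSpaceStar D) →
      Nonempty (GlueSpaceStar D ≃ₜ ↥((truncBoundary D)ᶜ))) := by
  rcases hn with rfl | rfl | rfl
  · obtain ⟨h1, h2⟩ := GlueAux.final D (Or.inl rfl)
    exact ⟨h1, fun _ => h2⟩
  · obtain ⟨h1, h2⟩ := GlueAux.final D (Or.inr (Or.inl rfl))
    exact ⟨h1, fun _ => h2⟩
  · obtain ⟨h1, h2⟩ := GlueAux.final D (Or.inr (Or.inr rfl))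
    exact ⟨h1, fun _ => h2⟩
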